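/- arXiv:1808.10849 — 4 statements merged into one kernel-verified Lean document; each statement's English description precedes it below -/
import Mathlib

section
/- A rational singular curve δ_p in ℂP^d, d ≥ 2, has a natural group structure on its set of smooth points δ_p* such that d+1 points in δ_p* lie on a hyperplane if and only if they sum to the identity. This group is isomorphic to (ℂ, +) if the singularity of δ_p is a cusp and isomorphic to (ℂ*, ·) if the singularity is a node. If the curve is real and cuspidal or acnodal, then it has a group isomorphic to (ℝ, +) or ℝ/ℤ, respectively, such that d+1 points in δ_p* lie on a hyperplane if and only if they sum to the identity. If the curve is real and the singularity is a crunode, then the group is isomorphic to (ℝ, +) × ℤ₂, but d+1 points in δ_p* lie on a hyperplane if and only if they sum to (0,0) or to (0,1), depending on p. -/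
open scoped Pointwise
open Classical

noncomputable section

/-- `n`-dimensional projective space over `𝔽`. -/
abbrev PS (𝔽 : Type) [Field 𝔽] (n : ℕ) := Projectivization 𝔽 (Fin (n + 1) → 𝔽)

/-- A projective flat of projective dimension `r - 1` (linear rank `r`), as a set of points. -/
def IsFlatOfRank {𝔽 : Type} [Field 𝔽] {n : ℕ} (r : ℕ) (S : Set (PS 𝔽 n)) : Prop :=
  ∃ W : Submodule 𝔽 (Fin (n + 1) → 𝔽), Module.finrank 𝔽 W = r ∧ S = {x | x.submodule ≤ W}

/-- A hyperplane of `PS 𝔽 n`, as a set of points. -/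
def IsHypSet {𝔽 : Type} [Field 𝔽] {n : ℕ} (S : Set (PS 𝔽 n)) : Prop := IsFlatOfRank n S

/-- The linear span of a set of projective points. -/
def projSpan {𝔽 : Type} [Field 𝔽] {n : ℕ} (S : Set (PS 𝔽 n)) : Submodule 𝔽 (Fin (n + 1) → 𝔽) :=
  ⨆ x ∈ S, x.submodule

/-- Every `d` points of `P` span a hyperplane (of `PS 𝔽 d`). -/
def SpanEveryd {𝔽 : Type} [Field 𝔽] {n : ℕ} (d : ℕ) (P : Set (PS 𝔽 n)) : Prop :=
  ∀ S : Set (PS 𝔽 n), S ⊆ P → S.Finite → S.ncard = d → Module.finrank 𝔽 (projSpan S) = d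

/-- The hyperplanes passing through exactly `k` points of `P`. -/
def hypThrough {𝔽 : Type} [Field 𝔽] {n : ℕ} (P : Set (PS 𝔽 n)) (k : ℕ) :
    Set (Submodule 𝔽 (Fin (n + 1) → 𝔽)) :=
  {W | Module.finrank 𝔽 W = n ∧ ({x ∈ P | x.submodule ≤ W}).ncard = k}

/-- The number of hyperplanes passing through exactly `k` points of `P`.
`numHyp P n` is the number of ordinary hyperplanes of `P ⊆ PS 𝔽 n`;
`numHyp P (n+1)` is the number of `(n+1)`-point hyperplanes. -/
def numHyp {𝔽 : Type} [Field 𝔽] {n : ℕ} (P : Set (PS 𝔽 n)) (k : ℕ) : ℕ :=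
  (hypThrough P k).ncard
/-- The projective zero locus of a set of (homogeneous) polynomials. -/
def projZeroLocus {n : ℕ} (S : Set (MvPolynomial (Fin (n + 1)) ℂ)) : Set (PS ℂ n) :=
  {x | ∀ f ∈ S, ∀ v ∈ x.submodule, MvPolynomial.eval v f = 0}

/-- A (closed, projective) algebraic set in `ℂPⁿ`. -/
def IsAlg {n : ℕ} (V : Set (PS ℂ n)) : Prop :=
  ∃ S : Set (MvPolynomial (Fin (n + 1)) ℂ),
    (∀ f ∈ S, ∃ e, f.IsHomogeneous e) ∧ V = projZeroLocus S

/-- The Zariski closure of a set of points of `ℂPⁿ`. -/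
def zclosure {n : ℕ} (A : Set (PS ℂ n)) : Set (PS ℂ n) :=
  ⋂₀ {V | IsAlg V ∧ A ⊆ V}

/-- An irreducible algebraic set in `ℂPⁿ`. -/
def IsIrredAlg {n : ℕ} (V : Set (PS ℂ n)) : Prop :=
  IsAlg V ∧ V.Nonempty ∧
    ∀ V₁ V₂ : Set (PS ℂ n), IsAlg V₁ → IsAlg V₂ → V ⊆ V₁ ∪ V₂ → V ⊆ V₁ ∨ V ⊆ V₂

/-- An irreducible component of an algebraic set. -/
def IsComponentOf {n : ℕ} (C V : Set (PS ℂ n)) : Prop :=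
  IsIrredAlg C ∧ C ⊆ V ∧ ∀ C' : Set (PS ℂ n), IsIrredAlg C' → C' ⊆ V → C ⊆ C' → C = C'

/-- `V` is non-degenerate: it is not contained in a hyperplane. -/
def NonDeg {n : ℕ} (V : Set (PS ℂ n)) : Prop := ∀ S : Set (PS ℂ n), IsHypSet S → ¬V ⊆ S

/-- `V` is non-planar: it is not contained in a 2-flat. -/
def NonPlanar {n : ℕ} (V : Set (PS ℂ n)) : Prop := ∀ S : Set (PS ℂ n), IsFlatOfRank 3 S → ¬V ⊆ S

/-- A projective variety of pure dimension 1: it is algebraic, some hyperplane meets it in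
finitely many points (dimension at most 1), and every irreducible component is infinite
(dimension at least 1). -/
def IsPureCurve {n : ℕ} (V : Set (PS ℂ n)) : Prop :=
  IsAlg V ∧ (∃ S : Set (PS ℂ n), IsHypSet S ∧ (V ∩ S).Finite) ∧
    ∀ C, IsComponentOf C V → C.Infinite

/-- A curve of degree `e` in `ℂPⁿ`: a pure 1-dimensional variety such that the maximum number
of points in a finite intersection with a hyperplane is `e`. -/
def IsCurveDeg {n : ℕ} (V : Set (PS ℂ n)) (e : ℕ) : Prop :=
  IsPureCurve V ∧
    IsGreatest {m : ℕ | ∃ S : Set (PS ℂ n), IsHypSet S ∧ (V ∩ S).Finite ∧ (V ∩ S).ncard = m} e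

/-- All homogeneous polynomials vanishing on `V`. -/
def vanishingForms {n : ℕ} (V : Set (PS ℂ n)) : Set (MvPolynomial (Fin (n + 1)) ℂ) :=
  {f | (∃ e, f.IsHomogeneous e) ∧ ∀ x ∈ V, ∀ v ∈ x.submodule, MvPolynomial.eval v f = 0}

/-- The (affine cone of the) Zariski tangent space of `V` at `x`. -/
def tangentSpaceAt {n : ℕ} (V : Set (PS ℂ n)) (x : PS ℂ n) : Submodule ℂ (Fin (n + 1) → ℂ) :=
  ⨅ f ∈ vanishingForms V,
    LinearMap.ker (∑ i : Fin (n + 1),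
      MvPolynomial.eval x.rep (MvPolynomial.pderiv i f) •
        (LinearMap.proj i : (Fin (n + 1) → ℂ) →ₗ[ℂ] ℂ))

/-- A smooth point of a curve `V`: the tangent space has (affine) dimension 2. -/
def IsSmoothPt {n : ℕ} (V : Set (PS ℂ n)) (x : PS ℂ n) : Prop :=
  x ∈ V ∧ Module.finrank ℂ (tangentSpaceAt V x) = 2

/-- The set of smooth points of a curve `V`. -/
def smoothPts {n : ℕ} (V : Set (PS ℂ n)) : Set (PS ℂ n) := {x | IsSmoothPt V x}

/-- A smooth curve. -/
def IsSmoothCurve {n : ℕ} (V : Set (PS ℂ n)) : Prop := ∀ x ∈ V, IsSmoothPt V x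

/-- A real point of `ℂPⁿ`: one admitting a representative vector with real coordinates. -/
def IsRealPt {n : ℕ} (x : PS ℂ n) : Prop := ∃ v ∈ x.submodule, v ≠ 0 ∧ ∀ i, (v i).im = 0

/-- A real curve: each irreducible component contains infinitely many real points. -/
def IsRealCurve {n : ℕ} (V : Set (PS ℂ n)) : Prop :=
  ∀ C, IsComponentOf C V → {x ∈ C | IsRealPt x}.Infinite

/-- The natural embedding `ℝPⁿ → ℂPⁿ`. -/
def cx {n : ℕ} (x : PS ℝ n) : PS ℂ n :=
  Projectivization.mk ℂ (fun i => (x.rep i : ℂ)) (by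
    intro hc
    apply x.rep_nonzero
    funext i
    have h := congrFun hc i
    simp only [Pi.zero_apply] at h ⊢
    exact_mod_cast h)
/-- `q` is a (base-point-free) parametrisation of `V` by the projective line, with
homogeneous coordinate functions of degree `e`. -/
def IsParamOf {n : ℕ} (q : Fin (n + 1) → MvPolynomial (Fin 2) ℂ) (V : Set (PS ℂ n)) (e : ℕ) :
    Prop :=
  (∀ i, (q i).IsHomogeneous e) ∧
  (∀ s : Fin 2 → ℂ, s ≠ 0 → (fun i => MvPolynomial.eval s (q i)) ≠ 0) ∧
  V = {x : PS ℂ n | ∃ s : Fin 2 → ℂ, ∃ hs : (fun i => MvPolynomial.eval s (q i)) ≠ 0,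
        x = Projectivization.mk ℂ (fun i => MvPolynomial.eval s (q i)) hs}

/-- A rational curve of degree `e` in `ℂPⁿ`: can be parametrised by the projective line via
homogeneous polynomials of degree `e`. -/
def IsRationalCurve {n : ℕ} (V : Set (PS ℂ n)) (e : ℕ) : Prop := ∃ q, IsParamOf q V e

/-- An elliptic normal curve in `ℂPⁿ`: an irreducible non-degenerate smooth curve of degree
`n + 1` isomorphic to a plane elliptic curve; equivalently (since an irreducible
non-degenerate curve of degree `n + 1` in `ℂPⁿ` is either an elliptic normal curve or
rational), such a smooth curve that is not rational. -/
def IsEllipticNormal {n : ℕ} (V : Set (PS ℂ n)) : Prop :=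
  IsIrredAlg V ∧ NonDeg V ∧ IsCurveDeg V (n + 1) ∧ IsSmoothCurve V ∧ ¬∃ e, IsRationalCurve V e

/-- A rational singular curve: an irreducible non-degenerate singular rational curve of degree
`n + 1` in `ℂPⁿ`. -/
def IsRationalSingular {n : ℕ} (V : Set (PS ℂ n)) : Prop :=
  IsIrredAlg V ∧ NonDeg V ∧ IsCurveDeg V (n + 1) ∧ IsRationalCurve V (n + 1) ∧ ¬IsSmoothCurve V

/-- The parametrisation `q` is injective as a map on the projective line. -/
def ParamInjective {n : ℕ} (q : Fin (n + 1) → MvPolynomial (Fin 2) ℂ) : Prop :=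
  ∀ s t : Fin 2 → ℂ, s ≠ 0 → t ≠ 0 →
    (∃ c : ℂ, c ≠ 0 ∧
      (fun i => MvPolynomial.eval s (q i)) = c • fun i => MvPolynomial.eval t (q i)) →
    ∃ c : ℂ, c ≠ 0 ∧ s = c • t

/-- A parametrisation with real coefficients. -/
def IsRealParam {n : ℕ} (q : Fin (n + 1) → MvPolynomial (Fin 2) ℂ) : Prop :=
  ∀ i m, ((q i).coeff m).im = 0

/-- A rational cuspidal curve: the singularity is a cusp, i.e. the parametrisation is
injective. -/
def IsCuspidalCurve {n : ℕ} (V : Set (PS ℂ n)) : Prop :=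
  IsRationalSingular V ∧ ∃ q, IsParamOf q V (n + 1) ∧ ParamInjective q

/-- A rational acnodal curve: a real rational singular curve whose singularity is a node whose
two branches correspond to a pair of complex-conjugate (non-real) parameter values of a real
parametrisation. -/
def IsAcnodalCurve {n : ℕ} (V : Set (PS ℂ n)) : Prop :=
  IsRationalSingular V ∧ IsRealCurve V ∧
  ∃ q, IsParamOf q V (n + 1) ∧ IsRealParam q ∧
    ∃ s t : Fin 2 → ℂ, s ≠ 0 ∧ t ≠ 0 ∧ (¬∃ c : ℂ, s = c • t) ∧
      (∃ c : ℂ, c ≠ 0 ∧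
        (fun i => MvPolynomial.eval s (q i)) = c • fun i => MvPolynomial.eval t (q i)) ∧
      (∃ c : ℂ, c ≠ 0 ∧ t = c • fun j => starRingEnd ℂ (s j))

/-- A rational crunodal curve: a real rational singular curve whose singularity is a node whose
two branches correspond to two distinct real parameter values of a real parametrisation. -/
def IsCrunodalCurve {n : ℕ} (V : Set (PS ℂ n)) : Prop :=
  IsRationalSingular V ∧ IsRealCurve V ∧
  ∃ q, IsParamOf q V (n + 1) ∧ IsRealParam q ∧
    ∃ s t : Fin 2 → ℂ, s ≠ 0 ∧ t ≠ 0 ∧ (¬∃ c : ℂ, s = c • t) ∧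
      (∀ j, (s j).im = 0) ∧ (∀ j, (t j).im = 0) ∧
      (∃ c : ℂ, c ≠ 0 ∧
        (fun i => MvPolynomial.eval s (q i)) = c • fun i => MvPolynomial.eval t (q i))
/-- An abelian group structure on a ground type `α`, given explicitly by its operations. -/
structure AbGrp (α : Type*) where
  add : α → α → α
  zero : α
  neg : α → α
  add_assoc' : ∀ a b c, add (add a b) c = add a (add b c)
  add_comm' : ∀ a b, add a b = add b a
  zero_add' : ∀ a, add zero a = a
  neg_add' : ∀ a, add (neg a) a = zero

/-- The sum of a finite tuple in an `AbGrp`. -/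
def AbGrp.sumFin {α : Type*} (A : AbGrp α) {k : ℕ} (x : Fin k → α) : α :=
  (List.ofFn x).foldr A.add A.zero

/-- `k`-fold sum of an element in an `AbGrp`. -/
def AbGrp.nsmul {α : Type*} (A : AbGrp α) : ℕ → α → α
  | 0, _ => A.zero
  | k + 1, a => A.add a (A.nsmul k a)

/-- Subtraction in an `AbGrp`. -/
def AbGrp.sub {α : Type*} (A : AbGrp α) (a b : α) : α := A.add a (A.neg b)

/-- Two `AbGrp`s are isomorphic. -/
def AbGrp.Iso {α β : Type*} (A : AbGrp α) (B : AbGrp β) : Prop :=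
  ∃ φ : α ≃ β, ∀ a b, φ (A.add a b) = B.add (φ a) (φ b)

/-- A subgroup of an `AbGrp`, as a subset. -/
def AbGrp.IsSubgroup {α : Type*} (A : AbGrp α) (H : Set α) : Prop :=
  A.zero ∈ H ∧ (∀ a ∈ H, ∀ b ∈ H, A.add a b ∈ H) ∧ ∀ a ∈ H, A.neg a ∈ H

/-- The coset `H ⊕ x` of a subset `H` of an `AbGrp`. -/
def AbGrp.coset {α : Type*} (A : AbGrp α) (H : Set α) (x : α) : Set α :=
  {y | ∃ h ∈ H, y = A.add h x}

/-- The `AbGrp` underlying an additive commutative group. -/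
def AbGrp.ofGroup (β : Type*) [AddCommGroup β] : AbGrp β :=
  ⟨(· + ·), 0, Neg.neg, add_assoc, add_comm, zero_add, fun a => by simp⟩

open Finset in
/-- The point with parameter `(u : v)` on the curve of degree `d + 1` with coefficient vectors
`Q 0, …, Q (d + 1)`. -/
def paramPt {d : ℕ} (Q : ℕ → Fin (d + 1) → ℂ) (u v : ℂ) : Fin (d + 1) → ℂ :=
  ∑ i ∈ range (d + 2), (u ^ (d + 1 - i) * v ^ i) • Q i

/-- The vectors `Q 0, …, Q (d + 1)` are the coefficients of a base-point-free parametrisation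
of `δ`, and they span the ambient space. -/
structure IsFrame {d : ℕ} (δ : Set (PS ℂ d)) (Q : ℕ → Fin (d + 1) → ℂ) : Prop where
  ne_zero : ∀ u v : ℂ, (u ≠ 0 ∨ v ≠ 0) → paramPt Q u v ≠ 0
  mem_iff : ∀ x, x ∈ δ ↔ ∃ u v : ℂ, (u ≠ 0 ∨ v ≠ 0) ∧ paramPt Q u v ∈ x.submodule
  dual_eq_zero : ∀ l : Module.Dual ℂ (Fin (d + 1) → ℂ), (∀ i < d + 2, l (Q i) = 0) → l = 0

section Projective

variable {n : ℕ}

theorem mk_eq_of_mem_submodule {x : PS ℂ n} {y : Fin (n + 1) → ℂ} (hy : y ≠ 0)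
    (h : y ∈ x.submodule) : Projectivization.mk ℂ y hy = x := by
  induction x using Projectivization.ind with
  | h w hw =>
    rw [Projectivization.submodule_mk, Submodule.mem_span_singleton] at h
    rw [Projectivization.mk_eq_mk_iff']
    exact h

theorem mem_submodule_iff_exists_smul {x : PS ℂ n} {y : Fin (n + 1) → ℂ} (hy : y ≠ 0)
    (h : y ∈ x.submodule) (z : Fin (n + 1) → ℂ) : z ∈ x.submodule ↔ ∃ c : ℂ, z = c • y := by
  rw [← mk_eq_of_mem_submodule hy h, Projectivization.submodule_mk, Submodule.mem_span_singleton]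
  exact ⟨fun ⟨c, hc⟩ => ⟨c, hc.symm⟩, fun ⟨c, hc⟩ => ⟨c, hc.symm⟩⟩

theorem submodule_le_iff_mem {x : PS ℂ n} {y : Fin (n + 1) → ℂ} (hy : y ≠ 0)
    (h : y ∈ x.submodule) (W : Submodule ℂ (Fin (n + 1) → ℂ)) : x.submodule ≤ W ↔ y ∈ W := by
  rw [← mk_eq_of_mem_submodule hy h, Projectivization.submodule_mk,
    Submodule.span_singleton_le_iff_mem]

theorem eval_smul_of_isHomogeneous {σ : Type*} {f : MvPolynomial σ ℂ} {e : ℕ}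
    (hf : f.IsHomogeneous e) (c : ℂ) (y : σ → ℂ) :
    MvPolynomial.eval (c • y) f = c ^ e * MvPolynomial.eval y f := by
  rw [MvPolynomial.eval_eq, MvPolynomial.eval_eq, Finset.mul_sum]
  refine Finset.sum_congr rfl fun m hm => ?_
  have hdeg := hf.degree_eq_sum_deg_support hm
  have : c ^ e = ∏ i ∈ m.support, c ^ m i := by
    rw [Finset.prod_pow_eq_pow_sum, hdeg]
  rw [this]
  simp only [Pi.smul_apply, smul_eq_mul, mul_pow, Finset.prod_mul_distrib]
  ring

theorem mem_tangentSpaceAt_iff {V : Set (PS ℂ n)} {x : PS ℂ n} {y : Fin (n + 1) → ℂ}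
    (hy : y ≠ 0) (h : y ∈ x.submodule) (z : Fin (n + 1) → ℂ) :
    z ∈ tangentSpaceAt V x ↔ ∀ f ∈ vanishingForms V,
      ∑ i, MvPolynomial.eval y (MvPolynomial.pderiv i f) * z i = 0 := by
  obtain ⟨c, hc⟩ := (mem_submodule_iff_exists_smul hy h x.rep).1 (by
    rw [Projectivization.submodule_eq]; exact Submodule.mem_span_singleton_self _)
  have hc0 : c ≠ 0 := by
    rintro rfl
    exact x.rep_nonzero (by rw [hc, zero_smul])
  unfold tangentSpaceAt
  simp only [Submodule.mem_iInf, LinearMap.mem_ker, LinearMap.sum_apply, LinearMap.smul_apply,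
    LinearMap.proj_apply, smul_eq_mul]
  refine forall₂_congr fun f hf => ?_
  obtain ⟨⟨e, he⟩, -⟩ := hf
  rw [hc]
  simp only [eval_smul_of_isHomogeneous (he.pderiv), mul_assoc, ← Finset.mul_sum]
  simp [hc0]

theorem isHypSet_iff_exists_dual {ι : Type*} (x : ι → PS ℂ n) (y : ι → Fin (n + 1) → ℂ)
    (hy : ∀ i, y i ≠ 0) (h : ∀ i, y i ∈ (x i).submodule) :
    (∃ S : Set (PS ℂ n), IsHypSet S ∧ ∀ i, x i ∈ S) ↔
      ∃ l : Module.Dual ℂ (Fin (n + 1) → ℂ), l ≠ 0 ∧ ∀ i, l (y i) = 0 := by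
  constructor
  · rintro ⟨S, ⟨W, hW, rfl⟩, hS⟩
    have hlt : W < ⊤ := by
      rw [lt_top_iff_ne_top]
      rintro rfl
      simp at hW
    obtain ⟨l, hl, hle⟩ := Submodule.exists_le_ker_of_lt_top W hlt
    exact ⟨l, hl, fun i => hle ((submodule_le_iff_mem (hy i) (h i) W).1 (hS i))⟩
  · rintro ⟨l, hl, hl'⟩
    refine ⟨_, ⟨LinearMap.ker l, ?_, rfl⟩, fun i =>
      (submodule_le_iff_mem (hy i) (h i) _).2 (hl' i)⟩
    have := Module.Dual.finrank_ker_add_one_of_ne_zero hl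
    simpa using this

theorem sum_C_pderiv_mul_X (p : MvPolynomial (Fin (n + 1)) ℂ) (j : Fin (n + 1))
    (y : Fin (n + 1) → ℂ) (R : Fin (n + 1) → Polynomial ℂ) :
    ∑ i, Polynomial.C (MvPolynomial.eval y (MvPolynomial.pderiv i (p * MvPolynomial.X j))) * R i
      = (∑ i, Polynomial.C (MvPolynomial.eval y (MvPolynomial.pderiv i p)) * R i)
          * Polynomial.C (y j)
        + Polynomial.C (MvPolynomial.eval y p) * R j := by
  have h : ∀ i, Polynomial.C (MvPolynomial.eval y
        (MvPolynomial.pderiv i (p * MvPolynomial.X j))) * R i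
      = Polynomial.C (MvPolynomial.eval y (MvPolynomial.pderiv i p)) * R i * Polynomial.C (y j)
        + if i = j then Polynomial.C (MvPolynomial.eval y p) * R i else 0 := by
    intro i
    rw [MvPolynomial.pderiv_mul, map_add, map_mul, map_mul, MvPolynomial.eval_X]
    by_cases hij : i = j
    · subst hij
      rw [MvPolynomial.pderiv_X_self]
      simp only [map_one, mul_one, map_add, map_mul, if_true]
      ring
    · rw [MvPolynomial.pderiv_X_of_ne (Ne.symm hij)]
      simp only [map_zero, mul_zero, add_zero, map_mul, if_neg hij]
      ring
  rw [Finset.sum_congr rfl fun i _ => h i, Finset.sum_add_distrib, Finset.sum_mul]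
  simp

/-- First-order Taylor expansion of a polynomial along a polynomial arc. -/
theorem dvd_aeval_sub_taylor (f : MvPolynomial (Fin (n + 1)) ℂ) (y : Fin (n + 1) → ℂ) (k : ℕ)
    (R : Fin (n + 1) → Polynomial ℂ) :
    Polynomial.X ^ (2 * k) ∣
      MvPolynomial.aeval (fun i => Polynomial.C (y i) + Polynomial.X ^ k * R i) f
        - (Polynomial.C (MvPolynomial.eval y f) + Polynomial.X ^ k *
          ∑ i, Polynomial.C (MvPolynomial.eval y (MvPolynomial.pderiv i f)) * R i) := by
  induction f using MvPolynomial.induction_on with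
  | C a => simp
  | add p q hp hq =>
    obtain ⟨a, ha⟩ := hp
    obtain ⟨b, hb⟩ := hq
    refine ⟨a + b, ?_⟩
    simp only [map_add, add_mul, Finset.sum_add_distrib, mul_add]
    rw [← ha, ← hb]
    ring
  | mul_X p j hp =>
    obtain ⟨a, ha⟩ := hp
    have key := sum_C_pderiv_mul_X p j y R
    rw [sub_eq_iff_eq_add] at ha
    refine ⟨a * (Polynomial.C (y j) + Polynomial.X ^ k * R j) +
      (∑ i, Polynomial.C (MvPolynomial.eval y (MvPolynomial.pderiv i p)) * R i) * R j, ?_⟩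
    rw [key]
    simp only [map_mul, MvPolynomial.aeval_X, MvPolynomial.eval_X]
    rw [ha, two_mul, pow_add]
    ring

theorem sum_pderiv_mul_coeff_eq_zero {f : MvPolynomial (Fin (n + 1)) ℂ} {y : Fin (n + 1) → ℂ}
    {k : ℕ} {R : Fin (n + 1) → Polynomial ℂ}
    (h : MvPolynomial.aeval (fun i => Polynomial.C (y i) + Polynomial.X ^ k * R i) f = 0)
    (hy : MvPolynomial.eval y f = 0) {j : ℕ} (hj : j < k) :
    ∑ i, MvPolynomial.eval y (MvPolynomial.pderiv i f) * (R i).coeff j = 0 := by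
  have := dvd_aeval_sub_taylor f y k R
  rw [h, hy, map_zero, zero_add, zero_sub, dvd_neg] at this
  rw [two_mul, pow_add, mul_dvd_mul_iff_left (pow_ne_zero _ Polynomial.X_ne_zero),
    Polynomial.X_pow_dvd_iff] at this
  simpa [Polynomial.finsetSum_coeff] using this j hj

theorem sum_pderiv_mul_self_eq_zero {f : MvPolynomial (Fin (n + 1)) ℂ} {y : Fin (n + 1) → ℂ}
    {e : ℕ} (hf : f.IsHomogeneous e) (hy : MvPolynomial.eval y f = 0) :
    ∑ i, MvPolynomial.eval y (MvPolynomial.pderiv i f) * y i = 0 := by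
  have := congrArg (MvPolynomial.eval y) hf.sum_X_mul_pderiv
  simp only [map_sum, map_mul, MvPolynomial.eval_X, map_nsmul, hy, smul_zero] at this
  simpa [mul_comm] using this

end Projective

section Frame

open Polynomial

variable {d : ℕ} {δ : Set (PS ℂ d)} {Q : ℕ → Fin (d + 1) → ℂ}

theorem paramPt_one_zero : paramPt Q 1 0 = Q 0 := by
  simp [paramPt, Finset.sum_range_succ']

theorem paramPt_zero_one : paramPt Q 0 1 = Q (d + 1) := by
  unfold paramPt
  rw [Finset.sum_eq_single (d + 1)]
  · simp
  · intro i hi hne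
    rw [Finset.mem_range] at hi
    rw [zero_pow (by omega)]
    simp
  · simp

theorem paramPt_smul (c u v : ℂ) : paramPt Q (c * u) (c * v) = c ^ (d + 1) • paramPt Q u v := by
  unfold paramPt
  rw [Finset.smul_sum]
  refine Finset.sum_congr rfl fun i hi => ?_
  rw [Finset.mem_range] at hi
  have h : c ^ (d + 1) = c ^ (d + 1 - i) * c ^ i := by
    rw [← pow_add]
    congr 1
    omega
  rw [smul_smul, mul_pow, mul_pow, h]
  congr 1
  ring

theorem continuous_paramPt_left (v : ℂ) : Continuous fun u => paramPt Q u v := by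
  unfold paramPt
  fun_prop

theorem exists_dual_of_relation
    (hQ : ∀ l : Module.Dual ℂ (Fin (d + 1) → ℂ), (∀ i < d + 2, l (Q i) = 0) → l = 0)
    {r : ℕ → ℂ} (hr : ∃ i < d + 2, r i ≠ 0)
    (hrel : ∑ i ∈ Finset.range (d + 2), r i • Q i = 0) (a : ℕ → ℂ)
    (ha : ∑ i ∈ Finset.range (d + 2), r i * a i = 0) :
    ∃ l : Module.Dual ℂ (Fin (d + 1) → ℂ), ∀ i < d + 2, l (Q i) = a i := by
  let E : Module.Dual ℂ (Fin (d + 1) → ℂ) →ₗ[ℂ] (Fin (d + 2) → ℂ) :=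
    LinearMap.pi fun i => LinearMap.applyₗ (Q i)
  let φ : Module.Dual ℂ (Fin (d + 2) → ℂ) := ∑ i : Fin (d + 2), r i • LinearMap.proj i
  have hE : Function.Injective E := by
    rw [← LinearMap.ker_eq_bot, LinearMap.ker_eq_bot']
    intro l hl
    exact hQ l fun i hi => congrFun hl ⟨i, hi⟩
  have hφ : φ ≠ 0 := by
    obtain ⟨i, hi, hri⟩ := hr
    intro h
    have := LinearMap.congr_fun h (Pi.single ⟨i, hi⟩ 1)
    simp only [φ, LinearMap.sum_apply, LinearMap.smul_apply, LinearMap.proj_apply,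
      Pi.single_apply, smul_eq_mul, mul_ite, mul_one, mul_zero, Finset.sum_ite_eq',
      Finset.mem_univ, if_true, LinearMap.zero_apply] at this
    exact hri this
  have hle : LinearMap.range E ≤ LinearMap.ker φ := by
    rintro _ ⟨l, rfl⟩
    have h0 := congrArg l hrel
    rw [map_sum, map_zero, Finset.sum_range] at h0
    simpa [φ, E] using h0
  have hfin : Module.finrank ℂ (LinearMap.range E) = Module.finrank ℂ (LinearMap.ker φ) := by
    have h1 := Module.Dual.finrank_ker_add_one_of_ne_zero hφ
    have h2 := LinearMap.finrank_range_of_inj hE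
    rw [Subspace.dual_finrank_eq] at h2
    simp only [Module.finrank_fin_fun] at h1 h2
    omega
  have heq := Submodule.eq_of_le_of_finrank_eq hle hfin
  have hmem : (fun i : Fin (d + 2) => a i) ∈ LinearMap.range E := by
    rw [heq, LinearMap.mem_ker]
    rw [Finset.sum_range] at ha
    simpa [φ] using ha
  obtain ⟨l, hl⟩ := hmem
  exact ⟨l, fun i hi => congrFun hl ⟨i, hi⟩⟩

theorem exists_relation (Q : ℕ → Fin (d + 1) → ℂ) :
    ∃ r : ℕ → ℂ, (∃ i < d + 2, r i ≠ 0) ∧ ∑ i ∈ Finset.range (d + 2), r i • Q i = 0 := by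
  have h : ¬LinearIndependent ℂ fun i : Fin (d + 2) => Q i := by
    intro h
    have := h.fintype_card_le_finrank
    simp at this
  rw [Fintype.not_linearIndependent_iff] at h
  obtain ⟨g, hg, i, hi⟩ := h
  refine ⟨fun k => if hk : k < d + 2 then g ⟨k, hk⟩ else 0, ⟨i, i.2, by simpa using hi⟩, ?_⟩
  rw [Finset.sum_range]
  simpa using hg

/-- The restriction of a linear functional to the curve, in the affine chart `u = 1`. -/
def dualPoly (Q : ℕ → Fin (d + 1) → ℂ) : Module.Dual ℂ (Fin (d + 1) → ℂ) →ₗ[ℂ] ℂ[X] :=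
  ∑ i ∈ Finset.range (d + 2), (monomial i).comp (LinearMap.applyₗ (Q i))

theorem dualPoly_apply (l : Module.Dual ℂ (Fin (d + 1) → ℂ)) :
    dualPoly Q l = ∑ i ∈ Finset.range (d + 2), monomial i (l (Q i)) := by
  simp [dualPoly]

theorem coeff_dualPoly (l : Module.Dual ℂ (Fin (d + 1) → ℂ)) (i : ℕ) :
    (dualPoly Q l).coeff i = if i < d + 2 then l (Q i) else 0 := by
  simp [dualPoly_apply, coeff_monomial]

theorem eval_dualPoly (l : Module.Dual ℂ (Fin (d + 1) → ℂ)) (v : ℂ) :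
    (dualPoly Q l).eval v = l (paramPt Q 1 v) := by
  simp [dualPoly_apply, paramPt, eval_finsetSum, mul_comm]

theorem dualPoly_mem_degreeLT (l : Module.Dual ℂ (Fin (d + 1) → ℂ)) :
    dualPoly Q l ∈ degreeLT ℂ (d + 2) := by
  rw [mem_degreeLT, degree_lt_iff_coeff_zero]
  intro m hm
  rw [coeff_dualPoly, if_neg (by omega)]

/-- The polynomials of degree at most `d + 1` cut out on the curve by hyperplanes. -/
def sections (Q : ℕ → Fin (d + 1) → ℂ) : Submodule ℂ ℂ[X] := LinearMap.range (dualPoly Q)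

/-- The sections vanishing at the parameter `0`, divided by `X`. -/
def residualSections (Q : ℕ → Fin (d + 1) → ℂ) : Submodule ℂ ℂ[X] :=
  degreeLT ℂ (d + 1) ⊓ (sections Q).comap (LinearMap.mulLeft ℂ X)

theorem mem_sections_of_relation
    (hQ : ∀ l : Module.Dual ℂ (Fin (d + 1) → ℂ), (∀ i < d + 2, l (Q i) = 0) → l = 0)
    {r : ℕ → ℂ} (hr : ∃ i < d + 2, r i ≠ 0)
    (hrel : ∑ i ∈ Finset.range (d + 2), r i • Q i = 0) {f : ℂ[X]} (hf : f ∈ degreeLT ℂ (d + 2))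
    (ha : ∑ i ∈ Finset.range (d + 2), r i * f.coeff i = 0) : f ∈ sections Q := by
  obtain ⟨l, hl⟩ := exists_dual_of_relation hQ hr hrel f.coeff ha
  refine ⟨l, ?_⟩
  ext i
  rw [coeff_dualPoly]
  split_ifs with h
  · exact hl i h
  · rw [mem_degreeLT, degree_lt_iff_coeff_zero] at hf
    exact (hf i (by omega)).symm

theorem degreeLT_two_mul_le (n : ℕ) : degreeLT ℂ 2 * degreeLT ℂ n ≤ degreeLT ℂ (n + 1) := by
  rw [Submodule.mul_le]
  intro f hf g hg
  rw [mem_degreeLT] at *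
  rcases eq_or_ne f 0 with rfl | hf0
  · simp
  rcases eq_or_ne g 0 with rfl | hg0
  · simp
  rw [degree_mul, degree_eq_natDegree hf0, degree_eq_natDegree hg0] at *
  norm_cast at *
  omega

/-- The relation `r`, shifted by one, is not an evaluation at a point of the projective line. -/
def NotGeometric (d : ℕ) (r : ℕ → ℂ) : Prop :=
  ∀ α β : ℂ, (∀ i < d, α * r (i + 2) = β * r (i + 1)) → α = 0 ∧ β = 0

variable {r : ℕ → ℂ}

theorem X_mul_mem_degreeLT {n : ℕ} {f : ℂ[X]} (hf : f ∈ degreeLT ℂ n) :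
    X * f ∈ degreeLT ℂ (n + 1) :=
  degreeLT_two_mul_le n (Submodule.mul_mem_mul (by
    rw [mem_degreeLT, degree_X]
    norm_num) hf)

theorem mem_residualSections_of_relation
    (hQ : ∀ l : Module.Dual ℂ (Fin (d + 1) → ℂ), (∀ i < d + 2, l (Q i) = 0) → l = 0)
    (hr : ∃ i < d + 2, r i ≠ 0) (hrel : ∑ i ∈ Finset.range (d + 2), r i • Q i = 0)
    {w : ℂ[X]} (hw : w ∈ degreeLT ℂ (d + 1))
    (ha : ∑ i ∈ Finset.range (d + 1), r (i + 1) * w.coeff i = 0) : w ∈ residualSections Q := by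
  refine ⟨hw, mem_sections_of_relation hQ hr hrel (X_mul_mem_degreeLT hw) ?_⟩
  rw [Finset.sum_range_succ']
  simpa [coeff_X_mul] using ha

theorem degreeLT_le_residualSections_mul
    (hQ : ∀ l : Module.Dual ℂ (Fin (d + 1) → ℂ), (∀ i < d + 2, l (Q i) = 0) → l = 0)
    (hr : ∃ i < d + 2, r i ≠ 0) (hrel : ∑ i ∈ Finset.range (d + 2), r i • Q i = 0)
    (hj : ∃ j < d + 1, r (j + 1) ≠ 0) (hng : NotGeometric d r) :
    degreeLT ℂ (d + 2) ≤ residualSections Q * degreeLT ℂ 2 := by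
  intro f hf
  by_contra hf'
  obtain ⟨m, hmf, hm⟩ := Submodule.exists_le_ker_of_notMem hf'
  obtain ⟨j, hjd, hj⟩ := hj
  have hX : (X : ℂ[X]) ∈ degreeLT ℂ 2 := by rw [mem_degreeLT, degree_X]; norm_num
  have h1 : (1 : ℂ[X]) ∈ degreeLT ℂ 2 := by rw [mem_degreeLT, degree_one]; norm_num
  have hW : ∀ i < d + 1, C (r (j + 1)) * X ^ i - C (r (i + 1)) * X ^ j ∈ residualSections Q := by
    intro i hi
    have hpow : ∀ (c : ℂ) (k : ℕ), k < d + 1 → C c * X ^ k ∈ degreeLT ℂ (d + 1) := by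
      intro c k hk
      rw [mem_degreeLT]
      exact (degree_C_mul_X_pow_le k c).trans_lt (by exact_mod_cast hk)
    refine mem_residualSections_of_relation hQ hr hrel
      (Submodule.sub_mem _ (hpow _ _ hi) (hpow _ _ hjd)) ?_
    simp only [coeff_sub, coeff_C_mul, coeff_X_pow, mul_sub, mul_ite, mul_one, mul_zero,
      Finset.sum_sub_distrib, Finset.sum_ite_eq', Finset.mem_range, hi, hjd, if_true]
    ring
  have hm1 : ∀ i < d + 1, m (X ^ i) = m (X ^ j) / r (j + 1) * r (i + 1) := by
    intro i hi
    have : m _ = 0 := hm (Submodule.mul_mem_mul (hW i hi) h1)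
    rw [mul_one, map_sub, ← smul_eq_C_mul, ← smul_eq_C_mul, map_smul, map_smul, smul_eq_mul,
      smul_eq_mul] at this
    field_simp
    linear_combination this
  have hm2 : ∀ i < d + 1, m (X ^ (i + 1)) = m (X ^ (j + 1)) / r (j + 1) * r (i + 1) := by
    intro i hi
    have : m _ = 0 := hm (Submodule.mul_mem_mul (hW i hi) hX)
    rw [sub_mul, mul_assoc, mul_assoc, ← pow_succ, ← pow_succ, map_sub, ← smul_eq_C_mul,
      ← smul_eq_C_mul, map_smul, map_smul, smul_eq_mul, smul_eq_mul] at this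
    field_simp
    linear_combination this
  obtain ⟨hα, hβ⟩ := hng (m (X ^ j) / r (j + 1)) (m (X ^ (j + 1)) / r (j + 1)) fun i hi => by
    rw [← hm2 i (by omega), ← hm1 (i + 1) (by omega)]
  refine hmf ?_
  rw [mem_degreeLT] at hf
  rw [f.as_sum_range' (d + 2) (by
    rcases eq_or_ne f 0 with rfl | h
    · simp
    · rwa [natDegree_lt_iff_degree_lt h]), map_sum]
  refine Finset.sum_eq_zero fun i hi => ?_
  rw [Finset.mem_range] at hi
  rw [← C_mul_X_pow_eq_monomial, ← smul_eq_C_mul, map_smul]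
  rcases i with _ | i
  · rw [hm1 0 (by omega), hα]; simp
  · rw [hm2 i (by omega), hβ]; simp

end Frame

section Smoothness

open Polynomial

variable {d : ℕ} {δ : Set (PS ℂ d)} {Q : ℕ → Fin (d + 1) → ℂ} {r : ℕ → ℂ}

theorem mem_mul_of_le {U V W : Submodule ℂ ℂ[X]} (h : V ≤ W) {f : ℂ[X]} (hf : f ∈ U * V) :
    f ∈ U * W :=
  Submodule.mul_le.2 (fun _ hu _ hv => Submodule.mul_mem_mul hu (h hv)) hf

theorem exists_section_conductor
    (hQ : ∀ l : Module.Dual ℂ (Fin (d + 1) → ℂ), (∀ i < d + 2, l (Q i) = 0) → l = 0)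
    (hQ0 : Q 0 ≠ 0)
    (hr : ∃ i < d + 2, r i ≠ 0) (hrel : ∑ i ∈ Finset.range (d + 2), r i • Q i = 0)
    (hj : ∃ j < d + 1, r (j + 1) ≠ 0) (hng : NotGeometric d r) :
    ∃ H ∈ sections Q, H.coeff 0 = 1 ∧
      ∀ f ∈ degreeLT ℂ (d + 1), f * H ∈ residualSections Q * sections Q := by
  have hle := degreeLT_le_residualSections_mul hQ hr hrel hj hng
  obtain ⟨j, hjd, hj⟩ := hj
  have he : (X ^ j : ℂ[X]) ∈ degreeLT ℂ (d + 1) := by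
    rw [mem_degreeLT, degree_X_pow]
    exact_mod_cast hjd
  have hdecU : ∀ f ∈ degreeLT ℂ (d + 2), ∃ c : ℂ, f - c • (X * X ^ j) ∈ sections Q := by
    intro f hf
    refine ⟨(∑ i ∈ Finset.range (d + 2), r i * f.coeff i) / r (j + 1),
      mem_sections_of_relation hQ hr hrel
        (Submodule.sub_mem _ hf (Submodule.smul_mem _ _ (X_mul_mem_degreeLT he))) ?_⟩
    rw [← pow_succ']
    simp only [coeff_sub, coeff_smul, coeff_X_pow, smul_eq_mul, mul_sub, mul_ite, mul_one,
      mul_zero, Finset.sum_sub_distrib, Finset.sum_ite_eq', Finset.mem_range,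
      show j + 1 < d + 2 by omega, if_true]
    field_simp
    ring
  have hdecW : ∀ f ∈ degreeLT ℂ (d + 1), ∃ c : ℂ, f - c • X ^ j ∈ residualSections Q := by
    intro f hf
    obtain ⟨c, hc⟩ := hdecU _ (X_mul_mem_degreeLT hf)
    refine ⟨c, Submodule.sub_mem _ hf (Submodule.smul_mem _ _ he), ?_⟩
    simpa [mul_sub] using hc
  obtain ⟨l, hl⟩ : ∃ l : Module.Dual ℂ (Fin (d + 1) → ℂ), l (Q 0) = 1 := by
    obtain ⟨i, hi⟩ := Function.ne_iff.1 hQ0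
    exact ⟨(Q 0 i)⁻¹ • LinearMap.proj i, by simpa using inv_mul_cancel₀ hi⟩
  have hdec : ∀ k ∈ residualSections Q * degreeLT ℂ (d + 2),
      ∃ w ∈ residualSections Q, k - w * (X * X ^ j) ∈ residualSections Q * sections Q := by
    intro k hk
    induction hk using Submodule.mul_induction_on' with
    | mem_mul_mem w hw f hf =>
      obtain ⟨c, hc⟩ := hdecU f hf
      refine ⟨c • w, Submodule.smul_mem _ _ hw, ?_⟩
      convert Submodule.mul_mem_mul hw hc using 1
      rw [mul_sub, smul_mul_assoc, mul_smul_comm]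
    | add a _ b _ ha hb =>
      obtain ⟨w, hw, ha⟩ := ha
      obtain ⟨w', hw', hb⟩ := hb
      refine ⟨w + w', Submodule.add_mem _ hw hw', ?_⟩
      convert Submodule.add_mem _ ha hb using 1
      ring
  have hmem : dualPoly Q l * X ^ j ∈ residualSections Q * degreeLT ℂ (d + 2) := by
    have := Submodule.mul_mem_mul (hle (dualPoly_mem_degreeLT (Q := Q) l)) he
    rw [mul_assoc] at this
    exact mem_mul_of_le (degreeLT_two_mul_le (d + 1)) this
  obtain ⟨w, hw, hmem⟩ := hdec _ hmem
  have hH : dualPoly Q l - X * w ∈ sections Q := Submodule.sub_mem _ ⟨l, rfl⟩ hw.2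
  refine ⟨dualPoly Q l - X * w, hH, ?_, fun f hf => ?_⟩
  · simp [coeff_dualPoly, hl]
  · obtain ⟨c, hc⟩ := hdecW f hf
    have h1 := Submodule.mul_mem_mul hc hH
    convert Submodule.add_mem _ h1 (Submodule.smul_mem _ c hmem) using 1
    simp only [smul_eq_C_mul]
    ring

/-- The linear form attached to a linear functional. -/
def linForm (l : Module.Dual ℂ (Fin (d + 1) → ℂ)) : MvPolynomial (Fin (d + 1)) ℂ :=
  ∑ i, MvPolynomial.C (l (Pi.single i 1)) * MvPolynomial.X i

theorem eval_linForm (l : Module.Dual ℂ (Fin (d + 1) → ℂ)) (y : Fin (d + 1) → ℂ) :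
    MvPolynomial.eval y (linForm l) = l y := by
  simp only [linForm, map_sum, map_mul, MvPolynomial.eval_C, MvPolynomial.eval_X]
  conv_rhs => rw [← Finset.univ_sum_single y, map_sum]
  refine Finset.sum_congr rfl fun i _ => ?_
  rw [mul_comm, ← smul_eq_mul, ← map_smul, ← Pi.single_smul, smul_eq_mul, mul_one]

theorem pderiv_linForm (l : Module.Dual ℂ (Fin (d + 1) → ℂ)) (i : Fin (d + 1)) :
    MvPolynomial.pderiv i (linForm l) = MvPolynomial.C (l (Pi.single i 1)) := by
  rw [linForm, map_sum, Finset.sum_eq_single i]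
  · rw [MvPolynomial.pderiv_C_mul, MvPolynomial.pderiv_X_self, mul_one]
  · intro j _ hji
    rw [MvPolynomial.pderiv_C_mul, MvPolynomial.pderiv_X_of_ne hji, mul_zero]
  · simp

theorem isHomogeneous_linForm (l : Module.Dual ℂ (Fin (d + 1) → ℂ)) :
    (linForm l).IsHomogeneous 1 :=
  MvPolynomial.IsHomogeneous.sum _ _ _ fun i _ => MvPolynomial.isHomogeneous_C_mul_X _ i

theorem exists_linForm_residual {w : ℂ[X]} (hw : w ∈ residualSections Q) :
    ∃ l : Module.Dual ℂ (Fin (d + 1) → ℂ), l (Q 0) = 0 ∧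
      ∀ v : ℂ, l (paramPt Q 1 v) = v * w.eval v := by
  obtain ⟨l, hl⟩ := hw.2
  refine ⟨l, ?_, fun v => ?_⟩
  · have := congrArg (fun f => coeff f 0) hl
    simpa [coeff_dualPoly] using this
  · rw [← eval_dualPoly, hl]
    simp

theorem exists_quadric {h : ℂ[X]} (hh : h ∈ residualSections Q * residualSections Q) :
    ∃ F : MvPolynomial (Fin (d + 1)) ℂ, F.IsHomogeneous 2 ∧
      (∀ v : ℂ, MvPolynomial.eval (paramPt Q 1 v) F = v ^ 2 * h.eval v) ∧
      MvPolynomial.eval (Q 0) F = 0 ∧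
      ∀ i, MvPolynomial.eval (Q 0) (MvPolynomial.pderiv i F) = 0 := by
  induction hh using Submodule.mul_induction_on' with
  | mem_mul_mem w hw w' hw' =>
    obtain ⟨l, hl0, hl⟩ := exists_linForm_residual hw
    obtain ⟨l', hl0', hl'⟩ := exists_linForm_residual hw'
    refine ⟨linForm l * linForm l', (isHomogeneous_linForm l).mul (isHomogeneous_linForm l'),
      fun v => ?_, ?_, fun i => ?_⟩
    · rw [map_mul, eval_linForm, eval_linForm, hl, hl', eval_mul]
      ring
    · rw [map_mul, eval_linForm, hl0, zero_mul]
    · rw [MvPolynomial.pderiv_mul, map_add, map_mul, map_mul, eval_linForm, eval_linForm, hl0, hl0']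
      simp
  | add f _ g _ hf hg =>
    obtain ⟨F, hF1, hF2, hF3, hF4⟩ := hf
    obtain ⟨G, hG1, hG2, hG3, hG4⟩ := hg
    refine ⟨F + G, hF1.add hG1, fun v => ?_, ?_, fun i => ?_⟩
    · rw [map_add, hF2, hG2, eval_add]; ring
    · rw [map_add, hF3, hG3, add_zero]
    · rw [map_add, map_add, hF4, hG4, add_zero]

theorem exists_cubic {h : ℂ[X]}
    (hh : h ∈ residualSections Q * residualSections Q * sections Q) :
    ∃ F : MvPolynomial (Fin (d + 1)) ℂ, F.IsHomogeneous 3 ∧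
      (∀ v : ℂ, MvPolynomial.eval (paramPt Q 1 v) F = v ^ 2 * h.eval v) ∧
      ∀ i, MvPolynomial.eval (Q 0) (MvPolynomial.pderiv i F) = 0 := by
  induction hh using Submodule.mul_induction_on' with
  | mem_mul_mem w hw u hu =>
    obtain ⟨F, hF1, hF2, hF3, hF4⟩ := exists_quadric hw
    obtain ⟨l, rfl⟩ := hu
    refine ⟨F * linForm l, hF1.mul (isHomogeneous_linForm l), fun v => ?_, fun i => ?_⟩
    · rw [map_mul, eval_linForm, hF2, eval_mul, eval_dualPoly]
      ring
    · rw [MvPolynomial.pderiv_mul, map_add, map_mul, map_mul, hF3, hF4]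
      simp
  | add f _ g _ hf hg =>
    obtain ⟨F, hF1, hF2, hF4⟩ := hf
    obtain ⟨G, hG1, hG2, hG4⟩ := hg
    refine ⟨F + G, hF1.add hG1, fun v => ?_, fun i => ?_⟩
    · rw [map_add, hF2, hG2, eval_add]; ring
    · rw [map_add, map_add, hF4, hG4, add_zero]

theorem IsFrame.zero_ne_zero (hF : IsFrame δ Q) : Q 0 ≠ 0 := by
  rw [← paramPt_one_zero (Q := Q)]
  exact hF.ne_zero 1 0 (Or.inl one_ne_zero)

theorem IsFrame.mem_vanishingForms (hF : IsFrame δ Q) {F : MvPolynomial (Fin (d + 1)) ℂ} {e : ℕ}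
    (he : F.IsHomogeneous e) (h : ∀ v : ℂ, MvPolynomial.eval (paramPt Q 1 v) F = 0) :
    F ∈ vanishingForms δ := by
  have h1 : ∀ u v : ℂ, u ≠ 0 → MvPolynomial.eval (paramPt Q u v) F = 0 := by
    intro u v hu
    have : paramPt Q u v = u ^ (d + 1) • paramPt Q 1 (v / u) := by
      rw [← paramPt_smul, mul_one, mul_div_cancel₀ _ hu]
    rw [this, eval_smul_of_isHomogeneous he, h, mul_zero]
  have h2 : ∀ u v : ℂ, MvPolynomial.eval (paramPt Q u v) F = 0 := by
    intro u v
    rcases eq_or_ne u 0 with rfl | hu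
    · have hcont : Continuous fun u => MvPolynomial.eval (paramPt Q u v) F :=
        (MvPolynomial.continuous_eval F).comp (continuous_paramPt_left v)
      have hz : (fun u => MvPolynomial.eval (paramPt Q u v) F) = fun _ => 0 := by
        refine Continuous.ext_on (dense_compl_singleton (0 : ℂ)) hcont continuous_const ?_
        intro u hu
        exact h1 u v hu
      exact congrFun hz 0
    · exact h1 u v hu
  refine ⟨⟨e, he⟩, fun x hx w hw => ?_⟩
  obtain ⟨u, v, huv, hmem⟩ := (hF.mem_iff x).1 hx
  obtain ⟨c, rfl⟩ := (mem_submodule_iff_exists_smul (hF.ne_zero u v huv) hmem w).1 hw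
  rw [eval_smul_of_isHomogeneous he, h2, mul_zero]

theorem mul_mem_mul_mul_of_mem {W U V : Submodule ℂ ℂ[X]} {h k : ℂ[X]}
    (hV : ∀ f ∈ V, f * h ∈ W * U) (hk : k ∈ W * V) : k * h ∈ W * W * U := by
  induction hk using Submodule.mul_induction_on' with
  | mem_mul_mem w hw f hf =>
    rw [mul_assoc, mul_assoc]
    exact Submodule.mul_mem_mul hw (hV f hf)
  | add a _ b _ ha hb =>
    rw [add_mul]
    exact Submodule.add_mem _ ha hb

theorem IsFrame.tangentSpaceAt_le (hF : IsFrame δ Q)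
    (hr : ∃ i < d + 2, r i ≠ 0) (hrel : ∑ i ∈ Finset.range (d + 2), r i • Q i = 0)
    (hj : ∃ j < d + 1, r (j + 1) ≠ 0) (hng : NotGeometric d r) {x : PS ℂ d}
    (hx : Q 0 ∈ x.submodule) : tangentSpaceAt δ x ≤ Submodule.span ℂ {Q 0, Q 1} := by
  intro y hy
  by_contra hyn
  obtain ⟨l, hly, hl⟩ := Submodule.exists_le_ker_of_notMem hyn
  have hl0 : l (Q 0) = 0 := hl (Submodule.subset_span (by simp))
  have hl1 : l (Q 1) = 0 := hl (Submodule.subset_span (by simp))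
  obtain ⟨H, ⟨lH, rfl⟩, hH0, hH⟩ :=
    exists_section_conductor hF.dual_eq_zero hF.zero_ne_zero hr hrel hj hng
  obtain ⟨g, hg⟩ : X ^ 2 ∣ dualPoly Q l := by
    rw [X_pow_dvd_iff]
    intro k hk
    rw [coeff_dualPoly]
    interval_cases k <;> simp [hl0, hl1]
  have hgd : g ∈ degreeLT ℂ d := by
    have := dualPoly_mem_degreeLT (Q := Q) l
    rw [hg] at this
    rw [mem_degreeLT, degree_lt_iff_coeff_zero] at this ⊢
    intro m hm
    have := this (m + 2) (by omega)
    rwa [mul_comm, coeff_mul_X_pow] at this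
  have hmem : g * dualPoly Q lH * dualPoly Q lH ∈
      residualSections Q * residualSections Q * sections Q := by
    have h1 := degreeLT_le_residualSections_mul hF.dual_eq_zero hr hrel hj hng
      (dualPoly_mem_degreeLT (Q := Q) lH)
    have h2 : g * dualPoly Q lH ∈ residualSections Q * degreeLT ℂ (d + 1) := by
      rw [mul_comm g]
      have := Submodule.mul_mem_mul h1 hgd
      rw [mul_assoc] at this
      exact mem_mul_of_le (degreeLT_two_mul_le d) this
    exact mul_mem_mul_mul_of_mem hH h2
  obtain ⟨F, hF1, hF2, hF3⟩ := exists_cubic hmem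
  have hvan : linForm l * (linForm lH * linForm lH) - F ∈ vanishingForms δ := by
    refine hF.mem_vanishingForms (e := 3) (((isHomogeneous_linForm l).mul
      ((isHomogeneous_linForm lH).mul (isHomogeneous_linForm lH))).sub hF1) fun v => ?_
    rw [map_sub, hF2, map_mul, map_mul, eval_linForm, eval_linForm, eval_mul, eval_mul,
      ← eval_dualPoly, ← eval_dualPoly, hg]
    simp
    ring
  have hlH : lH (Q 0) = 1 := by
    rw [coeff_dualPoly] at hH0
    simpa using hH0
  have := (mem_tangentSpaceAt_iff hF.zero_ne_zero hx y).1 hy _ hvan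
  refine hly ?_
  rw [← eval_linForm l y, linForm, map_sum]
  simpa [MvPolynomial.pderiv_mul, pderiv_linForm, eval_linForm, hl0, hlH, hF3] using this

end Smoothness

section Tangent

open Polynomial

variable {d : ℕ} {δ : Set (PS ℂ d)} {Q : ℕ → Fin (d + 1) → ℂ}

theorem IsFrame.mem (hF : IsFrame δ Q) {u v : ℂ} (huv : u ≠ 0 ∨ v ≠ 0) :
    Projectivization.mk ℂ (paramPt Q u v) (hF.ne_zero u v huv) ∈ δ := by
  rw [hF.mem_iff]
  refine ⟨u, v, huv, ?_⟩
  rw [Projectivization.submodule_mk]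
  exact Submodule.mem_span_singleton_self _

theorem IsFrame.eval_eq_zero (hF : IsFrame δ Q) {f : MvPolynomial (Fin (d + 1)) ℂ}
    (hf : f ∈ vanishingForms δ) {u v : ℂ} (huv : u ≠ 0 ∨ v ≠ 0) :
    MvPolynomial.eval (paramPt Q u v) f = 0 := by
  refine hf.2 _ (hF.mem huv) _ ?_
  rw [Projectivization.submodule_mk]
  exact Submodule.mem_span_singleton_self _

theorem IsFrame.aeval_arc_eq_zero (hF : IsFrame δ Q) {f : MvPolynomial (Fin (d + 1)) ℂ}
    (hf : f ∈ vanishingForms δ) {g : Fin (d + 1) → ℂ[X]}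
    (hg : ∀ v : ℂ, (fun i => (g i).eval v) = paramPt Q 1 v) : MvPolynomial.aeval g f = 0 := by
  refine Polynomial.funext fun v => ?_
  have h : (MvPolynomial.aeval g f).eval v = MvPolynomial.eval (fun i => (g i).eval v) f := by
    clear hf
    induction f using MvPolynomial.induction_on with
    | C a => simp
    | add p q hp hq => simp [hp, hq]
    | mul_X p i hp => simp [hp]
  rw [h, hg, hF.eval_eq_zero hf (Or.inl one_ne_zero), eval_zero]

theorem IsFrame.coeff_mem_tangentSpaceAt (hF : IsFrame δ Q) {x : PS ℂ d}
    (hx : Q 0 ∈ x.submodule) {k : ℕ} (hk : k ≤ d + 1) (hQ : ∀ i, 0 < i → i < k → Q i = 0) {j : ℕ}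
    (hj : j < k) (hjk : j + k ≤ d + 1) : Q (j + k) ∈ tangentSpaceAt δ x := by
  rw [mem_tangentSpaceAt_iff hF.zero_ne_zero hx]
  intro f hf
  let R : Fin (d + 1) → ℂ[X] := fun i => ∑ m ∈ Finset.range (d + 2 - k), monomial m (Q (m + k) i)
  have hR : ∀ i, (R i).coeff j = Q (j + k) i := by
    intro i
    simp only [R, finsetSum_coeff, coeff_monomial, Finset.sum_ite_eq', Finset.mem_range]
    rw [if_pos (by omega)]
  have harc : ∀ v : ℂ, (fun i => (C (Q 0 i) + X ^ k * R i).eval v) = paramPt Q 1 v := by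
    intro v
    ext i
    have h1 : d + 2 = k + (d + 2 - k) := by omega
    simp only [paramPt, R, eval_add, eval_C, eval_mul, eval_pow, eval_X, eval_finsetSum,
      eval_monomial, Finset.sum_apply, Pi.smul_apply, smul_eq_mul, one_pow, one_mul]
    rw [show Finset.range (d + 2) = Finset.range (k + (d + 2 - k)) by rw [← h1],
      Finset.sum_range_add]
    congr 1
    · rw [Finset.sum_eq_single 0]
      · simp
      · intro m hm hm0
        rw [Finset.mem_range] at hm
        rw [hQ m (by omega) hm]
        simp
      · intro h
        rw [Finset.mem_range] at h
        omega
    · rw [Finset.mul_sum]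
      refine Finset.sum_congr rfl fun m _ => ?_
      rw [pow_add, add_comm k m]
      ring
  have h0 : MvPolynomial.eval (Q 0) f = 0 := by
    rw [← paramPt_one_zero (Q := Q)]
    exact hF.eval_eq_zero hf (Or.inl one_ne_zero)
  have := sum_pderiv_mul_coeff_eq_zero (hF.aeval_arc_eq_zero hf harc) h0 hj
  simpa only [hR] using this

theorem IsFrame.self_mem_tangentSpaceAt (hF : IsFrame δ Q) {x : PS ℂ d}
    (hx : Q 0 ∈ x.submodule) : Q 0 ∈ tangentSpaceAt δ x := by
  rw [mem_tangentSpaceAt_iff hF.zero_ne_zero hx]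
  intro f hf
  obtain ⟨e, he⟩ := hf.1
  refine sum_pderiv_mul_self_eq_zero he ?_
  rw [← paramPt_one_zero (Q := Q)]
  exact hF.eval_eq_zero hf (Or.inl one_ne_zero)

theorem eq_smul_of_smul_add_smul_eq_zero {y z : Fin (d + 1) → ℂ} {a b : ℂ} (hb : b ≠ 0)
    (h : a • y + b • z = 0) : z = (-a / b) • y := by
  have h2 : b • z = -(a • y) := by
    rw [eq_neg_iff_add_eq_zero, add_comm (b • z)]
    exact h
  rw [div_eq_inv_mul, mul_smul, neg_smul, ← h2, inv_smul_smul₀ hb]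

theorem exists_node_or_cusp_of_geometric {r : ℕ → ℂ}
    (hrel : ∑ i ∈ Finset.range (d + 2), r i • Q i = 0)
    (hj : ∃ j < d + 1, r (j + 1) ≠ 0) (hng : ¬NotGeometric d r) :
    (∃ u v c : ℂ, v ≠ 0 ∧ paramPt Q u v = c • Q 0) ∨ ∃ c : ℂ, Q 1 = c • Q 0 := by
  unfold NotGeometric at hng
  push Not at hng
  obtain ⟨α, β, hαβ, hne⟩ := hng
  obtain ⟨j, hjd, hj⟩ := hj
  rcases eq_or_ne α 0 with rfl | hα
  · left
    have hβ := hne rfl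
    have hz : ∀ i < d, r (i + 1) = 0 := by
      intro i hi
      have := hαβ i hi
      rw [zero_mul, eq_comm, mul_eq_zero] at this
      exact this.resolve_left hβ
    rw [Finset.sum_range_succ, Finset.sum_range_succ', Finset.sum_eq_zero (fun i hi => by
      rw [hz i (Finset.mem_range.1 hi), zero_smul]), zero_add] at hrel
    have hd1 : r (d + 1) ≠ 0 := by
      have : j = d := by
        by_contra h
        exact hj (hz j (by omega))
      rwa [this] at hj
    exact ⟨0, 1, -r 0 / r (d + 1), one_ne_zero, by
      rw [paramPt_zero_one, eq_smul_of_smul_add_smul_eq_zero hd1 hrel]⟩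
  · have hgeo : ∀ i < d + 1, r (i + 1) = r 1 * (β / α) ^ i := by
      intro i
      induction i with
      | zero => simp
      | succ i ih =>
        intro hi
        have h1 := hαβ i (by omega)
        rw [ih (by omega)] at h1
        rw [pow_succ]
        field_simp
        field_simp at h1
        linear_combination h1
    have hr1 : r 1 ≠ 0 := by
      intro h
      rw [hgeo j hjd, h, zero_mul] at hj
      exact hj rfl
    rcases eq_or_ne β 0 with rfl | hβ
    · right
      rw [Finset.sum_range_succ', Finset.sum_range_succ', Finset.sum_eq_zero (fun i hi => by
        rw [Finset.mem_range] at hi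
        rw [hgeo (i + 1) (by omega)]
        simp), zero_add, add_comm (_ • Q (0 + 1))] at hrel
      exact ⟨_, eq_smul_of_smul_add_smul_eq_zero hr1 hrel⟩
    · left
      refine ⟨1, β / α, 1 - β / α * r 0 / r 1, div_ne_zero hβ hα, ?_⟩
      rw [Finset.sum_range_succ'] at hrel
      have h1 : ∑ i ∈ Finset.range (d + 1), r (i + 1) • Q (i + 1)
          = r 1 • ∑ i ∈ Finset.range (d + 1), (β / α) ^ i • Q (i + 1) := by
        rw [Finset.smul_sum]
        refine Finset.sum_congr rfl fun i hi => ?_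
        rw [hgeo i (Finset.mem_range.1 hi), smul_smul]
      rw [h1, add_comm (r 1 • _)] at hrel
      have h2 := eq_smul_of_smul_add_smul_eq_zero hr1 hrel
      unfold paramPt
      rw [Finset.sum_range_succ']
      have h3 : ∑ i ∈ Finset.range (d + 1), ((1 : ℂ) ^ (d + 1 - (i + 1)) * (β / α) ^ (i + 1)) •
          Q (i + 1) = (β / α) • ∑ i ∈ Finset.range (d + 1), (β / α) ^ i • Q (i + 1) := by
        rw [Finset.smul_sum]
        refine Finset.sum_congr rfl fun i _ => ?_
        rw [smul_smul, one_pow, one_mul, pow_succ']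
      rw [h3, h2, smul_smul]
      simp only [one_pow, pow_zero, one_mul]
      rw [← add_smul]
      congr 1
      ring

theorem IsFrame.isSmoothPt (hF : IsFrame δ Q) {x : PS ℂ d} (hx : Q 0 ∈ x.submodule)
    (hnode : ∀ u v c : ℂ, v ≠ 0 → paramPt Q u v ≠ c • Q 0) (hcusp : ∀ c : ℂ, Q 1 ≠ c • Q 0) :
    IsSmoothPt δ x := by
  obtain ⟨r, hr, hrel⟩ := exists_relation Q
  have hj : ∃ j < d + 1, r (j + 1) ≠ 0 := by
    by_contra h
    push Not at h
    rw [Finset.sum_range_succ', Finset.sum_eq_zero (fun i hi => by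
      rw [h i (Finset.mem_range.1 hi), zero_smul]), zero_add, smul_eq_zero] at hrel
    obtain ⟨i, hi, hri⟩ := hr
    rcases i with _ | i
    · exact hri (hrel.resolve_right hF.zero_ne_zero)
    · exact hri (h i (by omega))
  have hng : NotGeometric d r := by
    by_contra hng
    rcases exists_node_or_cusp_of_geometric hrel hj hng with
      ⟨u, v, c, hv, h⟩ | ⟨c, h⟩
    · exact hnode u v c hv h
    · exact hcusp c h
  have hle := hF.tangentSpaceAt_le hr hrel hj hng hx
  have hge : Submodule.span ℂ {Q 0, Q 1} ≤ tangentSpaceAt δ x := by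
    rw [Submodule.span_le]
    rintro y (rfl | rfl)
    · exact hF.self_mem_tangentSpaceAt hx
    · exact hF.coeff_mem_tangentSpaceAt hx (k := 1) (j := 0) (by omega)
        (fun i h1 h2 => by omega) (by omega) (by omega)
  refine ⟨?_, ?_⟩
  · rw [hF.mem_iff]
    exact ⟨1, 0, Or.inl one_ne_zero, by rwa [paramPt_one_zero]⟩
  · rw [le_antisymm hle hge]
    have hli : LinearIndependent ℂ ![Q 0, Q 1] := by
      rw [LinearIndependent.pair_iff' hF.zero_ne_zero]
      exact fun c h => hcusp c h.symm
    rw [show ({Q 0, Q 1} : Set (Fin (d + 1) → ℂ)) = Set.range ![Q 0, Q 1] by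
      ext y; simp [or_comm]]
    exact finrank_span_eq_card hli

theorem finrank_ne_two_of_dual {W : Submodule ℂ (Fin (d + 1) → ℂ)} (v : Fin 3 → Fin (d + 1) → ℂ)
    (hv : ∀ j, v j ∈ W)
    (h : ∀ j, ∃ l : Module.Dual ℂ (Fin (d + 1) → ℂ), l (v j) = 1 ∧ ∀ i, i ≠ j → l (v i) = 0) :
    Module.finrank ℂ W ≠ 2 := by
  choose l hl using h
  have hli : LinearIndependent ℂ v :=
    LinearIndependent.of_pairwise_dual_eq_zero_one v l (fun i j hij => (hl i).2 j hij.symm)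
      fun i => (hl i).1
  have h3 : Module.finrank ℂ (Submodule.span ℂ (Set.range v)) = 3 := by
    simpa using finrank_span_eq_card hli
  have hle : Submodule.span ℂ (Set.range v) ≤ W := by
    rw [Submodule.span_le]
    rintro _ ⟨j, rfl⟩
    exact hv j
  have := Submodule.finrank_mono hle
  omega

theorem paramPt_reverse (u v : ℂ) :
    paramPt (fun i => Q (d + 1 - i)) u v = paramPt Q v u := by
  unfold paramPt
  rw [← Finset.sum_range_reflect]
  refine Finset.sum_congr rfl fun i hi => ?_
  rw [Finset.mem_range] at hi
  simp only [show d + 2 - 1 - i = d + 1 - i by omega, show d + 1 - (d + 1 - i) = i by omega]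
  rw [mul_comm]

theorem IsFrame.reverse (hF : IsFrame δ Q) : IsFrame δ (fun i => Q (d + 1 - i)) where
  ne_zero u v huv := by
    rw [paramPt_reverse]
    exact hF.ne_zero v u huv.symm
  mem_iff x := by
    rw [hF.mem_iff]
    constructor
    · rintro ⟨u, v, huv, h⟩
      exact ⟨v, u, huv.symm, by rwa [paramPt_reverse]⟩
    · rintro ⟨u, v, huv, h⟩
      exact ⟨v, u, huv.symm, by rwa [paramPt_reverse] at h⟩
  dual_eq_zero l hl := hF.dual_eq_zero l fun i hi => by
    have := hl (d + 1 - i) (by omega)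
    rwa [show d + 1 - (d + 1 - i) = i by omega] at this

theorem IsFrame.exists_dual_node (hF : IsFrame δ Q) {c : ℂ}
    (hQ : Q 0 = c • Q (d + 1)) (a : ℕ → ℂ) (ha : a 0 = c * a (d + 1)) :
    ∃ l : Module.Dual ℂ (Fin (d + 1) → ℂ), ∀ i < d + 2, l (Q i) = a i := by
  refine exists_dual_of_relation hF.dual_eq_zero
    (r := fun i => if i = 0 then 1 else if i = d + 1 then -c else 0)
    ⟨0, by omega, by simp⟩ ?_ a ?_
  · rw [Finset.sum_range_succ', Finset.sum_range_succ, Finset.sum_eq_zero fun i hi => by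
      rw [Finset.mem_range] at hi
      simp [hi.ne]]
    simp [hQ]
  · rw [Finset.sum_range_succ', Finset.sum_range_succ, Finset.sum_eq_zero fun i hi => by
      rw [Finset.mem_range] at hi
      simp [hi.ne]]
    simp [ha]

theorem IsFrame.exists_dual_cusp (hF : IsFrame δ Q) (hQ : Q 1 = 0) (a : ℕ → ℂ) (ha : a 1 = 0) :
    ∃ l : Module.Dual ℂ (Fin (d + 1) → ℂ), ∀ i < d + 2, l (Q i) = a i := by
  refine exists_dual_of_relation hF.dual_eq_zero (r := fun i => if i = 1 then 1 else 0)
    ⟨1, by omega, by simp⟩ ?_ a ?_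
  · simp [hQ]
  · simp [ha]

theorem IsFrame.not_isSmoothPt_cusp (hd : 2 ≤ d) (hF : IsFrame δ Q) (hQ : Q 1 = 0) {x : PS ℂ d}
    (hx : Q 0 ∈ x.submodule) : ¬IsSmoothPt δ x := by
  rintro ⟨-, h⟩
  have h1 : ∀ i, 0 < i → i < 2 → Q i = 0 := by
    intro i h1 h2
    rwa [show i = 1 by omega]
  let k : Fin 3 → ℕ := ![0, 2, 3]
  have hk : Function.Injective k := by decide
  have hk1 : ∀ j, k j < d + 2 := by
    intro j
    fin_cases j <;> simp [k] <;> omega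
  have hk2 : ∀ j, k j ≠ 1 := by decide
  refine finrank_ne_two_of_dual (fun j => Q (k j)) ?_ ?_ h
  · intro j
    fin_cases j
    · exact hF.self_mem_tangentSpaceAt hx
    · exact hF.coeff_mem_tangentSpaceAt hx (k := 2) (j := 0) (by omega) h1 (by omega) (by omega)
    · exact hF.coeff_mem_tangentSpaceAt hx (k := 2) (j := 1) (by omega) h1 (by omega) (by omega)
  · intro j
    obtain ⟨l, hl⟩ := hF.exists_dual_cusp hQ (fun i => if i = k j then 1 else 0)
      (if_neg (hk2 j).symm)
    refine ⟨l, by rw [hl _ (hk1 j), if_pos rfl], fun i hij => ?_⟩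
    rw [hl _ (hk1 i), if_neg fun h => hij (hk h)]

theorem IsFrame.not_isSmoothPt_node (hd : 2 ≤ d) (hF : IsFrame δ Q) {c : ℂ} (hc : c ≠ 0)
    (hQ : Q 0 = c • Q (d + 1)) {x : PS ℂ d} (hx : Q 0 ∈ x.submodule) : ¬IsSmoothPt δ x := by
  rintro ⟨-, h⟩
  have hx' : Q (d + 1 - 0) ∈ x.submodule := by
    have := Submodule.smul_mem _ c⁻¹ hx
    rwa [hQ, inv_smul_smul₀ hc] at this
  let k : Fin 3 → ℕ := ![0, 1, d]
  have hk : Function.Injective k := by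
    intro i j
    fin_cases i <;> fin_cases j <;> simp [k] <;> omega
  have hk1 : ∀ j, k j < d + 1 := by
    intro j
    fin_cases j <;> simp [k] <;> omega
  refine finrank_ne_two_of_dual (fun j => Q (k j)) ?_ ?_ h
  · intro j
    fin_cases j
    · exact hF.self_mem_tangentSpaceAt hx
    · exact hF.coeff_mem_tangentSpaceAt hx (k := 1) (j := 0) (by omega)
        (fun i h1 h2 => by omega) (by omega) (by omega)
    · exact hF.reverse.coeff_mem_tangentSpaceAt hx' (k := 1) (j := 0) (by omega)
        (fun i h1 h2 => by omega) (by omega) (by omega)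
  · intro j
    obtain ⟨l, hl⟩ := hF.exists_dual_node hQ (fun i => if i = k j then 1 else
      if i = d + 1 ∧ k j = 0 then c⁻¹ else 0) (by
        have := hk1 j
        by_cases h0 : k j = 0
        · simp [h0, hc]
        · simp [h0, Ne.symm h0, this.ne'])
    refine ⟨l, by rw [hl _ (by have := hk1 j; omega), if_pos rfl], fun i hij => ?_⟩
    rw [hl _ (by have := hk1 i; omega), if_neg fun h => hij (hk h), if_neg fun h => (hk1 i).ne h.1]

end Tangent

section Frames

open Polynomial

variable {d : ℕ} {δ : Set (PS ℂ d)}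

theorem exists_coeff_of_isHomogeneous {f : MvPolynomial (Fin 2) ℂ} {e : ℕ}
    (hf : f.IsHomogeneous e) (s t : Fin 2 → ℂ) :
    ∃ a : ℕ → ℂ, ∀ u v : ℂ, MvPolynomial.eval (u • s + v • t) f =
      ∑ k ∈ Finset.range (e + 1), u ^ (e - k) * v ^ k * a k := by
  let g : ℂ[X] := MvPolynomial.aeval (fun j => C (s j) + C (t j) * X) f
  have hdeg : g.natDegree ≤ e := by
    have := MvPolynomial.aeval_natDegree_le (m := e) (n := 1) f hf.totalDegree_le
      (fun j => C (s j) + C (t j) * X) fun j => by compute_degree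
    simpa [g] using this
  have hg : ∀ v, g.eval v = MvPolynomial.eval (s + v • t) f := by
    intro v
    simp only [g]
    clear hf hdeg g
    induction f using MvPolynomial.induction_on with
    | C a => simp
    | add p q hp hq => simp [hp, hq]
    | mul_X p i hp => simp [hp, mul_comm v]
  refine ⟨g.coeff, fun u v => ?_⟩
  have hc1 : Continuous fun u : ℂ => MvPolynomial.eval (u • s + v • t) f :=
    (MvPolynomial.continuous_eval f).comp (by fun_prop)
  have hc2 : Continuous fun u : ℂ =>
      ∑ k ∈ Finset.range (e + 1), u ^ (e - k) * v ^ k * g.coeff k := by fun_prop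
  refine congrFun (hc1.ext_on (dense_compl_singleton 0) hc2 fun u (hu : u ≠ 0) => ?_) u
  have h1 : u • s + v • t = u • (s + (v / u) • t) := by
    rw [smul_add, smul_smul, mul_div_cancel₀ _ hu]
  change MvPolynomial.eval (u • s + v • t) f = _
  rw [h1, eval_smul_of_isHomogeneous hf, ← hg, eval_eq_sum_range' (Nat.lt_succ_of_le hdeg),
    Finset.mul_sum]
  refine Finset.sum_congr rfl fun k hk => ?_
  rw [Finset.mem_range] at hk
  have h2 : u ^ e = u ^ (e - k) * u ^ k := by rw [← pow_add]; congr 1; omega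
  rw [h2, div_pow]
  field_simp

theorem exists_frame (hnd : NonDeg δ) {q : Fin (d + 1) → MvPolynomial (Fin 2) ℂ}
    (hq : IsParamOf q δ (d + 1)) {s t : Fin 2 → ℂ} (hst : s 0 * t 1 - s 1 * t 0 ≠ 0) :
    ∃ Q, IsFrame δ Q ∧
      ∀ u v, paramPt Q u v = fun i => MvPolynomial.eval (u • s + v • t) (q i) := by
  choose a ha using fun i => exists_coeff_of_isHomogeneous (hq.1 i) s t
  have hQ : ∀ u v, paramPt (fun k i => a i k) u v =
      fun i => MvPolynomial.eval (u • s + v • t) (q i) := by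
    intro u v
    ext i
    simp [paramPt, ha]
  have hne : ∀ u v : ℂ, (u ≠ 0 ∨ v ≠ 0) → paramPt (fun k i => a i k) u v ≠ 0 := by
    intro u v huv
    rw [hQ]
    refine hq.2.1 _ fun h => ?_
    have h0 := congrFun h 0
    have h1 := congrFun h 1
    simp only [Pi.add_apply, Pi.smul_apply, smul_eq_mul, Pi.zero_apply] at h0 h1
    rcases huv with h | h <;> refine mul_ne_zero h hst ?_
    · linear_combination t 1 * h0 - t 0 * h1
    · linear_combination s 0 * h1 - s 1 * h0
  have hmem : ∀ x, x ∈ δ ↔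
      ∃ u v : ℂ, (u ≠ 0 ∨ v ≠ 0) ∧ paramPt (fun k i => a i k) u v ∈ x.submodule := by
    intro x
    constructor
    · intro hx
      rw [hq.2.2] at hx
      obtain ⟨r, hr, rfl⟩ := hx
      obtain ⟨u, v, hrst⟩ : ∃ u v : ℂ, r = u • s + v • t := by
        refine ⟨(r 0 * t 1 - r 1 * t 0) / (s 0 * t 1 - s 1 * t 0),
          (s 0 * r 1 - s 1 * r 0) / (s 0 * t 1 - s 1 * t 0), ?_⟩
        ext j
        rw [Pi.add_apply, Pi.smul_apply, Pi.smul_apply, smul_eq_mul, smul_eq_mul,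
          div_mul_eq_mul_div, div_mul_eq_mul_div, ← add_div, eq_div_iff hst]
        fin_cases j <;> simp <;> ring
      refine ⟨u, v, ?_, ?_⟩
      · by_contra! h
        rw [h.1, h.2, zero_smul, zero_smul, zero_add] at hrst
        refine hr (funext fun i => ?_)
        have := eval_smul_of_isHomogeneous (hq.1 i) 0 r
        rwa [zero_smul, zero_pow (by omega), zero_mul, ← hrst] at this
      · rw [hQ, ← hrst, Projectivization.submodule_mk]
        exact Submodule.mem_span_singleton_self _
    · rintro ⟨u, v, huv, h⟩
      rw [hq.2.2]
      have hne' := hne u v huv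
      rw [hQ] at hne' h
      exact ⟨_, hne', (mk_eq_of_mem_submodule hne' h).symm⟩
  refine ⟨fun k i => a i k, ⟨hne, hmem, fun l hl => ?_⟩, hQ⟩
  by_contra hl0
  refine hnd _ ⟨LinearMap.ker l, ?_, rfl⟩ fun x hx => ?_
  · have := Module.Dual.finrank_ker_add_one_of_ne_zero hl0
    simpa using this
  · obtain ⟨u, v, huv, h⟩ := (hmem x).1 hx
    rw [Set.mem_ofPred_eq, submodule_le_iff_mem (hne u v huv) h, LinearMap.mem_ker, paramPt, map_sum]
    exact Finset.sum_eq_zero fun i hi => by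
      rw [map_smul, hl i (Finset.mem_range.1 hi), smul_zero]

theorem IsFrame.isParamOf {Q : ℕ → Fin (d + 1) → ℂ} (hF : IsFrame δ Q) :
    ∃ q, IsParamOf q δ (d + 1) ∧
      ∀ s : Fin 2 → ℂ, (fun i => MvPolynomial.eval s (q i)) = paramPt Q (s 0) (s 1) := by
  let q : Fin (d + 1) → MvPolynomial (Fin 2) ℂ := fun i => ∑ k ∈ Finset.range (d + 2),
    MvPolynomial.C (Q k i) * (MvPolynomial.X 0 ^ (d + 1 - k) * MvPolynomial.X 1 ^ k)
  have hq : ∀ s : Fin 2 → ℂ, (fun i => MvPolynomial.eval s (q i)) = paramPt Q (s 0) (s 1) := by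
    intro s
    ext i
    simp only [q, paramPt, map_sum, map_mul, map_pow, MvPolynomial.eval_C, MvPolynomial.eval_X,
      Finset.sum_apply, Pi.smul_apply, smul_eq_mul]
    exact Finset.sum_congr rfl fun k _ => by ring
  have hs : ∀ s : Fin 2 → ℂ, s ≠ 0 → s 0 ≠ 0 ∨ s 1 ≠ 0 := by
    intro s hs
    by_contra! h
    refine hs (funext fun j => ?_)
    fin_cases j
    exacts [h.1, h.2]
  refine ⟨q, ⟨fun i => ?_, fun s h => ?_, ?_⟩, hq⟩
  · refine MvPolynomial.IsHomogeneous.sum _ _ _ fun k hk => ?_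
    rw [Finset.mem_range] at hk
    have h1 := (MvPolynomial.isHomogeneous_C (Fin 2) (Q k i)).mul
      ((MvPolynomial.isHomogeneous_X_pow (R := ℂ) (0 : Fin 2) (d + 1 - k)).mul
        (MvPolynomial.isHomogeneous_X_pow (1 : Fin 2) k))
    rwa [show 0 + (d + 1 - k + k) = d + 1 by omega] at h1
  · rw [hq]
    exact hF.ne_zero _ _ (hs s h)
  · ext x
    rw [hF.mem_iff]
    constructor
    · rintro ⟨u, v, huv, h⟩
      have := hF.ne_zero u v huv
      rw [show paramPt Q u v = fun i => MvPolynomial.eval ![u, v] (q i) by rw [hq]; rfl] at this h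
      exact ⟨_, this, (mk_eq_of_mem_submodule this h).symm⟩
    · rintro ⟨s, h, rfl⟩
      refine ⟨s 0, s 1, ?_, ?_⟩
      · by_contra! h0
        refine h ?_
        rw [hq, h0.1, h0.2, paramPt]
        refine Finset.sum_eq_zero fun i hi => ?_
        rcases i with _ | i <;> simp
      · rw [← hq, Projectivization.submodule_mk]
        exact Submodule.mem_span_singleton_self _

theorem IsFrame.exists_change (hnd : NonDeg δ) {Q : ℕ → Fin (d + 1) → ℂ} (hF : IsFrame δ Q)
    {a b a' b' : ℂ} (h : a * b' - a' * b ≠ 0) :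
    ∃ Q', IsFrame δ Q' ∧
      ∀ u v, paramPt Q' u v = paramPt Q (u * a + v * b) (u * a' + v * b') := by
  obtain ⟨q, hq, hqQ⟩ := hF.isParamOf
  obtain ⟨Q', hF', hQ'⟩ := exists_frame hnd hq (s := ![a, a']) (t := ![b, b']) (by simpa using h)
  refine ⟨Q', hF', fun u v => ?_⟩
  rw [hQ', hqQ]
  simp

end Frames

section NormalForms

open Polynomial

variable {d : ℕ} {δ : Set (PS ℂ d)} {Q : ℕ → Fin (d + 1) → ℂ}

/-- The smooth points of `δ` are the points with parameter `(z : 1)`, `z ∈ T`, and `z` is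
determined by the point. -/
structure IsUniformized (δ : Set (PS ℂ d)) (Q : ℕ → Fin (d + 1) → ℂ) (T : Set ℂ) : Prop where
  ne_zero : ∀ z, paramPt Q z 1 ≠ 0
  mem_smoothPts : ∀ x, x ∈ smoothPts δ ↔ ∃ z ∈ T, paramPt Q z 1 ∈ x.submodule
  eq_of_smul : ∀ z ∈ T, ∀ w ∈ T, ∀ k : ℂ, paramPt Q z 1 = k • paramPt Q w 1 → z = w

theorem map_paramPt_of_single (l : Module.Dual ℂ (Fin (d + 1) → ℂ)) {j : ℕ} (hj : j < d + 2)
    (hl : ∀ i < d + 2, l (Q i) = if i = j then 1 else 0) (u v : ℂ) :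
    l (paramPt Q u v) = u ^ (d + 1 - j) * v ^ j := by
  rw [paramPt, map_sum, Finset.sum_eq_single j]
  · rw [map_smul, hl j hj, if_pos rfl, smul_eq_mul, mul_one]
  · intro i hi hij
    rw [map_smul, hl i (Finset.mem_range.1 hi), if_neg hij, smul_zero]
  · intro h
    exact absurd (Finset.mem_range.2 hj) h

theorem IsFrame.exists_monomial_node (hF : IsFrame δ Q) {c : ℂ} (hQ : Q 0 = c • Q (d + 1)) {j : ℕ}
    (hj : 0 < j) (hjd : j ≤ d) :
    ∃ l : Module.Dual ℂ (Fin (d + 1) → ℂ), ∀ u v, l (paramPt Q u v) = u ^ (d + 1 - j) * v ^ j := by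
  obtain ⟨l, hl⟩ := hF.exists_dual_node hQ (fun i => if i = j then 1 else 0) (by
    rw [if_neg (by omega), if_neg (by omega), mul_zero])
  exact ⟨l, map_paramPt_of_single l (by omega) hl⟩

theorem IsFrame.exists_monomial_cusp (hF : IsFrame δ Q) (hQ : Q 1 = 0) {j : ℕ}
    (hj : j ≠ 1) (hjd : j < d + 2) :
    ∃ l : Module.Dual ℂ (Fin (d + 1) → ℂ), ∀ u v, l (paramPt Q u v) = u ^ (d + 1 - j) * v ^ j := by
  obtain ⟨l, hl⟩ := hF.exists_dual_cusp hQ (fun i => if i = j then 1 else 0) (by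
    rw [if_neg (by omega)])
  exact ⟨l, map_paramPt_of_single l hjd hl⟩

theorem map_eq_coeff (l : Module.Dual ℂ (Fin (d + 1) → ℂ)) {f : ℂ[X]}
    (h : ∀ v, l (paramPt Q 1 v) = f.eval v) {i : ℕ} (hi : i < d + 2) : l (Q i) = f.coeff i := by
  have : dualPoly Q l = f := Polynomial.funext fun v => by rw [eval_dualPoly, h]
  rw [← this, coeff_dualPoly, if_pos hi]

theorem IsFrame.eq_mul_of_node (hd : 2 ≤ d) (hF : IsFrame δ Q) {c : ℂ} (hQ : Q 0 = c • Q (d + 1))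
    {u v z k : ℂ} (hz : z ≠ 0) (huv : u ≠ 0 ∨ v ≠ 0)
    (h : paramPt Q u v = k • paramPt Q z 1) : u = z * v := by
  have hk : k ≠ 0 := by
    rintro rfl
    exact hF.ne_zero u v huv (by rw [h, zero_smul])
  obtain ⟨l, hl⟩ := hF.exists_monomial_node hQ (j := d) (by omega) le_rfl
  obtain ⟨l', hl'⟩ := hF.exists_monomial_node hQ (j := d - 1) (by omega) (by omega)
  have h1 := congrArg l h
  have h2 := congrArg l' h
  rw [map_smul, hl, hl, show d + 1 - d = 1 by omega, smul_eq_mul, one_pow, mul_one, pow_one,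
    pow_one] at h1
  rw [map_smul, hl', hl', show d + 1 - (d - 1) = 2 by omega, smul_eq_mul, one_pow, mul_one] at h2
  have hne : u * v ^ d ≠ 0 := by
    rw [h1]
    exact mul_ne_zero hk hz
  refine mul_left_cancel₀ hne ?_
  have h3 : v ^ d = v ^ (d - 1) * v := by rw [← pow_succ]; congr 1; omega
  calc u * v ^ d * u = u ^ 2 * v ^ (d - 1) * v := by rw [h3]; ring
    _ = k * z * (z * v) := by rw [h2]; ring
    _ = _ := by rw [h1]

theorem IsFrame.eq_mul_of_cusp (hd : 2 ≤ d) (hF : IsFrame δ Q) (hQ : Q 1 = 0)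
    {u v z k : ℂ} (huv : u ≠ 0 ∨ v ≠ 0)
    (h : paramPt Q u v = k • paramPt Q z 1) : u = z * v := by
  have hk : k ≠ 0 := by
    rintro rfl
    exact hF.ne_zero u v huv (by rw [h, zero_smul])
  obtain ⟨l, hl⟩ := hF.exists_monomial_cusp hQ (j := d) (by omega) (by omega)
  obtain ⟨l', hl'⟩ := hF.exists_monomial_cusp hQ (j := d + 1) (by omega) (by omega)
  have h1 := congrArg l h
  have h2 := congrArg l' h
  rw [map_smul, hl, hl, show d + 1 - d = 1 by omega, smul_eq_mul, one_pow, mul_one, pow_one,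
    pow_one] at h1
  rw [map_smul, hl', hl', Nat.sub_self, smul_eq_mul, one_pow, mul_one, pow_zero, pow_zero,
    mul_one, one_mul] at h2
  have hv : v ^ d ≠ 0 := by
    intro h
    rw [pow_succ, h, zero_mul] at h2
    exact hk h2.symm
  refine mul_right_cancel₀ hv ?_
  rw [h1, ← h2]
  ring

theorem IsFrame.exists_at (hnd : NonDeg δ) (hF : IsFrame δ Q) (z : ℂ) :
    ∃ Q', IsFrame δ Q' ∧ Q' 0 = paramPt Q z 1 ∧
      ∀ u v, paramPt Q' u v = paramPt Q (u * z + v) u := by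
  obtain ⟨Q', hF', hQ'⟩ := hF.exists_change hnd (a := z) (b := 1) (a' := 1) (b' := 0) (by simp)
  have h : ∀ u v, paramPt Q' u v = paramPt Q (u * z + v) u := by
    intro u v
    rw [hQ']
    simp
  refine ⟨Q', hF', ?_, h⟩
  rw [← paramPt_one_zero (Q := Q'), h]
  simp

theorem IsFrame.isSmoothPt_of_node (hd : 2 ≤ d) (hnd : NonDeg δ) (hF : IsFrame δ Q) {c : ℂ}
    (hQ : Q 0 = c • Q (d + 1)) {z : ℂ} (hz : z ≠ 0) {x : PS ℂ d}
    (hx : paramPt Q z 1 ∈ x.submodule) : IsSmoothPt δ x := by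
  obtain ⟨Q', hF', hQ0, hQ'⟩ := hF.exists_at hnd z
  refine hF'.isSmoothPt (by rwa [hQ0]) (fun u v k hv h => ?_) fun k h => ?_
  · rw [hQ', hQ0] at h
    have huv : u * z + v ≠ 0 ∨ u ≠ 0 := by
      by_contra! h0
      rw [h0.2, zero_mul, zero_add] at h0
      exact hv h0.1
    have := hF.eq_mul_of_node hd hQ hz huv h
    exact hv (by linear_combination this)
  · obtain ⟨l, hl⟩ := hF.exists_monomial_node hQ (j := d) (by omega) le_rfl
    obtain ⟨l', hl'⟩ := hF.exists_monomial_node hQ (j := d - 1) (by omega) (by omega)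
    obtain ⟨a, ha⟩ : ∃ a, a = z ^ 2 := ⟨_, rfl⟩
    have h1 := congrArg l h
    have h2 := congrArg l' h
    rw [map_smul, map_eq_coeff l (f := C z + X) (fun v => by
      rw [hQ', hl, show d + 1 - d = 1 by omega]; simp) (by omega), map_eq_coeff l (f := C z + X)
        (fun v => by rw [hQ', hl, show d + 1 - d = 1 by omega]; simp) (by omega)] at h1
    rw [map_smul, map_eq_coeff l' (f := C a + C (2 * z) * X + X ^ 2) (fun v => by
      rw [hQ', hl', show d + 1 - (d - 1) = 2 by omega]; simp [ha]; ring) (by omega),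
      map_eq_coeff l' (f := C a + C (2 * z) * X + X ^ 2) (fun v => by
      rw [hQ', hl', show d + 1 - (d - 1) = 2 by omega]; simp [ha]; ring) (by omega)] at h2
    simp [coeff_C, coeff_X, coeff_X_pow] at h1 h2
    exact hz (by linear_combination h2 - z * h1 + k * ha)

theorem IsFrame.isSmoothPt_of_cusp (hd : 2 ≤ d) (hnd : NonDeg δ) (hF : IsFrame δ Q)
    (hQ : Q 1 = 0) {z : ℂ} {x : PS ℂ d}
    (hx : paramPt Q z 1 ∈ x.submodule) : IsSmoothPt δ x := by
  obtain ⟨Q', hF', hQ0, hQ'⟩ := hF.exists_at hnd z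
  refine hF'.isSmoothPt (by rwa [hQ0]) (fun u v k hv h => ?_) fun k h => ?_
  · rw [hQ', hQ0] at h
    have huv : u * z + v ≠ 0 ∨ u ≠ 0 := by
      by_contra! h0
      rw [h0.2, zero_mul, zero_add] at h0
      exact hv h0.1
    have := hF.eq_mul_of_cusp hd hQ huv h
    exact hv (by linear_combination this)
  · obtain ⟨l, hl⟩ := hF.exists_monomial_cusp hQ (j := d) (by omega) (by omega)
    obtain ⟨l', hl'⟩ := hF.exists_monomial_cusp hQ (j := d + 1) (by omega) (by omega)
    have h1 := congrArg l h
    have h2 := congrArg l' h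
    rw [map_smul, map_eq_coeff l (f := C z + X) (fun v => by
      rw [hQ', hl, show d + 1 - d = 1 by omega]; simp) (by omega), map_eq_coeff l (f := C z + X)
        (fun v => by rw [hQ', hl, show d + 1 - d = 1 by omega]; simp) (by omega)] at h1
    rw [map_smul, map_eq_coeff l' (f := 1) (fun v => by rw [hQ', hl']; simp) (by omega),
      map_eq_coeff l' (f := 1) (fun v => by rw [hQ', hl']; simp) (by omega)] at h2
    simp only [coeff_one, one_ne_zero, if_false, if_true, smul_eq_mul, mul_one] at h2
    simp [← h2] at h1

theorem IsFrame.mem_iff_of_inhomogeneous (hF : IsFrame δ Q) (x : PS ℂ d) :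
    x ∈ δ ↔ Q 0 ∈ x.submodule ∨ ∃ z, paramPt Q z 1 ∈ x.submodule := by
  rw [hF.mem_iff]
  constructor
  · rintro ⟨u, v, huv, h⟩
    rcases eq_or_ne v 0 with rfl | hv
    · left
      have hu : u ≠ 0 := by simpa using huv
      have := Submodule.smul_mem _ ((u⁻¹) ^ (d + 1)) h
      rwa [← paramPt_smul, inv_mul_cancel₀ hu, mul_zero, paramPt_one_zero] at this
    · right
      have := Submodule.smul_mem _ ((v⁻¹) ^ (d + 1)) h
      rw [← paramPt_smul, inv_mul_cancel₀ hv] at this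
      exact ⟨_, this⟩
  · rintro (h | ⟨z, h⟩)
    · exact ⟨1, 0, by simp, by rwa [paramPt_one_zero]⟩
    · exact ⟨z, 1, by simp, h⟩

theorem IsFrame.isUniformized_node (hd : 2 ≤ d) (hnd : NonDeg δ) (hF : IsFrame δ Q) {c : ℂ}
    (hc : c ≠ 0) (hQ : Q 0 = c • Q (d + 1)) : IsUniformized δ Q {z | z ≠ 0} where
  ne_zero z := hF.ne_zero z 1 (by simp)
  mem_smoothPts x := by
    constructor
    · intro hx
      rcases (hF.mem_iff_of_inhomogeneous x).1 hx.1 with h | ⟨z, h⟩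
      · exact absurd hx (hF.not_isSmoothPt_node hd hc hQ h)
      · refine ⟨z, ?_, h⟩
        rintro rfl
        refine hF.not_isSmoothPt_node hd hc hQ ?_ hx
        rw [hQ, ← paramPt_zero_one (Q := Q)]
        exact Submodule.smul_mem _ _ h
    · rintro ⟨z, hz, h⟩
      exact hF.isSmoothPt_of_node hd hnd hQ hz h
  eq_of_smul z _ w hw k h := by
    simpa using hF.eq_mul_of_node hd hQ hw (by simp) h

theorem IsFrame.isUniformized_cusp (hd : 2 ≤ d) (hnd : NonDeg δ) (hF : IsFrame δ Q)
    (hQ : Q 1 = 0) : IsUniformized δ Q Set.univ where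
  ne_zero z := hF.ne_zero z 1 (by simp)
  mem_smoothPts x := by
    constructor
    · intro hx
      rcases (hF.mem_iff_of_inhomogeneous x).1 hx.1 with h | ⟨z, h⟩
      · exact absurd hx (hF.not_isSmoothPt_cusp hd hQ h)
      · exact ⟨z, trivial, h⟩
    · rintro ⟨z, hz, h⟩
      exact hF.isSmoothPt_of_cusp hd hnd hQ h
  eq_of_smul z _ w hw k h := by
    simpa using hF.eq_mul_of_cusp hd hQ (by simp) h

theorem eval_dualPoly_reverse (l : Module.Dual ℂ (Fin (d + 1) → ℂ)) (z : ℂ) :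
    (dualPoly (fun i => Q (d + 1 - i)) l).eval z = l (paramPt Q z 1) := by
  rw [eval_dualPoly, paramPt_reverse]

theorem coeff_prod_X_sub_C_top (z : Fin (d + 1) → ℂ) :
    (∏ j, (X - C (z j))).coeff (d + 1) = 1 := by
  have := (monic_prod_X_sub_C z Finset.univ).coeff_natDegree
  simpa using this

theorem map_eq_mul_coeff_prod {l : Module.Dual ℂ (Fin (d + 1) → ℂ)} {z : Fin (d + 1) → ℂ}
    (hz : Function.Injective z) (h : ∀ i, l (paramPt Q (z i) 1) = 0) {i : ℕ} (hi : i < d + 2) :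
    l (Q i) = l (Q 0) * (∏ j, (X - C (z j))).coeff (d + 1 - i) := by
  let f := dualPoly (fun i => Q (d + 1 - i)) l
  let P : ℂ[X] := ∏ j, (X - C (z j))
  have hPd : P.natDegree = d + 1 := by simp [P]
  have hfd : f.coeff (d + 1) = l (Q 0) := by simp [f, coeff_dualPoly]
  have hfP : f - C (l (Q 0)) * P = 0 := by
    refine eq_zero_of_natDegree_lt_card_of_eval_eq_zero _ hz (fun j => ?_) ?_
    · rw [eval_sub, eval_dualPoly_reverse, h, eval_mul, eval_prod,
        Finset.prod_eq_zero (Finset.mem_univ j) (by simp)]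
      simp
    · rw [Fintype.card_fin, Nat.lt_succ_iff, natDegree_le_iff_coeff_eq_zero]
      intro N hN
      rw [coeff_sub, coeff_C_mul]
      rcases (show d + 1 ≤ N by omega).eq_or_lt with rfl | hN
      · rw [hfd, coeff_prod_X_sub_C_top, mul_one, sub_self]
      · rw [coeff_eq_zero_of_natDegree_lt (p := P) (by rwa [hPd]), coeff_dualPoly, if_neg (by omega)]
        simp
  have := congrArg (fun g => g.coeff (d + 1 - i)) hfP
  simp only [coeff_sub, coeff_C_mul, coeff_zero, f, coeff_dualPoly] at this
  rw [if_pos (by omega), show d + 1 - (d + 1 - i) = i by omega, sub_eq_zero] at this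
  exact this

theorem map_paramPt_eq_zero_of_coeff_prod {l : Module.Dual ℂ (Fin (d + 1) → ℂ)}
    {z : Fin (d + 1) → ℂ} (hl : ∀ i < d + 2, l (Q i) = (∏ j, (X - C (z j))).coeff (d + 1 - i))
    (j : Fin (d + 1)) : l (paramPt Q (z j) 1) = 0 := by
  have : dualPoly (fun i => Q (d + 1 - i)) l = ∏ j, (X - C (z j)) := by
    ext m
    rw [coeff_dualPoly]
    split_ifs with hm
    · rw [hl _ (by omega)]
      congr 1
      omega
    · rw [coeff_eq_zero_of_natDegree_lt]
      simp
      omega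
  rw [← eval_dualPoly_reverse, this, eval_prod,
    Finset.prod_eq_zero (Finset.mem_univ j) (by simp)]

theorem coeff_prod_X_sub_C_zero (z : Fin (d + 1) → ℂ) :
    (∏ j, (X - C (z j))).coeff 0 = (-1) ^ (d + 1) * ∏ j, z j := by
  rw [coeff_zero_eq_eval_zero, eval_prod]
  simp [Finset.prod_neg]

theorem coeff_prod_X_sub_C_pred (z : Fin (d + 1) → ℂ) :
    (∏ j, (X - C (z j))).coeff d = -∑ j, z j := by
  have := prod_X_sub_C_coeff_card_pred Finset.univ z (by simp)
  simpa using this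

theorem IsFrame.exists_dual_iff_prod (hF : IsFrame δ Q) {c : ℂ} (hc : c ≠ 0)
    (hQ : Q 0 = c • Q (d + 1)) {z : Fin (d + 1) → ℂ} (hz : Function.Injective z) :
    (∃ l : Module.Dual ℂ (Fin (d + 1) → ℂ), l ≠ 0 ∧ ∀ i, l (paramPt Q (z i) 1) = 0) ↔
      ∏ j, z j = (-1) ^ (d + 1) / c := by
  have hsign : ((-1 : ℂ) ^ (d + 1)) * (-1) ^ (d + 1) = 1 := by
    rw [← mul_pow]; simp
  rw [eq_div_iff hc]
  constructor
  · rintro ⟨l, hl0, hl⟩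
    have h0 : l (Q 0) ≠ 0 := by
      intro h
      refine hl0 (hF.dual_eq_zero l fun i hi => ?_)
      rw [map_eq_mul_coeff_prod hz hl hi, h, zero_mul]
    have h1 := map_eq_mul_coeff_prod hz hl (i := d + 1) (by omega)
    rw [Nat.sub_self, coeff_prod_X_sub_C_zero] at h1
    have h2 := congrArg l hQ
    rw [map_smul, h1, smul_eq_mul] at h2
    have h3 : 1 = c * ((-1) ^ (d + 1) * ∏ j, z j) := by
      refine mul_left_cancel₀ h0 ?_
      linear_combination h2
    linear_combination -(∏ j, z j) * c * hsign - (-1) ^ (d + 1) * h3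
  · intro h
    obtain ⟨l, hl⟩ := hF.exists_dual_node hQ (fun i => (∏ j, (X - C (z j))).coeff (d + 1 - i)) (by
      rw [Nat.sub_zero, Nat.sub_self, coeff_prod_X_sub_C_top, coeff_prod_X_sub_C_zero]
      linear_combination -hsign - (-1) ^ (d + 1) * h)
    refine ⟨l, ?_, map_paramPt_eq_zero_of_coeff_prod hl⟩
    rintro rfl
    have := hl 0 (by omega)
    rw [Nat.sub_zero, coeff_prod_X_sub_C_top] at this
    simp at this

theorem IsFrame.exists_dual_iff_sum (hF : IsFrame δ Q) (hQ : Q 1 = 0) {z : Fin (d + 1) → ℂ}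
    (hz : Function.Injective z) :
    (∃ l : Module.Dual ℂ (Fin (d + 1) → ℂ), l ≠ 0 ∧ ∀ i, l (paramPt Q (z i) 1) = 0) ↔
      ∑ j, z j = 0 := by
  constructor
  · rintro ⟨l, hl0, hl⟩
    have h0 : l (Q 0) ≠ 0 := by
      intro h
      refine hl0 (hF.dual_eq_zero l fun i hi => ?_)
      rw [map_eq_mul_coeff_prod hz hl hi, h, zero_mul]
    have h1 := map_eq_mul_coeff_prod hz hl (i := 1) (by omega)
    rw [Nat.add_sub_cancel, coeff_prod_X_sub_C_pred, hQ, map_zero, zero_eq_mul] at h1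
    simpa using h1.resolve_left h0
  · intro h
    obtain ⟨l, hl⟩ := hF.exists_dual_cusp hQ (fun i => (∏ j, (X - C (z j))).coeff (d + 1 - i)) (by
      rw [Nat.add_sub_cancel, coeff_prod_X_sub_C_pred, h, neg_zero])
    refine ⟨l, ?_, map_paramPt_eq_zero_of_coeff_prod hl⟩
    rintro rfl
    have := hl 0 (by omega)
    rw [Nat.sub_zero, coeff_prod_X_sub_C_top] at this
    simp at this

end NormalForms

section Groups

variable {d : ℕ} {δ : Set (PS ℂ d)} {Q : ℕ → Fin (d + 1) → ℂ} {T : Set ℂ}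

/-- The transport of an additive commutative group along a bijection. -/
def AbGrp.ofEquiv {α β : Type*} [AddCommGroup β] (e : α ≃ β) : AbGrp α where
  add a b := e.symm (e a + e b)
  zero := e.symm 0
  neg a := e.symm (-e a)
  add_assoc' a b c := by simp [add_assoc]
  add_comm' a b := by rw [add_comm]
  zero_add' a := by simp
  neg_add' a := by simp

theorem AbGrp.apply_sumFin_ofEquiv {α β : Type*} [AddCommGroup β] (e : α ≃ β) {k : ℕ}
    (v : Fin k → α) : e ((AbGrp.ofEquiv e).sumFin v) = ∑ i, e (v i) := by
  have h : ∀ L : List α, e (L.foldr (AbGrp.ofEquiv e).add (AbGrp.ofEquiv e).zero)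
      = (L.map e).sum := by
    intro L
    induction L with
    | nil => simp [AbGrp.ofEquiv]
    | cons a L ih =>
      rw [List.foldr_cons, List.map_cons, List.sum_cons, ← ih]
      simp [AbGrp.ofEquiv]
  rw [AbGrp.sumFin, h, List.map_ofFn, List.sum_ofFn]
  rfl

theorem IsUniformized.exists_equiv (hU : IsUniformized δ Q T) {A : Set (PS ℂ d)} {β : Type*}
    (f : β → ℂ) (hf : Function.Injective f) (hfT : ∀ b, f b ∈ T)
    (hA : ∀ x, x ∈ A ↔ ∃ b, paramPt Q (f b) 1 ∈ x.submodule) :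
    ∃ e : A ≃ β, ∀ x : A, paramPt Q (f (e x)) 1 ∈ x.1.submodule := by
  choose e he using fun x : A => (hA x).1 x.2
  refine ⟨Equiv.ofBijective e ⟨fun x y hxy => ?_, fun b => ?_⟩, he⟩
  · have hx := he x
    have hy := he y
    rw [hxy] at hx
    refine Subtype.ext ?_
    rw [← mk_eq_of_mem_submodule (hU.ne_zero _) hx, mk_eq_of_mem_submodule (hU.ne_zero _) hy]
  · have hb : paramPt Q (f b) 1 ∈
        (Projectivization.mk ℂ (paramPt Q (f b) 1) (hU.ne_zero _)).submodule := by
      rw [Projectivization.submodule_mk]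
      exact Submodule.mem_span_singleton_self _
    refine ⟨⟨_, (hA _).2 ⟨b, hb⟩⟩, hf ?_⟩
    obtain ⟨k, hk⟩ := (mem_submodule_iff_exists_smul (hU.ne_zero _) hb _).1
      (he ⟨_, (hA _).2 ⟨b, hb⟩⟩)
    exact hU.eq_of_smul _ (hfT _) _ (hfT _) k hk

theorem IsUniformized.exists_group (hU : IsUniformized δ Q T) {A : Set (PS ℂ d)} {β : Type*}
    [AddCommGroup β] (f : β → ℂ) (hf : Function.Injective f) (hfT : ∀ b, f b ∈ T)
    (hA : ∀ x, x ∈ A ↔ ∃ b, paramPt Q (f b) 1 ∈ x.submodule) (b₀ : β)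
    (hsum : ∀ b : Fin (d + 1) → β, Function.Injective b →
      ((∃ l : Module.Dual ℂ (Fin (d + 1) → ℂ), l ≠ 0 ∧ ∀ i, l (paramPt Q (f (b i)) 1) = 0) ↔
        ∑ i, b i = b₀)) :
    ∃ G : AbGrp A, ∃ φ : A ≃ β, (∀ a b, φ (G.add a b) = φ a + φ b) ∧ φ G.zero = 0 ∧
      ∀ v : Fin (d + 1) → A, Function.Injective v →
        ((∃ S : Set (PS ℂ d), IsHypSet S ∧ ∀ i, (v i : PS ℂ d) ∈ S) ↔ φ (G.sumFin v) = b₀) := by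
  obtain ⟨e, he⟩ := hU.exists_equiv f hf hfT hA
  refine ⟨AbGrp.ofEquiv e, e, fun a b => by simp [AbGrp.ofEquiv], by simp [AbGrp.ofEquiv],
    fun v hv => ?_⟩
  rw [isHypSet_iff_exists_dual (fun i => (v i : PS ℂ d)) (fun i => paramPt Q (f (e (v i))) 1)
    (fun i => hU.ne_zero _) fun i => he (v i), AbGrp.apply_sumFin_ofEquiv]
  exact hsum (fun i => e (v i)) (e.injective.comp hv)

theorem IsUniformized.exists_group_zero (hU : IsUniformized δ Q T) {A : Set (PS ℂ d)} {β : Type*}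
    [AddCommGroup β] (f : β → ℂ) (hf : Function.Injective f) (hfT : ∀ b, f b ∈ T)
    (hA : ∀ x, x ∈ A ↔ ∃ b, paramPt Q (f b) 1 ∈ x.submodule)
    (hsum : ∀ b : Fin (d + 1) → β, Function.Injective b →
      ((∃ l : Module.Dual ℂ (Fin (d + 1) → ℂ), l ≠ 0 ∧ ∀ i, l (paramPt Q (f (b i)) 1) = 0) ↔
        ∑ i, b i = 0)) :
    ∃ G : AbGrp A, (∀ v : Fin (d + 1) → A, Function.Injective v →
      ((∃ S : Set (PS ℂ d), IsHypSet S ∧ ∀ i, (v i : PS ℂ d) ∈ S) ↔ G.sumFin v = G.zero)) ∧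
      G.Iso (AbGrp.ofGroup β) := by
  obtain ⟨G, φ, hadd, hzero, h⟩ := hU.exists_group f hf hfT hA 0 hsum
  refine ⟨G, fun v hv => ?_, φ, hadd⟩
  rw [h v hv, ← hzero, φ.injective.eq_iff]

theorem IsFrame.exists_group_cusp (hd : 2 ≤ d) (hnd : NonDeg δ) (hF : IsFrame δ Q)
    (hQ : Q 1 = 0) :
    ∃ G : AbGrp (smoothPts δ), (∀ v : Fin (d + 1) → smoothPts δ, Function.Injective v →
      ((∃ S : Set (PS ℂ d), IsHypSet S ∧ ∀ i, (v i : PS ℂ d) ∈ S) ↔ G.sumFin v = G.zero)) ∧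
      G.Iso (AbGrp.ofGroup ℂ) := by
  have hU := hF.isUniformized_cusp hd hnd hQ
  refine hU.exists_group_zero id Function.injective_id (fun _ => trivial) (fun x => ?_)
    fun b hb => hF.exists_dual_iff_sum hQ hb
  simpa using hU.mem_smoothPts x

theorem IsFrame.exists_group_node (hd : 2 ≤ d) (hnd : NonDeg δ) (hF : IsFrame δ Q) {c : ℂ}
    (hc : c ≠ 0) (hQ : Q 0 = c • Q (d + 1)) :
    ∃ G : AbGrp (smoothPts δ), (∀ v : Fin (d + 1) → smoothPts δ, Function.Injective v →
      ((∃ S : Set (PS ℂ d), IsHypSet S ∧ ∀ i, (v i : PS ℂ d) ∈ S) ↔ G.sumFin v = G.zero)) ∧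
      G.Iso (AbGrp.ofGroup (Additive ℂˣ)) := by
  have hU := hF.isUniformized_node hd hnd hc hQ
  obtain ⟨ρ, hρ⟩ := IsAlgClosed.exists_pow_nat_eq ((-1) ^ (d + 1) / c) (Nat.succ_pos d)
  have hκ : (-1) ^ (d + 1) / c ≠ 0 := div_ne_zero (pow_ne_zero _ (by norm_num)) hc
  have hρ0 : ρ ≠ 0 := by
    rintro rfl
    rw [zero_pow (by omega)] at hρ
    exact hκ hρ.symm
  have hinj : Function.Injective fun b : Additive ℂˣ => ρ * (b.toMul : ℂˣ) := by
    intro b b' h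
    exact Additive.toMul.injective (Units.ext (mul_left_cancel₀ hρ0 h))
  refine hU.exists_group_zero _ hinj (fun b => mul_ne_zero hρ0 b.toMul.ne_zero)
    (fun x => ?_) fun b hb => ?_
  · rw [hU.mem_smoothPts]
    constructor
    · rintro ⟨z, hz, h⟩
      refine ⟨Additive.ofMul (Units.mk0 (z / ρ) (div_ne_zero hz hρ0)), ?_⟩
      simpa [mul_div_cancel₀ _ hρ0] using h
    · rintro ⟨b, h⟩
      exact ⟨_, mul_ne_zero hρ0 b.toMul.ne_zero, h⟩
  · refine (hF.exists_dual_iff_prod hc hQ (hinj.comp hb)).trans ?_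
    have h1 : ∏ j, ρ * ((b j).toMul : ℂ) = (-1) ^ (d + 1) / c * (((∑ j, b j).toMul : ℂˣ) : ℂ) := by
      rw [Finset.prod_mul_distrib, Finset.prod_const, Finset.card_univ, Fintype.card_fin, hρ,
        toMul_sum, Units.coe_prod]
    change ∏ j, ρ * ((b j).toMul : ℂ) = _ ↔ _
    rw [h1, mul_eq_left₀ hκ, Units.val_eq_one]
    exact toMul_eq_one

theorem det_ne_zero_of_not_smul {s t : Fin 2 → ℂ} (ht : t ≠ 0) (hst : ¬∃ c : ℂ, s = c • t) :
    s 0 * t 1 - s 1 * t 0 ≠ 0 := by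
  intro h
  rcases eq_or_ne (t 0) 0 with h0 | h0
  · have h1 : t 1 ≠ 0 := by
      intro h1
      refine ht (funext fun j => ?_)
      fin_cases j
      exacts [h0, h1]
    refine hst ⟨s 1 / t 1, funext fun j => ?_⟩
    fin_cases j
    · rw [h0, mul_zero, sub_zero, mul_eq_zero] at h
      simp [h0, h.resolve_right h1]
    · simp [h1]
  · refine hst ⟨s 0 / t 0, funext fun j => ?_⟩
    fin_cases j
    · simp [h0]
    · simp
      field_simp
      linear_combination -h

theorem exists_node_frame (hnd : NonDeg δ) {q : Fin (d + 1) → MvPolynomial (Fin 2) ℂ}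
    (hq : IsParamOf q δ (d + 1)) {s t : Fin 2 → ℂ} (hst : s 0 * t 1 - s 1 * t 0 ≠ 0) {c : ℂ}
    (h : (fun i => MvPolynomial.eval s (q i)) = c • fun i => MvPolynomial.eval t (q i)) :
    ∃ Q, IsFrame δ Q ∧ Q 0 = c • Q (d + 1) ∧
      ∀ u v, paramPt Q u v = fun i => MvPolynomial.eval (u • s + v • t) (q i) := by
  obtain ⟨Q, hF, hQ⟩ := exists_frame hnd hq hst
  refine ⟨Q, hF, ?_, hQ⟩
  rw [← paramPt_one_zero (Q := Q), ← paramPt_zero_one (Q := Q), hQ, hQ]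
  simpa using h

theorem exists_node_frame_of_not_cuspidal (hδ : IsRationalSingular δ) (h : ¬IsCuspidalCurve δ) :
    ∃ (Q : ℕ → Fin (d + 1) → ℂ) (c : ℂ), IsFrame δ Q ∧ c ≠ 0 ∧ Q 0 = c • Q (d + 1) := by
  obtain ⟨q, hq⟩ := hδ.2.2.2.1
  have hinj : ¬ParamInjective q := fun hi => h ⟨hδ, q, hq, hi⟩
  unfold ParamInjective at hinj
  push Not at hinj
  obtain ⟨s, t, hs, ht, ⟨c, hc, hst⟩, hne⟩ := hinj
  have hdet := det_ne_zero_of_not_smul (s := s) ht (by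
    rintro ⟨k, hk⟩
    refine hne k ?_ hk
    rintro rfl
    exact hs (by rw [hk, zero_smul]))
  obtain ⟨Q, hF, hQ, -⟩ := exists_node_frame hδ.2.1 hq hdet hst
  exact ⟨Q, c, hF, hc, hQ⟩

theorem IsFrame.exists_cusp_frame (hnd : NonDeg δ) (hF : IsFrame δ Q) {k : ℂ}
    (hQ : Q 1 = k • Q 0) : ∃ Q', IsFrame δ Q' ∧ Q' 1 = 0 := by
  obtain ⟨Q', hF', hQ'⟩ := hF.exists_change hnd (a := 1) (b := -(k / (d + 1))) (a' := 0) (b' := 1)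
    (by simp)
  refine ⟨Q', hF', ?_⟩
  ext m
  set μ : ℂ := k / (d + 1) with hμ
  have hμd : (d + 1 : ℂ) * μ = k := mul_div_cancel₀ _ (by exact_mod_cast Nat.succ_ne_zero d)
  let f : Polynomial ℂ := ∑ i ∈ Finset.range (d + 2),
    Polynomial.C (Q i m) * (1 - Polynomial.C μ * Polynomial.X) ^ (d + 1 - i) * Polynomial.X ^ i
  have hf : ∀ v, LinearMap.proj (R := ℂ) (φ := fun _ => ℂ) m (paramPt Q' 1 v) = f.eval v := by
    intro v
    rw [hQ', LinearMap.proj_apply]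
    simp only [paramPt, f, Finset.sum_apply, Pi.smul_apply, smul_eq_mul,
      Polynomial.eval_finsetSum, Polynomial.eval_mul, Polynomial.eval_C, Polynomial.eval_pow,
      Polynomial.eval_sub, Polynomial.eval_one, Polynomial.eval_X]
    exact Finset.sum_congr rfl fun i _ => by ring
  have h1 := map_eq_coeff _ hf (i := 1) (by omega)
  rw [LinearMap.proj_apply] at h1
  have hd1 : ((1 - Polynomial.C μ * Polynomial.X) ^ (d + 1)).coeff 1 = -k := by
    have := Polynomial.coeff_derivative ((1 - Polynomial.C μ * Polynomial.X) ^ (d + 1)) 0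
    rw [Polynomial.coeff_zero_eq_eval_zero] at this
    simp [Polynomial.derivative_pow] at this
    rw [← this, hμd]
  have hd2 : ((1 - Polynomial.C μ * Polynomial.X) ^ d).coeff 0 = 1 := by
    rw [Polynomial.coeff_zero_eq_eval_zero]
    simp
  rw [h1, Polynomial.finsetSum_coeff, Finset.sum_range_succ', Finset.sum_range_succ',
    Finset.sum_eq_zero fun i _ => by
      rw [Polynomial.coeff_mul_X_pow', if_neg (by omega)], hQ]
  simp only [Nat.sub_zero, pow_zero, mul_one, zero_add, Nat.add_sub_cancel, pow_one,
    Polynomial.coeff_C_mul, hd1, Polynomial.coeff_mul_X _ 0, hd2, Pi.smul_apply, smul_eq_mul,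
    Pi.zero_apply]
  ring

theorem exists_cusp_frame_of_cuspidal (h : IsCuspidalCurve δ) : ∃ Q, IsFrame δ Q ∧ Q 1 = 0 := by
  obtain ⟨hδ, q, hq, hinj⟩ := h
  have hns := hδ.2.2.2.2
  unfold IsSmoothCurve at hns
  push Not at hns
  obtain ⟨x, hx, hns⟩ := hns
  have hx' := hx
  rw [hq.2.2] at hx'
  obtain ⟨s, hs, rfl⟩ := hx'
  have hs0 : s ≠ 0 := by
    rintro rfl
    refine hs (funext fun i => ?_)
    have := eval_smul_of_isHomogeneous (hq.1 i) 0 0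
    rwa [zero_smul, zero_pow (by omega), zero_mul] at this
  obtain ⟨t, hst⟩ : ∃ t : Fin 2 → ℂ, s 0 * t 1 - s 1 * t 0 ≠ 0 := by
    rcases eq_or_ne (s 0) 0 with h0 | h0
    · refine ⟨![1, 0], fun h => hs0 (funext fun j => ?_)⟩
      fin_cases j
      · exact h0
      · simpa using h
    · exact ⟨![0, 1], by simpa using h0⟩
  obtain ⟨Q, hF, hQ⟩ := exists_frame hδ.2.1 hq hst
  have hQ0 : Q 0 = fun i => MvPolynomial.eval s (q i) := by
    rw [← paramPt_one_zero (Q := Q), hQ]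
    simp
  by_contra hno
  refine hns (hF.isSmoothPt ?_ (fun u v k hv h => ?_) fun k h => ?_)
  · rw [hQ0, Projectivization.submodule_mk]
    exact Submodule.mem_span_singleton_self _
  · have hne := hF.ne_zero u v (Or.inr hv)
    have hk : k ≠ 0 := by
      rintro rfl
      exact hne (by rw [h, zero_smul])
    have hr : u • s + v • t ≠ 0 := by
      intro h0
      rw [hQ, h0] at hne
      refine hne (funext fun i => ?_)
      have := eval_smul_of_isHomogeneous (hq.1 i) 0 0
      rwa [zero_smul, zero_pow (by omega), zero_mul] at this
    rw [hQ, hQ0] at h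
    obtain ⟨m, -, hm⟩ := hinj _ _ hr hs0 ⟨k, hk, h⟩
    have h0 := congrFun hm 0
    have h1 := congrFun hm 1
    simp only [Pi.add_apply, Pi.smul_apply, smul_eq_mul] at h0 h1
    refine mul_ne_zero hv hst ?_
    linear_combination s 0 * h1 - s 1 * h0
  · exact hno (hF.exists_cusp_frame hδ.2.1 h)

end Groups

section RealPoints

variable {d : ℕ} {δ : Set (PS ℂ d)} {Q : ℕ → Fin (d + 1) → ℂ} {T : Set ℂ}

theorem isRealPt_iff_exists_star {n : ℕ} {x : PS ℂ n} {y : Fin (n + 1) → ℂ} (hy : y ≠ 0)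
    (h : y ∈ x.submodule) : IsRealPt x ↔ ∃ k : ℂ, star y = k • y := by
  constructor
  · rintro ⟨v, hv, hv0, hr⟩
    obtain ⟨c, rfl⟩ := (mem_submodule_iff_exists_smul hy h v).1 hv
    have hc : c ≠ 0 := by
      rintro rfl
      simp at hv0
    have hstar : star (c • y) = c • y := funext fun i => Complex.conj_eq_iff_im.2 (hr i)
    rw [star_smul] at hstar
    refine ⟨(star c)⁻¹ * c, ?_⟩
    rw [mul_smul, ← hstar, smul_smul, inv_mul_cancel₀ (star_ne_zero.2 hc), one_smul]
  · rintro ⟨k, hk⟩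
    obtain ⟨i, hi⟩ : ∃ i, y i ≠ 0 := by
      by_contra! h0
      exact hy (funext h0)
    have hki : star (y i) = k * y i := congrFun hk i
    have hk0 : k ≠ 0 := by
      rintro rfl
      rw [zero_mul, star_eq_zero] at hki
      exact hi hki
    refine ⟨(y i)⁻¹ • y, Submodule.smul_mem _ _ h, smul_ne_zero (inv_ne_zero hi) hy,
      fun j => Complex.conj_eq_iff_im.1 ?_⟩
    have hkj : star (y j) = k * y j := congrFun hk j
    rw [starRingEnd_apply, Pi.smul_apply, smul_eq_mul, star_mul', star_inv₀, hki, hkj]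
    field_simp

theorem star_eval_of_im_eq_zero {σ : Type*} {f : MvPolynomial σ ℂ} (hf : ∀ m, (f.coeff m).im = 0)
    (r : σ → ℂ) : star (MvPolynomial.eval r f) = MvPolynomial.eval (star r) f := by
  rw [MvPolynomial.eval_eq, MvPolynomial.eval_eq, star_sum]
  refine Finset.sum_congr rfl fun m _ => ?_
  rw [star_mul', star_prod, ← starRingEnd_apply, Complex.conj_eq_iff_im.2 (hf m)]
  simp

theorem IsUniformized.mem_real_smoothPts_iff (hU : IsUniformized δ Q T) (x : PS ℂ d) :
    x ∈ {x ∈ smoothPts δ | IsRealPt x} ↔ ∃ z ∈ T, (∃ k : ℂ, star (paramPt Q z 1) =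
      k • paramPt Q z 1) ∧ paramPt Q z 1 ∈ x.submodule := by
  constructor
  · rintro ⟨hx, hr⟩
    obtain ⟨z, hz, h⟩ := (hU.mem_smoothPts x).1 hx
    exact ⟨z, hz, (isRealPt_iff_exists_star (hU.ne_zero z) h).1 hr, h⟩
  · rintro ⟨z, hz, hr, h⟩
    exact ⟨(hU.mem_smoothPts x).2 ⟨z, hz, h⟩, (isRealPt_iff_exists_star (hU.ne_zero z) h).2 hr⟩

/-- The parametrisation of the nonzero real numbers by `ℝ × ℤ₂`. -/
def signedExp (b : ℝ × ZMod 2) : ℝ := (if b.2 = 0 then 1 else -1) * Real.exp b.1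

theorem signedExp_zero : signedExp 0 = 1 := by simp [signedExp]

theorem signedExp_add (a b : ℝ × ZMod 2) : signedExp (a + b) = signedExp a * signedExp b := by
  have h : ∀ x y : ZMod 2, (if x + y = 0 then (1 : ℝ) else -1) =
      (if x = 0 then 1 else -1) * (if y = 0 then 1 else -1) := by
    intro x y
    have hx : x = 0 ∨ x = 1 := by revert x; decide
    have hy : y = 0 ∨ y = 1 := by revert y; decide
    have h2 : (1 + 1 : ZMod 2) = 0 := by decide
    rcases hx with rfl | rfl <;> rcases hy with rfl | rfl <;> simp [h2]
  simp only [signedExp, Prod.fst_add, Prod.snd_add, h, Real.exp_add]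
  ring

theorem signedExp_ne_zero (b : ℝ × ZMod 2) : signedExp b ≠ 0 := by
  unfold signedExp
  split_ifs <;> simp

theorem signedExp_injective : Function.Injective signedExp := by
  rintro ⟨r, x⟩ ⟨s, y⟩ h
  have hx : x = 0 ∨ x = 1 := by clear h; revert x; decide
  have hy : y = 0 ∨ y = 1 := by clear h; revert y; decide
  have hr := Real.exp_pos r
  have hs := Real.exp_pos s
  rcases hx with rfl | rfl <;> rcases hy with rfl | rfl <;> simp [signedExp] at h <;>
    first | linarith | simp [h]

theorem exists_signedExp_eq {r : ℝ} (hr : r ≠ 0) : ∃ x : ZMod 2, signedExp (Real.log |r|, x) = r := by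
  rcases lt_or_gt_of_ne hr with h | h
  · exact ⟨1, by simp [signedExp, abs_of_neg h, Real.exp_log_of_neg h]⟩
  · exact ⟨0, by simp [signedExp, Real.exp_log h]⟩

theorem signedExp_sum {ι : Type*} (s : Finset ι) (b : ι → ℝ × ZMod 2) :
    signedExp (∑ i ∈ s, b i) = ∏ i ∈ s, signedExp (b i) := by
  induction s using Finset.induction_on with
  | empty => simp [signedExp_zero]
  | insert i s hi ih => rw [Finset.sum_insert hi, Finset.prod_insert hi, signedExp_add, ih]

theorem star_paramPt_of_crunode {q : Fin (d + 1) → MvPolynomial (Fin 2) ℂ} (hq : IsRealParam q)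
    {s t : Fin 2 → ℂ} (hs : ∀ j, (s j).im = 0) (ht : ∀ j, (t j).im = 0)
    (hQ : ∀ u v, paramPt Q u v = fun i => MvPolynomial.eval (u • s + v • t) (q i)) (u v : ℂ) :
    star (paramPt Q u v) = paramPt Q (star u) (star v) := by
  have hs' : star s = s := funext fun j => Complex.conj_eq_iff_im.2 (hs j)
  have ht' : star t = t := funext fun j => Complex.conj_eq_iff_im.2 (ht j)
  rw [hQ, hQ]
  ext i
  rw [Pi.star_apply, star_eval_of_im_eq_zero (hq i), star_add, star_smul, star_smul, hs', ht']

theorem exists_group_crunodal (hd : 2 ≤ d) (h : IsCrunodalCurve δ) :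
    ∃ Gr : AbGrp ↥{x ∈ smoothPts δ | IsRealPt x},
      ∃ φ : ↥{x ∈ smoothPts δ | IsRealPt x} ≃ ℝ × ZMod 2,
        (∀ a b, φ (Gr.add a b) = φ a + φ b) ∧
        ∃ ε : ZMod 2, ∀ v : Fin (d + 1) → ↥{x ∈ smoothPts δ | IsRealPt x},
          Function.Injective v →
            ((∃ S : Set (PS ℂ d), IsHypSet S ∧ ∀ i, (v i : PS ℂ d) ∈ S) ↔
              φ (Gr.sumFin v) = ((0 : ℝ), ε)) := by
  obtain ⟨hδ, -, q, hq, hqr, s, t, -, ht0, hst, hs, ht, c, hc, hcst⟩ := h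
  obtain ⟨Q, hF, hQ, hQq⟩ := exists_node_frame hδ.2.1 hq (det_ne_zero_of_not_smul ht0 hst) hcst
  have hU := hF.isUniformized_node hd hδ.2.1 hc hQ
  have hstar := star_paramPt_of_crunode hqr hs ht hQq
  have hcr : star c = c := by
    have h0 := hstar 1 0
    have h1 := hstar 0 1
    simp only [star_one, star_zero, paramPt_one_zero, paramPt_zero_one] at h0 h1
    have hne : Q (d + 1) ≠ 0 := by
      rw [← paramPt_zero_one (Q := Q)]
      exact hF.ne_zero 0 1 (by simp)
    rw [hQ, star_smul, h1] at h0
    exact smul_left_injective ℂ hne h0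
  obtain ⟨r, rfl⟩ := Complex.conj_eq_iff_real.1 hcr
  have hr : r ≠ 0 := by exact_mod_cast hc
  have hκ0 : (-1) ^ (d + 1) / r ≠ 0 := div_ne_zero (pow_ne_zero _ (by norm_num)) hr
  obtain ⟨κ, hκ⟩ : ∃ κ, κ = (-1) ^ (d + 1) / r := ⟨_, rfl⟩
  rw [← hκ] at hκ0
  obtain ⟨ε, hε⟩ := exists_signedExp_eq hκ0
  let τ : ℝ × ZMod 2 := (Real.log |κ| / (d + 1), 0)
  have hinj : Function.Injective fun b => ((signedExp (τ + b) : ℝ) : ℂ) :=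
    Complex.ofReal_injective.comp (signedExp_injective.comp (add_right_injective τ))
  have hA : ∀ x, x ∈ {x ∈ smoothPts δ | IsRealPt x} ↔
      ∃ b, paramPt Q (signedExp (τ + b) : ℝ) 1 ∈ x.submodule := by
    intro x
    rw [hU.mem_real_smoothPts_iff]
    constructor
    · rintro ⟨z, hz, ⟨k, hk⟩, h⟩
      rw [hstar, star_one] at hk
      obtain ⟨w, rfl⟩ := Complex.conj_eq_iff_real.1
        (hU.eq_of_smul _ (star_ne_zero.2 hz) _ hz k hk)
      obtain ⟨x, hx⟩ := exists_signedExp_eq (r := w) (Complex.ofReal_ne_zero.1 hz)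
      exact ⟨(Real.log |w|, x) - τ, by rwa [add_sub_cancel, hx]⟩
    · rintro ⟨b, hb⟩
      refine ⟨_, Complex.ofReal_ne_zero.2 (signedExp_ne_zero _), ⟨1, ?_⟩, hb⟩
      rw [hstar, star_one, one_smul]
      congr 1
      exact Complex.conj_ofReal _
  have hsum : ∀ b : Fin (d + 1) → ℝ × ZMod 2, Function.Injective b →
      ((∃ l : Module.Dual ℂ (Fin (d + 1) → ℂ), l ≠ 0 ∧
        ∀ i, l (paramPt Q (signedExp (τ + b i) : ℝ) 1) = 0) ↔ ∑ i, b i = (0, ε)) := by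
    intro b hb
    refine (hF.exists_dual_iff_prod hc hQ (hinj.comp hb)).trans ?_
    have h1 : (-1) ^ (d + 1) / (r : ℂ) = (κ : ℂ) := by rw [hκ]; push_cast; rfl
    have h2 : ∑ i, (τ + b i) = (Real.log |κ|, 0) + ∑ i, b i := by
      rw [Finset.sum_add_distrib, Finset.sum_const, Finset.card_univ, Fintype.card_fin]
      congr 1
      refine Prod.ext ?_ (by simp [τ])
      simp [τ]
      field_simp
    simp only [Function.comp_apply]
    rw [h1, ← Complex.ofReal_prod, Complex.ofReal_inj, ← signedExp_sum, ← hε,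
      signedExp_injective.eq_iff, h2,
      show ((Real.log |κ|, ε) : ℝ × ZMod 2) = (Real.log |κ|, 0) + (0, ε) by simp, add_right_inj]
  obtain ⟨G, φ, hadd, -, hG⟩ := hU.exists_group _ hinj
    (fun b => Complex.ofReal_ne_zero.2 (signedExp_ne_zero _)) hA (0, ε) hsum
  exact ⟨G, φ, hadd, ε, hG⟩

theorem exists_group_acnodal (hd : 2 ≤ d) (h : IsAcnodalCurve δ) :
    ∃ Gr : AbGrp ↥{x ∈ smoothPts δ | IsRealPt x},
      (∀ v : Fin (d + 1) → ↥{x ∈ smoothPts δ | IsRealPt x}, Function.Injective v →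
        ((∃ S : Set (PS ℂ d), IsHypSet S ∧ ∀ i, (v i : PS ℂ d) ∈ S) ↔
          Gr.sumFin v = Gr.zero)) ∧
      Gr.Iso (AbGrp.ofGroup (AddCircle (1 : ℝ))) := by
  obtain ⟨hδ, -, q, hq, hqr, s, t, -, ht0, hst, ⟨c₁, hc₁, hcst⟩, c₂, hc₂, ht⟩ := h
  change t = c₂ • star s at ht
  have hs' : star s ≠ 0 := by
    rintro h
    exact ht0 (by rw [ht, h, smul_zero])
  have hdet := det_ne_zero_of_not_smul (s := s) hs' (by
    rintro ⟨k, hk⟩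
    exact hst ⟨k / c₂, by rw [ht, smul_smul, div_mul_cancel₀ _ hc₂, ← hk]⟩)
  obtain ⟨Q, hF, hQ, hQq⟩ := exists_node_frame (c := c₁ * c₂ ^ (d + 1)) hδ.2.1 hq hdet (by
    rw [hcst, mul_smul]
    congr 1
    ext i
    rw [ht, eval_smul_of_isHomogeneous (hq.1 i)]
    rfl)
  obtain ⟨c, hcdef⟩ : ∃ c, c = c₁ * c₂ ^ (d + 1) := ⟨_, rfl⟩
  have hc : c ≠ 0 := by
    rw [hcdef]
    exact mul_ne_zero hc₁ (pow_ne_zero _ hc₂)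
  rw [← hcdef] at hQ
  have hU := hF.isUniformized_node hd hδ.2.1 hc hQ
  have hstar : ∀ u v, star (paramPt Q u v) = paramPt Q (star v) (star u) := by
    intro u v
    rw [hQq, hQq]
    ext i
    rw [Pi.star_apply, star_eval_of_im_eq_zero (hqr i), star_add, star_smul, star_smul, star_star,
      add_comm (star u • star s)]
  have hcn : ‖c‖ = 1 := by
    have h0 := hstar 1 0
    have h1 := hstar 0 1
    simp only [star_one, star_zero, paramPt_one_zero, paramPt_zero_one] at h0 h1
    have hne : Q (d + 1) ≠ 0 := by
      rw [← paramPt_zero_one (Q := Q)]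
      exact hF.ne_zero 0 1 (by simp)
    rw [hQ, star_smul, h1, hQ, smul_smul] at h0
    have h2 : star c * c = 1 := smul_left_injective ℂ hne (by simpa using h0)
    have h3 := congrArg norm h2
    rw [norm_mul, norm_star, norm_one] at h3
    nlinarith [norm_nonneg c]
  obtain ⟨ρ, hρ⟩ := IsAlgClosed.exists_pow_nat_eq ((-1) ^ (d + 1) / c) (Nat.succ_pos d)
  have hκ : (-1) ^ (d + 1) / c ≠ 0 := div_ne_zero (pow_ne_zero _ (by norm_num)) hc
  have hρn : ‖ρ‖ = 1 := by
    have := congrArg norm hρ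
    rw [norm_pow, norm_div, norm_pow, norm_neg, norm_one, one_pow, hcn, div_one] at this
    exact (pow_eq_one_iff_of_nonneg (norm_nonneg ρ) (by omega)).1 this
  have hρ0 : ρ ≠ 0 := by
    rintro rfl
    simp at hρn
  have hinj : Function.Injective fun b : AddCircle (1 : ℝ) => ρ * (b.toCircle : ℂ) := by
    intro b b' h
    exact AddCircle.injective_toCircle one_ne_zero (Circle.ext (mul_left_cancel₀ hρ0 h))
  refine hU.exists_group_zero _ hinj (fun b => mul_ne_zero hρ0 b.toCircle.coe_ne_zero)
    (fun x => ?_) fun b hb => ?_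
  · rw [hU.mem_real_smoothPts_iff]
    constructor
    · rintro ⟨z, hz, ⟨k, hk⟩, h⟩
      rw [hstar, star_one] at hk
      have hz1 := hF.eq_mul_of_node hd hQ hz (by simp) hk
      have hzn : ‖z‖ = 1 := by
        have := congrArg norm hz1
        rw [norm_mul, norm_star, norm_one] at this
        nlinarith [norm_nonneg z]
      obtain ⟨b, hb⟩ := (AddCircle.homeomorphCircle one_ne_zero).surjective
        (⟨z / ρ, by simp [Submonoid.unitSphere, hzn, hρn]⟩ : Circle)
      refine ⟨b, ?_⟩
      rw [AddCircle.homeomorphCircle_apply] at hb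
      rw [hb]
      simpa [mul_div_cancel₀ _ hρ0] using h
    · rintro ⟨b, hb⟩
      obtain ⟨z, hz⟩ : ∃ z, z = ρ * (b.toCircle : ℂ) := ⟨_, rfl⟩
      have hzn : ‖z‖ = 1 := by rw [hz, norm_mul, hρn, Circle.norm_coe, mul_one]
      have hzz : star z * z = 1 := by
        rw [← starRingEnd_apply, Complex.conj_mul', hzn]
        simp
      rw [← hz] at hb
      refine ⟨z, ?_, ⟨(star z) ^ (d + 1), ?_⟩, hb⟩
      · rintro rfl
        simp at hzn
      · rw [← paramPt_smul, hstar, hzz, star_one, mul_one]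
  · refine (hF.exists_dual_iff_prod hc hQ (hinj.comp hb)).trans ?_
    have hsum : ∀ s : Finset (Fin (d + 1)),
        (∑ j ∈ s, b j).toCircle = ∏ j ∈ s, (b j).toCircle := by
      intro s
      induction s using Finset.induction_on with
      | empty => simp
      | insert i s hi ih =>
        rw [Finset.sum_insert hi, Finset.prod_insert hi, AddCircle.toCircle_add, ih]
    have h1 : ∏ j, ρ * ((b j).toCircle : ℂ) = (-1) ^ (d + 1) / c * ((∑ j, b j).toCircle : ℂ) := by
      rw [Finset.prod_mul_distrib, Finset.prod_const, Finset.card_univ, Fintype.card_fin, hρ, hsum]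
      congr 1
      exact (map_prod Circle.coeHom _ _).symm
    change ∏ j, ρ * ((b j).toCircle : ℂ) = _ ↔ _
    rw [h1, mul_eq_left₀ hκ, Circle.coe_eq_one, ← AddCircle.toCircle_zero (T := (1 : ℝ)),
      (AddCircle.injective_toCircle one_ne_zero).eq_iff]

end RealPoints

section RealCusp

open Polynomial

theorem rootMultiplicity_pow' {p : ℂ[X]} (hp : p ≠ 0) (x : ℂ) (n : ℕ) :
    (p ^ n).rootMultiplicity x = n * p.rootMultiplicity x := by
  induction n with
  | zero => simp [rootMultiplicity_eq_zero]
  | succ n ih =>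
    rw [pow_succ, rootMultiplicity_mul (mul_ne_zero (pow_ne_zero _ hp) hp), ih]
    ring

theorem not_infinite_of_star_eq {R : Set ℂ} (hR : R.Infinite) {w : ℂ}
    (h : ∀ z ∈ R, z ≠ 0 → star z = w) : False := by
  refine hR (((Set.finite_singleton (star w)).insert 0).subset fun z hz => ?_)
  rcases eq_or_ne z 0 with h0 | h0
  · exact Or.inl h0
  · right
    rw [Set.mem_singleton_iff, ← h z hz h0, star_star]

theorem eq_C_mul_X_pow_of_coeff {p : ℂ[X]} {n : ℕ} (h : ∀ i, i ≠ n → p.coeff i = 0) :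
    p = C (p.coeff n) * X ^ n := by
  ext i
  rw [coeff_C_mul_X_pow]
  split_ifs with hi
  · rw [hi]
  · exact h i hi

section ConjugateCoordinates

variable {d : ℕ} {A : ℕ → ℂ[X]} {R : Set ℂ}

theorem pow_eq_of_conj_coordinates (hR : R.Infinite)
    (hA : ∀ z ∈ R, ∃ κ, ∀ k ≤ d + 1, k ≠ d → (A k).eval z = κ * star z ^ k)
    {k : ℕ} (hk : k ≤ d + 1) (hkd : k ≠ d) :
    A k ^ (d + 1) = A 0 ^ (d + 1 - k) * A (d + 1) ^ k := by
  rcases Nat.eq_zero_or_pos d with rfl | hd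
  · interval_cases k
    · exact absurd rfl hkd
    · simp
  refine eq_of_infinite_eval_eq _ _ (hR.mono fun z hz => ?_)
  obtain ⟨κ, h⟩ := hA z hz
  change eval z _ = eval z _
  rw [eval_mul, eval_pow, eval_pow, eval_pow, h k hk hkd, h 0 (by omega) (by omega),
    h (d + 1) le_rfl (by omega), mul_pow, mul_pow, pow_zero, one_pow, mul_one,
    mul_pow, ← pow_mul, ← pow_mul, ← mul_assoc, ← pow_add, mul_comm k, Nat.sub_add_cancel hk]

theorem eval_zero_ne_zero_of_conj_coordinates (hd : 2 ≤ d) (hR : R.Infinite)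
    (hA : ∀ z ∈ R, ∃ κ, ∀ k ≤ d + 1, k ≠ d → (A k).eval z = κ * star z ^ k)
    (hdeg : ∀ k, (A k).natDegree ≤ d + 1) (hcoeff : ∀ k, (A k).coeff d = 0)
    (hne : ∀ z, ∃ k ≤ d + 1, k ≠ d ∧ (A k).eval z ≠ 0) (x : ℂ) : (A 0).eval x ≠ 0 := by
  intro hx
  have hpow : ∀ {k : ℕ}, k ≤ d + 1 → k ≠ d → A k ^ (d + 1) = A 0 ^ (d + 1 - k) * A (d + 1) ^ k :=
    fun hk hkd => pow_eq_of_conj_coordinates hR hA hk hkd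
  have hA0 : A 0 ≠ 0 := by
    intro h0
    obtain ⟨z, hz⟩ := hR.nonempty
    obtain ⟨κ, h⟩ := hA z hz
    obtain ⟨k, hk, hkd, hk0⟩ := hne z
    have h1 := h 0 (by omega) (by omega)
    rw [h0, eval_zero, pow_zero, mul_one] at h1
    rw [h k hk hkd, ← h1, zero_mul] at hk0
    exact hk0 rfl
  have htop : (A (d + 1)).eval x ≠ 0 := by
    obtain ⟨k, hk, hkd, hk0⟩ := hne x
    rcases hk.eq_or_lt with rfl | hlt
    · exact hk0
    · have := congrArg (eval x) (hpow hk hkd)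
      rw [eval_pow, eval_mul, eval_pow, hx, zero_pow (by omega), zero_mul] at this
      exact absurd (pow_eq_zero_iff (by omega) |>.1 this) hk0
  have htop0 : A (d + 1) ≠ 0 := by
    intro h
    rw [h, eval_zero] at htop
    exact htop rfl
  have hone := hpow (k := 1) (by omega) (by omega)
  rw [Nat.add_sub_cancel, pow_one] at hone
  have hA1 : A 1 ≠ 0 := by
    intro h
    rw [h, zero_pow (by omega)] at hone
    exact mul_ne_zero (pow_ne_zero _ hA0) htop0 hone.symm
  have hmult := congrArg (rootMultiplicity x) hone
  rw [rootMultiplicity_mul (mul_ne_zero (pow_ne_zero _ hA0) htop0), rootMultiplicity_pow' hA1,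
    rootMultiplicity_pow' hA0, rootMultiplicity_eq_zero (p := A (d + 1)) htop, add_zero] at hmult
  obtain ⟨e, he⟩ : d + 1 ∣ (A 0).rootMultiplicity x :=
    (Nat.coprime_self_add_left.2 (Nat.coprime_one_left d)).dvd_of_dvd_mul_left
      ⟨_, hmult.symm⟩
  have hpos := (rootMultiplicity_pos hA0).2 hx
  have he1 : 1 ≤ e := by
    rcases Nat.eq_zero_or_pos e with rfl | h
    · omega
    · exact h
  have hm1 : d ≤ (A 1).rootMultiplicity x := by
    rw [he] at hmult
    have : (A 1).rootMultiplicity x = d * e :=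
      Nat.eq_of_mul_eq_mul_left (Nat.succ_pos d) (by rw [Nat.succ_eq_add_one, hmult]; ring)
    rw [this]
    exact Nat.le_mul_of_pos_right d he1
  have hm0 : d + 1 ≤ (A 0).rootMultiplicity x := by
    rw [he]
    exact Nat.le_mul_of_pos_right (d + 1) he1
  obtain ⟨B, hB⟩ := (pow_dvd_pow _ hm0).trans (pow_rootMultiplicity_dvd (A 0) x)
  have hB0 : B ≠ 0 := by
    rintro rfl
    exact hA0 (by rw [hB, mul_zero])
  have hBdeg : B.natDegree = 0 := by
    have := hdeg 0
    rw [hB, natDegree_mul (pow_ne_zero _ (X_sub_C_ne_zero x)) hB0, natDegree_pow,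
      natDegree_X_sub_C] at this
    omega
  obtain ⟨b, rfl⟩ : ∃ b, B = C b := ⟨_, eq_C_of_natDegree_eq_zero hBdeg⟩
  have hb : b ≠ 0 := by
    rintro rfl
    exact hB0 C_0
  have hx0 : x = 0 := by
    have h := hcoeff 0
    rw [hB, sub_eq_add_neg, ← C_neg, coeff_mul_C, coeff_X_add_C_pow, show d + 1 - d = 1 by omega, pow_one,
      Nat.choose_succ_self_right] at h
    have : (d + 1 : ℂ) ≠ 0 := by exact_mod_cast Nat.succ_ne_zero d
    simpa [hb, this] using h
  subst hx0
  rw [C_0, sub_zero] at hB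
  have hdvd : X ^ d ∣ A 1 := by
    have := (pow_dvd_pow _ hm1).trans (pow_rootMultiplicity_dvd (A 1) 0)
    rwa [C_0, sub_zero] at this
  have hA1' := eq_C_mul_X_pow_of_coeff (p := A 1) (n := d + 1) fun i hi => by
    rcases lt_trichotomy i d with h | rfl | h
    · exact X_pow_dvd_iff.1 hdvd i h
    · exact hcoeff 1
    · exact coeff_eq_zero_of_natDegree_lt ((hdeg 1).trans_lt (by omega))
  refine not_infinite_of_star_eq hR (w := (A 1).coeff (d + 1) / b) fun z hz hz0 => ?_
  obtain ⟨κ, h⟩ := hA z hz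
  have h0 := h 0 (by omega) (by omega)
  have h1 := h 1 (by omega) (by omega)
  rw [hB, pow_zero, mul_one] at h0
  rw [hA1', ← h0] at h1
  simp only [eval_mul, eval_pow, eval_X, eval_C, pow_one] at h1
  rw [eq_div_iff hb]
  refine mul_left_cancel₀ (pow_ne_zero (d + 1) hz0) ?_
  linear_combination -h1

theorem exists_star_eq_mul_of_conj_coordinates (hd : 2 ≤ d) (hR : R.Infinite)
    (hA : ∀ z ∈ R, ∃ κ, ∀ k ≤ d + 1, k ≠ d → (A k).eval z = κ * star z ^ k)
    (hdeg : ∀ k, (A k).natDegree ≤ d + 1) (hcoeff : ∀ k, (A k).coeff d = 0)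
    (hne : ∀ z, ∃ k ≤ d + 1, k ≠ d ∧ (A k).eval z ≠ 0) :
    ∃ a μ : ℂ, A 0 = C a ∧ ∀ z ∈ R, star z = μ * z := by
  have hroot := eval_zero_ne_zero_of_conj_coordinates hd hR hA hdeg hcoeff hne
  obtain ⟨a, ha⟩ : ∃ a, A 0 = C a := by
    refine ⟨_, eq_C_of_degree_eq_zero ?_⟩
    by_contra h
    obtain ⟨x, hx⟩ := IsAlgClosed.exists_root (A 0) h
    exact hroot x hx
  have ha0 : a ≠ 0 := by
    have := hroot 0
    rwa [ha, eval_C] at this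
  have hz1 : ∀ z ∈ R, (A 1).eval z = a * star z := by
    intro z hz
    obtain ⟨κ, h⟩ := hA z hz
    have h0 := h 0 (by omega) (by omega)
    rw [ha, eval_C, pow_zero, mul_one] at h0
    rw [h 1 (by omega) (by omega), h0, pow_one]
  have hone := pow_eq_of_conj_coordinates hR hA (k := 1) (by omega) (by omega)
  rw [Nat.add_sub_cancel, pow_one, ha, ← C_pow] at hone
  have hdeg1 : (A 1).natDegree ≤ 1 := by
    have h := congrArg natDegree hone
    rw [natDegree_pow, natDegree_C_mul (pow_ne_zero _ ha0)] at h
    have := hdeg (d + 1)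
    rw [← h] at this
    exact Nat.le_of_mul_le_mul_left (by rwa [mul_one]) (Nat.succ_pos d)
  obtain ⟨e, f, hef⟩ := exists_eq_X_add_C_of_natDegree_le_one hdeg1
  have he : e ≠ 0 := by
    rintro rfl
    refine not_infinite_of_star_eq hR (w := f / a) fun z hz _ => ?_
    have := hz1 z hz
    rw [hef, C_0, zero_mul, zero_add, eval_C] at this
    rw [eq_div_iff ha0]
    linear_combination -this
  have hf : f = 0 := by
    have h := congrArg (fun p => p.coeff d) hone
    simp only [coeff_C_mul, hcoeff, mul_zero] at h
    rw [hef, show C e * X + C f = C e * (X + C (f / e)) by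
      rw [mul_add, ← C_mul, mul_div_cancel₀ _ he], mul_pow, ← C_pow, coeff_C_mul,
      coeff_X_add_C_pow, show d + 1 - d = 1 by omega, pow_one, Nat.choose_succ_self_right] at h
    have : (d + 1 : ℂ) ≠ 0 := by exact_mod_cast Nat.succ_ne_zero d
    simpa [he, this] using h
  refine ⟨a, e / a, ha, fun z hz => ?_⟩
  have := hz1 z hz
  rw [hef, hf, C_0, add_zero, eval_mul, eval_C, eval_X] at this
  field_simp
  linear_combination -this

end ConjugateCoordinates

variable {d : ℕ} {δ : Set (PS ℂ d)} {Q : ℕ → Fin (d + 1) → ℂ}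

/-- The complex conjugate of a linear form. -/
def starDual (l : Module.Dual ℂ (Fin (d + 1) → ℂ)) : Module.Dual ℂ (Fin (d + 1) → ℂ) where
  toFun y := star (l (star y))
  map_add' y z := by simp
  map_smul' c y := by simp

theorem starDual_apply (l : Module.Dual ℂ (Fin (d + 1) → ℂ)) (y : Fin (d + 1) → ℂ) :
    starDual l y = star (l (star y)) := rfl

theorem IsFrame.eq_zero_of_cusp (hF : IsFrame δ Q) (hQ : Q 1 = 0)
    {L : ℕ → Module.Dual ℂ (Fin (d + 1) → ℂ)}
    (hL : ∀ j, j ≠ 1 → j < d + 2 → ∀ i < d + 2, L j (Q i) = if i = j then 1 else 0)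
    {y : Fin (d + 1) → ℂ} (hy : ∀ j, j ≠ 1 → j < d + 2 → L j y = 0) : y = 0 := by
  have key : ∀ l : Module.Dual ℂ (Fin (d + 1) → ℂ), l y = 0 := by
    intro l
    have h : l - ∑ j ∈ (Finset.range (d + 2)).erase 1, l (Q j) • L j = 0 := by
      refine hF.dual_eq_zero _ fun i hi => ?_
      rw [LinearMap.sub_apply, LinearMap.sum_apply]
      rcases eq_or_ne i 1 with rfl | hi1
      · simp [hQ]
      · rw [Finset.sum_eq_single i]
        · simp [hL i hi1 hi i hi]
        · intro j hj hji
          rw [Finset.mem_erase, Finset.mem_range] at hj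
          simp [hL j hj.1 hj.2 i hi, hji.symm]
        · intro hn
          exact absurd (Finset.mem_erase.2 ⟨hi1, Finset.mem_range.2 hi⟩) hn
    rw [sub_eq_zero.1 h, LinearMap.sum_apply]
    refine Finset.sum_eq_zero fun j hj => ?_
    rw [Finset.mem_erase, Finset.mem_range] at hj
    simp [hy j hj.1 hj.2]
  exact funext fun i => key (LinearMap.proj i)

theorem IsFrame.infinite_real_parameters (hδ : IsIrredAlg δ) (hr : IsRealCurve δ)
    (hF : IsFrame δ Q) : {z | ∃ k : ℂ, star (paramPt Q z 1) = k • paramPt Q z 1}.Infinite := by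
  have hinf := hr δ ⟨hδ, subset_rfl, fun C' _ h h' => h'.antisymm h⟩
  have hQ0 : Q 0 ≠ 0 := by
    rw [← paramPt_one_zero (Q := Q)]
    exact hF.ne_zero 1 0 (by simp)
  intro hfin
  refine hinf (((hfin.image fun z => Projectivization.mk ℂ (paramPt Q z 1)
    (hF.ne_zero z 1 (by simp))).insert (Projectivization.mk ℂ (Q 0) hQ0)).subset ?_)
  rintro x ⟨hx, hxr⟩
  rcases (hF.mem_iff_of_inhomogeneous x).1 hx with h | ⟨z, h⟩
  · exact Or.inl (mk_eq_of_mem_submodule hQ0 h).symm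
  · exact Or.inr ⟨z, (isRealPt_iff_exists_star (hF.ne_zero z 1 (by simp)) h).1 hxr,
      mk_eq_of_mem_submodule _ h⟩

theorem IsFrame.exists_real_iff_cusp (hd : 2 ≤ d) (hF : IsFrame δ Q) (hQ : Q 1 = 0)
    (hR : {z | ∃ k : ℂ, star (paramPt Q z 1) = k • paramPt Q z 1}.Infinite) :
    ∃ μ : ℂ, ∀ z, (∃ k : ℂ, star (paramPt Q z 1) = k • paramPt Q z 1) ↔ star z = μ * z := by
  have hex : ∀ j, ∃ l : Module.Dual ℂ (Fin (d + 1) → ℂ), j ≠ 1 → j < d + 2 →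
      ∀ i < d + 2, l (Q i) = if i = j then 1 else 0 := by
    intro j
    rcases eq_or_ne j 1 with hj | hj
    · exact ⟨0, fun h => absurd hj h⟩
    · obtain ⟨l, hl⟩ := hF.exists_dual_cusp hQ (fun i => if i = j then 1 else 0) (by
        rw [if_neg (by omega)])
      exact ⟨l, fun _ _ => hl⟩
  choose L hL using hex
  let P : Module.Dual ℂ (Fin (d + 1) → ℂ) → ℂ[X] := dualPoly fun i => Q (d + 1 - i)
  have hP : ∀ l z, (P l).eval z = l (paramPt Q z 1) := eval_dualPoly_reverse
  let A : ℕ → ℂ[X] := fun k => P (starDual (L (d + 1 - k)))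
  have hmono : ∀ k ≤ d + 1, k ≠ d → ∀ z, L (d + 1 - k) (paramPt Q z 1) = z ^ k := by
    intro k hk hkd z
    rw [map_paramPt_of_single _ (by omega) (hL (d + 1 - k) (by omega) (by omega)), one_pow,
      mul_one, Nat.sub_sub_self hk]
  obtain ⟨a, μ, ha, hμ⟩ := exists_star_eq_mul_of_conj_coordinates (A := A) hd hR (by
      rintro z ⟨k, hk⟩
      refine ⟨star k, fun j hj hjd => ?_⟩
      rw [hP, starDual_apply, hk, map_smul, hmono j hj hjd, smul_eq_mul, star_mul', star_pow])
    (fun k => by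
      rw [natDegree_le_iff_coeff_eq_zero]
      intro N hN
      rw [coeff_dualPoly, if_neg (by omega)])
    (fun k => by
      rw [coeff_dualPoly, if_pos (by omega), show d + 1 - d = 1 by omega, hQ, map_zero])
    (fun z => by
      by_contra! h
      refine hF.ne_zero z 1 (by simp) (star_eq_zero.1 (hF.eq_zero_of_cusp hQ hL fun j hj hjd => ?_))
      have := h (d + 1 - j) (by omega) (by omega)
      rwa [hP, starDual_apply, star_eq_zero, Nat.sub_sub_self (by omega)] at this)
  have hid : ∀ l, P (starDual l) = C a * ((P l).map (starRingEnd ℂ)).comp (C μ * X) := by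
    intro l
    refine eq_of_infinite_eval_eq _ _ (hR.mono ?_)
    rintro z ⟨k, hk⟩
    have hka : star k = a := by
      have h0 : (A 0).eval z = a := by rw [ha, eval_C]
      rwa [hP, starDual_apply, hk, map_smul, hmono 0 (by omega) (by omega), pow_zero, smul_eq_mul,
        mul_one] at h0
    change eval z _ = eval z _
    rw [eval_mul, eval_C, eval_comp, eval_mul, eval_C, eval_X, ← hμ z ⟨k, hk⟩,
      ← starRingEnd_apply z, eval_map_apply, hP, hP, starDual_apply, hk, map_smul, smul_eq_mul,
      star_mul', hka, starRingEnd_apply]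
  refine ⟨μ, fun z => ⟨hμ z, fun hz => ⟨star a, funext fun i => ?_⟩⟩⟩
  have h := congrArg (eval z) (hid (LinearMap.proj i))
  rw [eval_mul, eval_C, eval_comp, eval_mul, eval_C, eval_X, ← hz, ← starRingEnd_apply z,
    eval_map_apply, hP, hP, starDual_apply, starRingEnd_apply] at h
  have h' := congrArg star h
  simpa using h'

theorem exists_group_real_cuspidal (hd : 2 ≤ d) (hr : IsRealCurve δ) (h : IsCuspidalCurve δ) :
    ∃ Gr : AbGrp ↥{x ∈ smoothPts δ | IsRealPt x},
      (∀ v : Fin (d + 1) → ↥{x ∈ smoothPts δ | IsRealPt x}, Function.Injective v →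
        ((∃ S : Set (PS ℂ d), IsHypSet S ∧ ∀ i, (v i : PS ℂ d) ∈ S) ↔
          Gr.sumFin v = Gr.zero)) ∧
      Gr.Iso (AbGrp.ofGroup ℝ) := by
  obtain ⟨Q, hF, hQ⟩ := exists_cusp_frame_of_cuspidal h
  have hU := hF.isUniformized_cusp hd h.1.2.1 hQ
  have hR := hF.infinite_real_parameters h.1.1 hr
  obtain ⟨μ, hμ⟩ := hF.exists_real_iff_cusp hd hQ hR
  obtain ⟨ρ, hρR, hρ0⟩ := hR.exists_notMem_finite (Set.finite_singleton (0 : ℂ))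
  rw [Set.mem_singleton_iff] at hρ0
  have hρ := (hμ ρ).1 hρR
  have hinj : Function.Injective fun r : ℝ => ρ * (r : ℂ) := by
    intro r r' h
    exact Complex.ofReal_injective (mul_left_cancel₀ hρ0 h)
  refine hU.exists_group_zero _ hinj (fun _ => trivial) (fun x => ?_) fun b hb => ?_
  · rw [hU.mem_real_smoothPts_iff]
    constructor
    · rintro ⟨z, -, hz, h⟩
      have hz' := (hμ z).1 hz
      have hreal : star (z / ρ) = z / ρ := by
        have hμ0 : μ ≠ 0 := by
          rintro rfl
          rw [zero_mul, star_eq_zero] at hρ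
          exact hρ0 hρ
        rw [star_div₀, hz', hρ, mul_div_mul_left _ _ hμ0]
      obtain ⟨r, hr⟩ := Complex.conj_eq_iff_real.1 hreal
      refine ⟨r, ?_⟩
      rwa [← hr, mul_div_cancel₀ _ hρ0]
    · rintro ⟨r, h⟩
      refine ⟨_, trivial, (hμ _).2 ?_, h⟩
      rw [star_mul', hρ, mul_assoc]
      congr 2
      exact Complex.conj_ofReal r
  · refine (hF.exists_dual_iff_sum hQ (hinj.comp hb)).trans ?_
    simp only [Function.comp_apply]
    rw [← Finset.mul_sum, mul_eq_zero, or_iff_right hρ0, ← Complex.ofReal_sum,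
      Complex.ofReal_eq_zero]

end RealCusp

/-- Proposition 3.10.
A rational singular curve `δ` in `ℂPᵈ`, `d ≥ 2`, has a natural group structure on its set of
smooth points `δ*` such that `d + 1` (distinct) points of `δ*` lie on a hyperplane if and
only if they sum to the identity; the group is isomorphic to `(ℂ, +)` if the singularity is
a cusp and to `(ℂ*, ·)` if it is a node. If the curve is real and cuspidal or acnodal, the
group on the real smooth points is isomorphic to `(ℝ, +)` or `ℝ/ℤ` respectively, with the
same hyperplane condition. If the curve is real and crunodal, the group on the real smooth
points is isomorphic to `(ℝ, +) × ℤ₂`, but `d + 1` points lie on a hyperplane if and only if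
they sum to `(0, 0)` or `(0, 1)`, depending on the curve. -/
theorem rational_singular_curve_group
    (d : ℕ) (hd : 2 ≤ d) (δ : Set (PS ℂ d)) (hδ : IsRationalSingular δ) :
    (∃ G : AbGrp ↥(smoothPts δ),
      (∀ v : Fin (d + 1) → ↥(smoothPts δ), Function.Injective v →
        ((∃ S : Set (PS ℂ d), IsHypSet S ∧ ∀ i, (v i : PS ℂ d) ∈ S) ↔
          G.sumFin v = G.zero)) ∧
      (IsCuspidalCurve δ → G.Iso (AbGrp.ofGroup ℂ)) ∧
      (¬IsCuspidalCurve δ → G.Iso (AbGrp.ofGroup (Additive ℂˣ)))) ∧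
    (IsRealCurve δ → IsCuspidalCurve δ →
      ∃ Gr : AbGrp ↥{x ∈ smoothPts δ | IsRealPt x},
        (∀ v : Fin (d + 1) → ↥{x ∈ smoothPts δ | IsRealPt x}, Function.Injective v →
          ((∃ S : Set (PS ℂ d), IsHypSet S ∧ ∀ i, (v i : PS ℂ d) ∈ S) ↔
            Gr.sumFin v = Gr.zero)) ∧
        Gr.Iso (AbGrp.ofGroup ℝ)) ∧
    (IsAcnodalCurve δ →
      ∃ Gr : AbGrp ↥{x ∈ smoothPts δ | IsRealPt x},
        (∀ v : Fin (d + 1) → ↥{x ∈ smoothPts δ | IsRealPt x}, Function.Injective v →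
          ((∃ S : Set (PS ℂ d), IsHypSet S ∧ ∀ i, (v i : PS ℂ d) ∈ S) ↔
            Gr.sumFin v = Gr.zero)) ∧
        Gr.Iso (AbGrp.ofGroup (AddCircle (1 : ℝ)))) ∧
    (IsCrunodalCurve δ →
      ∃ Gr : AbGrp ↥{x ∈ smoothPts δ | IsRealPt x},
        ∃ φ : ↥{x ∈ smoothPts δ | IsRealPt x} ≃ ℝ × ZMod 2,
          (∀ a b, φ (Gr.add a b) = φ a + φ b) ∧
          ∃ ε : ZMod 2, ∀ v : Fin (d + 1) → ↥{x ∈ smoothPts δ | IsRealPt x},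
            Function.Injective v →
              ((∃ S : Set (PS ℂ d), IsHypSet S ∧ ∀ i, (v i : PS ℂ d) ∈ S) ↔
                φ (Gr.sumFin v) = ((0 : ℝ), ε))) := by
  refine ⟨?_, exists_group_real_cuspidal hd, exists_group_acnodal hd, exists_group_crunodal hd⟩
  by_cases h : IsCuspidalCurve δ
  · obtain ⟨Q, hF, hQ⟩ := exists_cusp_frame_of_cuspidal h
    obtain ⟨G, hG, hiso⟩ := hF.exists_group_cusp hd hδ.2.1 hQ
    exact ⟨G, hG, fun _ => hiso, fun h' => absurd h h'⟩
  · obtain ⟨Q, c, hF, hc, hQ⟩ := exists_node_frame_of_not_cuspidal hδ h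
    obtain ⟨G, hG, hiso⟩ := hF.exists_group_node hd hδ.2.1 hc hQ
    exact ⟨G, hG, fun h' => absurd h' h, fun _ => hiso⟩
end
end

section
/- Let (G, ⊕, 0) and (G, ⊞, 0') be abelian groups on the same ground set, such that for some d ≥ 2 and some c, c' ∈ G, for all x₁, …, x_{d+1} ∈ G one has x₁ ⊕ ⋯ ⊕ x_{d+1} = c if and only if x₁ ⊞ ⋯ ⊞ x_{d+1} = c'. Then the map (G, ⊕, 0) → (G, ⊞, 0') given by x ↦ x ⊟ 0 = x ⊕ 0' is a group isomorphism, and c' = c ⊞ 0 ⊞ ⋯ ⊞ 0 (d copies of 0) = c ⊖ (0' ⊕ ⋯ ⊕ 0') (d copies of 0'). -/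
noncomputable section

namespace AbGrp

variable {α : Type*} (A : AbGrp α)

theorem add_zero (a : α) : A.add a A.zero = a := by
  rw [A.add_comm', A.zero_add']

theorem sub_add_cancel (a b : α) : A.add (A.sub a b) b = a := by
  rw [sub, A.add_assoc', A.neg_add', A.add_zero]

theorem add_sub_cancel_right (a b : α) : A.sub (A.add a b) b = a := by
  rw [sub, A.add_assoc', A.add_comm' b, A.neg_add', A.add_zero]

theorem add_right_cancel {a b e : α} (h : A.add a e = A.add b e) : a = b := by
  rw [← A.add_sub_cancel_right a e, h, A.add_sub_cancel_right]

theorem sub_self (a : α) : A.sub a a = A.zero := by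
  rw [sub, A.add_comm', A.neg_add']

theorem nsmul_zero (k : ℕ) : A.nsmul k A.zero = A.zero := by
  induction k with
  | zero => rfl
  | succ k ih => rw [nsmul, ih, A.zero_add']

theorem sumFin_cons {k : ℕ} (a : α) (x : Fin k → α) :
    A.sumFin (Fin.cons a x : Fin (k + 1) → α) = A.add a (A.sumFin x) := by
  simp [sumFin, List.ofFn_succ]

theorem sumFin_const (k : ℕ) (a : α) : A.sumFin (fun _ : Fin k => a) = A.nsmul k a := by
  induction k with
  | zero => simp [sumFin, nsmul]
  | succ k ih =>
    rw [nsmul, ← ih]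
    simp [sumFin]

/-- If the solution sets of `x₁ + ⋯ + x_{d+1} = const` agree for two abelian group structures and
`d ≥ 2`, then the two additions differ by a translation. -/
theorem add_eq_add_zero_of_sumFin_iff {A B : AbGrp α} {d : ℕ} (hd : 2 ≤ d) {c c' : α}
    (h : ∀ x : Fin (d + 1) → α, A.sumFin x = c ↔ B.sumFin x = c') (x y : α) :
    B.add x y = B.add (A.add x y) A.zero := by
  obtain ⟨n, rfl⟩ := Nat.exists_eq_add_of_le' hd
  let z := A.sub c (A.add x y)
  have hz : A.add (A.add x y) z = c := by rw [A.add_comm', A.sub_add_cancel]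
  have key : ∀ u v : α, A.add u v = A.add x y →
      B.add (B.add u v) (B.add z (B.nsmul n A.zero)) = c' := by
    intro u v huv
    have huvz := (h (Fin.cons u (Fin.cons v (Fin.cons z fun _ : Fin n => A.zero)))).1 (by
      simp only [sumFin_cons, sumFin_const]
      rw [nsmul_zero, add_zero, ← A.add_assoc', huv, hz])
    simp only [sumFin_cons, sumFin_const] at huvz
    rwa [B.add_assoc']
  exact B.add_right_cancel ((key x y rfl).trans (key _ _ (A.add_zero _)).symm)

end AbGrp

/-- Proposition 3.11.
Let `(G, ⊕, 0)` and `(G, ⊞, 0')` be abelian groups on the same ground set such that, for some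
`d ≥ 2` and `c, c' ∈ G`, one has `x₁ ⊕ ⋯ ⊕ x_{d+1} = c ↔ x₁ ⊞ ⋯ ⊞ x_{d+1} = c'` for all
`x₁, …, x_{d+1}`. Then `x ↦ x ⊟ 0 = x ⊕ 0'` is an isomorphism `(G, ⊕, 0) → (G, ⊞, 0')`, and
`c' = c ⊞ 0 ⊞ ⋯ ⊞ 0` (`d` copies of `0`) `= c ⊖ (0' ⊕ ⋯ ⊕ 0')` (`d` copies of `0'`). -/
theorem two_group_structures_translation {G : Type*} (A B : AbGrp G)
    (d : ℕ) (hd : 2 ≤ d) (c c' : G)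
    (h : ∀ x : Fin (d + 1) → G, A.sumFin x = c ↔ B.sumFin x = c') :
    (∀ x : G, B.sub x A.zero = A.add x B.zero) ∧
    Function.Bijective (fun x : G => B.sub x A.zero) ∧
    (∀ x y : G, B.sub (A.add x y) A.zero = B.add (B.sub x A.zero) (B.sub y A.zero)) ∧
    B.sub A.zero A.zero = B.zero ∧
    c' = B.add c (B.nsmul d A.zero) ∧
    c' = A.sub c (A.nsmul d B.zero) := by
  have hadd := AbGrp.add_eq_add_zero_of_sumFin_iff hd h
  have hA : ∀ x y : G, A.add x y = B.sub (B.add x y) A.zero := fun x y => by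
    rw [hadd, B.add_sub_cancel_right]
  refine ⟨fun x => by rw [hA, B.add_zero], ⟨fun x y hxy => ?_, fun y => ?_⟩, fun x y => ?_,
    B.sub_self _, ?_, ?_⟩
  · rw [← B.sub_add_cancel x A.zero, ← B.sub_add_cancel y A.zero]
    exact congrArg (B.add · A.zero) hxy
  · exact ⟨B.add y A.zero, B.add_sub_cancel_right _ _⟩
  · rw [hA]
    simp only [AbGrp.sub]
    rw [B.add_assoc', B.add_assoc', B.add_assoc', B.add_comm' (B.neg _) (B.add y _), B.add_assoc']
  · have hc := (h (Fin.cons c fun _ => A.zero)).1 (by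
      rw [A.sumFin_cons, A.sumFin_const, A.nsmul_zero, A.add_zero])
    rw [← hc, B.sumFin_cons, B.sumFin_const]
  · have hc := (h (Fin.cons c' fun _ => B.zero)).2 (by
      rw [B.sumFin_cons, B.sumFin_const, B.nsmul_zero, B.add_zero])
    rw [← hc, A.sumFin_cons, A.sumFin_const, A.add_sub_cancel_right]
end
end

section
/- Let P be a set of n points in ℝP^d, d ≥ 2, where every d points span a hyperplane. Let P' be a subset obtained from P by removing at most K points. If P spans m ordinary hyperplanes, then P' spans at most m + (1/d)·K·binom(n−1, d−1) ordinary hyperplanes. -/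
open scoped Pointwise
open Classical

noncomputable section

theorem eq_projSpan_of_spanEveryd {𝔽 : Type} [Field 𝔽] {d : ℕ} {P S : Set (PS 𝔽 d)}
    {W : Submodule 𝔽 (Fin (d + 1) → 𝔽)} (hgp : SpanEveryd d P) (hS : S ⊆ P) (hSfin : S.Finite)
    (hcard : S.ncard = d) (hW : Module.finrank 𝔽 W = d) (hSW : ∀ x ∈ S, x.submodule ≤ W) :
    W = projSpan S :=
  (Submodule.eq_of_le_of_finrank_eq (iSup₂_le hSW)
    ((hgp S hS hSfin hcard).trans hW.symm)).symm

theorem SpanEveryd.mono {𝔽 : Type} [Field 𝔽] {k d : ℕ} {P Q : Set (PS 𝔽 k)}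
    (hgp : SpanEveryd d P) (hQ : Q ⊆ P) : SpanEveryd d Q :=
  fun S hS => hgp S (hS.trans hQ)

theorem finite_hypThrough {𝔽 : Type} [Field 𝔽] {d : ℕ} {P : Set (PS 𝔽 d)} (hfin : P.Finite)
    (hgp : SpanEveryd d P) : (hypThrough P d).Finite := by
  refine (hfin.finite_subsets.image projSpan).subset fun W hW => ?_
  have hsub : {x ∈ P | x.submodule ≤ W} ⊆ P := Set.sep_subset _ _
  exact ⟨_, hsub, (eq_projSpan_of_spanEveryd hgp hsub (hfin.subset hsub) hW.2 hW.1
    fun x hx => hx.2).symm⟩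

/-- The ordinary hyperplanes of `Q` that pass through a further point `p` of `P`: each is spanned
by `p` together with any of the `d` subsets of size `d - 1` of its points in `Q`. -/
theorem mul_ncard_hypThrough_through_point_le {𝔽 : Type} [Field 𝔽] {d : ℕ} (hd : 1 ≤ d)
    {P Q : Set (PS 𝔽 d)} (hfin : P.Finite) (hgp : SpanEveryd d P) (hQ : Q ⊆ P)
    {p : PS 𝔽 d} (hp : p ∈ P) (hpQ : p ∉ Q) :
    d * {W ∈ hypThrough Q d | p.submodule ≤ W}.ncard ≤ (P.ncard - 1).choose (d - 1) := by
  have hQfin : Q.Finite := hfin.subset hQ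
  have hBfin : {W ∈ hypThrough Q d | p.submodule ≤ W}.Finite :=
    (finite_hypThrough hQfin (hgp.mono hQ)).subset (Set.sep_subset _ _)
  set points : Submodule 𝔽 (Fin (d + 1) → 𝔽) → Finset (PS 𝔽 d) :=
    fun W => hQfin.toFinset.filter fun x => x.submodule ≤ W with hpoints
  have hcard : ∀ W ∈ hypThrough Q d, (points W).card = d := by
    intro W hW
    refine Eq.trans ?_ hW.2
    rw [← Set.ncard_coe_finset]
    congr 1
    ext x
    simp [hpoints]
  have hspan : ∀ W ∈ hBfin.toFinset, ∀ T ∈ (points W).powersetCard (d - 1),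
      W = projSpan (insert p (T : Set (PS 𝔽 d))) := by
    intro W hW T hT
    obtain ⟨hWQ, hpW⟩ := hBfin.mem_toFinset.1 hW
    obtain ⟨hTW, hTcard⟩ := Finset.mem_powersetCard.1 hT
    have hT' : ∀ x ∈ T, x ∈ Q ∧ x.submodule ≤ W := fun x hx => by
      simpa [hpoints] using hTW hx
    refine eq_projSpan_of_spanEveryd hgp
      (Set.insert_subset hp fun x hx => hQ (hT' x hx).1) (T.finite_toSet.insert p) ?_ hWQ.1 ?_
    · rw [Set.ncard_insert_of_notMem (fun h => hpQ (hT' p h).1) T.finite_toSet,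
        Set.ncard_coe_finset, hTcard]
      omega
    · rintro x (rfl | hx)
      exacts [hpW, (hT' x hx).2]
  have hdisj : (hBfin.toFinset : Set _).PairwiseDisjoint
      fun W => (points W).powersetCard (d - 1) := by
    intro W hW W' hW' hne
    refine Finset.disjoint_left.2 fun T hT hT' => hne ?_
    exact (hspan W hW T hT).trans (hspan W' hW' T hT').symm
  have hsub : hBfin.toFinset.biUnion (fun W => (points W).powersetCard (d - 1)) ⊆
      (hfin.toFinset.erase p).powersetCard (d - 1) := by
    refine Finset.biUnion_subset.2 fun W _ => Finset.powersetCard_mono fun x hx => ?_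
    have hxQ : x ∈ Q := by simpa using (Finset.mem_filter.1 hx).1
    exact Finset.mem_erase.2 ⟨fun h => hpQ (h ▸ hxQ), hfin.mem_toFinset.2 (hQ hxQ)⟩
  have hle := Finset.card_le_card hsub
  rw [Finset.card_biUnion hdisj, Finset.card_powersetCard,
    Finset.card_erase_of_mem (hfin.mem_toFinset.2 hp), ← Set.ncard_eq_toFinset_card P hfin,
    Finset.sum_congr rfl fun W hW => by
      rw [Finset.card_powersetCard, hcard W (hBfin.mem_toFinset.1 hW).1,
        Nat.choose_symm hd, Nat.choose_one_right],
    Finset.sum_const, ← Set.ncard_eq_toFinset_card _ hBfin, smul_eq_mul, mul_comm] at hle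
  exact hle

/-- An ordinary hyperplane of a subset `Q` of `P` is ordinary for `P` or passes through a point of
`P \ Q`. -/
theorem hypThrough_subset_union {𝔽 : Type} [Field 𝔽] {k d : ℕ} {P Q : Set (PS 𝔽 k)}
    (hQ : Q ⊆ P) :
    hypThrough Q d ⊆
      hypThrough P d ∪ ⋃ p ∈ P \ Q, {W ∈ hypThrough Q d | p.submodule ≤ W} := by
  intro W hW
  by_cases h : ∃ p ∈ P \ Q, p.submodule ≤ W
  · obtain ⟨p, hp, hpW⟩ := h
    exact Or.inr (Set.mem_biUnion hp ⟨hW, hpW⟩)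
  · push Not at h
    refine Or.inl ⟨hW.1, ?_⟩
    rw [← hW.2]
    congr 1
    ext x
    exact ⟨fun hx => ⟨by_contra fun hxQ => h x ⟨hx.1, hxQ⟩ hx.2, hx.2⟩,
      fun hx => ⟨hQ hx.1, hx.2⟩⟩

/-- Lemma 4.3.
Let `P` be a set of `n` points in `ℝPᵈ`, `d ≥ 2`, where every `d` points span a hyperplane.
Let `P'` be a subset obtained from `P` by removing at most `K` points. If `P` spans `m`
ordinary hyperplanes, then `P'` spans at most `m + (1/d)·K·C(n-1, d-1)` ordinary
hyperplanes. -/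
theorem removing_points_ordinary_hyperplanes
    (d : ℕ) (hd : 2 ≤ d) (P P' : Set (PS ℝ d)) (n K m : ℕ)
    (hfin : P.Finite) (hn : P.ncard = n) (hgp : SpanEveryd d P)
    (hsub : P' ⊆ P) (hK : (P \ P').ncard ≤ K)
    (hm : numHyp P d = m) :
    (numHyp P' d : ℝ) ≤ (m : ℝ) + (1 / (d : ℝ)) * (K : ℝ) * ((n - 1).choose (d - 1)) := by
  have hRfin : (P \ P').Finite := hfin.subset Set.sdiff_subset
  have hP'fin := finite_hypThrough (hfin.subset hsub) (hgp.mono hsub)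
  have hcover : numHyp P' d ≤ m + ∑ p ∈ hRfin.toFinset,
      {W ∈ hypThrough P' d | p.submodule ≤ W}.ncard := by
    rw [← hm]
    refine (Set.ncard_le_ncard (hypThrough_subset_union hsub)
      ((finite_hypThrough hfin hgp).union
        (hRfin.biUnion fun p _ => hP'fin.subset (Set.sep_subset _ _)))).trans ?_
    refine (Set.ncard_union_le _ _).trans (Nat.add_le_add_left ?_ _)
    simpa using Finset.set_ncard_biUnion_le hRfin.toFinset
      fun p => {W ∈ hypThrough P' d | p.submodule ≤ W}
  have hsum : d * ∑ p ∈ hRfin.toFinset, {W ∈ hypThrough P' d | p.submodule ≤ W}.ncard ≤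
      K * (n - 1).choose (d - 1) := by
    rw [Finset.mul_sum]
    refine (Finset.sum_le_card_nsmul _ _ ((n - 1).choose (d - 1)) fun p hp => ?_).trans ?_
    · obtain ⟨hpP, hpP'⟩ := hRfin.mem_toFinset.1 hp
      exact hn ▸ mul_ncard_hypThrough_through_point_le (by omega) hfin hgp hsub hpP hpP'
    · rw [smul_eq_mul, ← Set.ncard_eq_toFinset_card _ hRfin]
      exact Nat.mul_le_mul_right _ hK
  have hd0 : (0 : ℝ) < d := by positivity
  have htotal : d * numHyp P' d ≤ d * m + K * (n - 1).choose (d - 1) :=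
    (Nat.mul_le_mul_left d hcover).trans (by rw [mul_add]; omega)
  have hreal : (d : ℝ) * numHyp P' d ≤ d * m + K * (n - 1).choose (d - 1) := by
    exact_mod_cast htotal
  refine le_of_mul_le_mul_left (hreal.trans_eq ?_) hd0
  field_simp
end
end

section
/- Let d ≥ 4, K ≥ 1, and let n ≥ 2dK. Let P be a set of n points in ℝP^d where every d points span a hyperplane. If all but K points of P lie on a hyperplane, then P spans at least binom(n−1, d−1) ordinary hyperplanes, with equality if and only if K = 1. -/
open scoped Pointwise
open Classical

noncomputable section

section Span

variable {𝔽 : Type} [Field 𝔽] {d : ℕ}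

theorem submodule_le_projSpan {S : Set (PS 𝔽 d)} {x : PS 𝔽 d} (hx : x ∈ S) :
    x.submodule ≤ projSpan S :=
  le_iSup₂_of_le x hx le_rfl

theorem projSpan_le_iff {S : Set (PS 𝔽 d)} {W : Submodule 𝔽 (Fin (d + 1) → 𝔽)} :
    projSpan S ≤ W ↔ ∀ x ∈ S, x.submodule ≤ W :=
  iSup₂_le_iff

/-- A hyperplane through exactly `d` points of a set in general position is the span of these
points, so ordinary hyperplanes correspond to `d`-subsets whose span has no further point. -/
def ordinarySubsets (P : Finset (PS 𝔽 d)) : Finset (Finset (PS 𝔽 d)) :=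
  {B ∈ P.powersetCard d | ∀ x ∈ P, x.submodule ≤ projSpan (↑B : Set (PS 𝔽 d)) → x ∈ B}

variable {P : Finset (PS 𝔽 d)} (hgp : SpanEveryd d (↑P : Set (PS 𝔽 d)))

include hgp

theorem finrank_projSpan_eq_of_card_eq {B : Finset (PS 𝔽 d)} (hB : B ⊆ P) (hc : B.card = d) :
    Module.finrank 𝔽 (projSpan (↑B : Set (PS 𝔽 d))) = d :=
  hgp B (by exact_mod_cast hB) B.finite_toSet (by rw [Set.ncard_coe_finset, hc])

theorem projSpan_eq_of_le {B : Finset (PS 𝔽 d)} (hB : B ⊆ P) (hc : B.card = d)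
    {W : Submodule 𝔽 (Fin (d + 1) → 𝔽)} (hW : Module.finrank 𝔽 W = d)
    (h : ∀ x ∈ B, x.submodule ≤ W) : projSpan (↑B : Set (PS 𝔽 d)) = W :=
  Submodule.eq_of_le_of_finrank_eq (projSpan_le_iff.2 (by simpa using h))
    ((finrank_projSpan_eq_of_card_eq hgp hB hc).trans hW.symm)

theorem numHyp_eq_card_ordinarySubsets :
    numHyp (↑P : Set (PS 𝔽 d)) d = (ordinarySubsets P).card := by
  rw [numHyp, ← Set.ncard_coe_finset]
  have hset : ∀ W : Submodule 𝔽 (Fin (d + 1) → 𝔽),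
      {x ∈ (↑P : Set (PS 𝔽 d)) | x.submodule ≤ W} = ↑({x ∈ P | x.submodule ≤ W} : Finset _) := by
    intro W; ext; simp
  have hspan : ∀ W ∈ hypThrough (↑P : Set (PS 𝔽 d)) d,
      projSpan (↑({x ∈ P | x.submodule ≤ W} : Finset _) : Set (PS 𝔽 d)) = W := by
    rintro W ⟨hW, hc⟩
    rw [hset, Set.ncard_coe_finset] at hc
    exact projSpan_eq_of_le hgp (Finset.filter_subset _ _) hc hW (by simp)
  refine Set.ncard_congr (fun W _ => {x ∈ P | x.submodule ≤ W}) ?_ ?_ ?_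
  · intro W hW
    have h := hspan W hW
    obtain ⟨-, hc⟩ := hW
    rw [hset, Set.ncard_coe_finset] at hc
    rw [Finset.mem_coe, ordinarySubsets, Finset.mem_filter, Finset.mem_powersetCard]
    refine ⟨⟨Finset.filter_subset _ _, hc⟩, fun x hx hxW => ?_⟩
    rw [h] at hxW
    simp [hx, hxW]
  · intro W V hW hV h
    rw [← hspan W hW, ← hspan V hV]
    rw [h]
  · intro B hB
    rw [Finset.mem_coe, ordinarySubsets, Finset.mem_filter, Finset.mem_powersetCard] at hB
    obtain ⟨⟨hBP, hc⟩, hB⟩ := hB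
    have h : ({x ∈ P | x.submodule ≤ projSpan (↑B : Set (PS 𝔽 d))} : Finset _) = B := by
      ext x
      simp only [Finset.mem_filter]
      exact ⟨fun h => hB x h.1 h.2, fun h => ⟨hBP h, submodule_le_projSpan (by simpa using h)⟩⟩
    refine ⟨projSpan ↑B, ⟨finrank_projSpan_eq_of_card_eq hgp hBP hc, ?_⟩, h⟩
    rw [hset, h, Set.ncard_coe_finset, hc]

variable {Q R : Finset (PS 𝔽 d)} {W : Submodule 𝔽 (Fin (d + 1) → 𝔽)}
  (hQP : Q ⊆ P) (hRP : R ⊆ P) (hW : Module.finrank 𝔽 W = d)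
  (hQ : ∀ x ∈ Q, x.submodule ≤ W) (hR : ∀ x ∈ R, ¬ x.submodule ≤ W)

include hQP hW hQ

/-- A hyperplane other than `W` contains at most `d - 1` of the points of `W`. -/
theorem card_ne_of_le_hyperplane {V : Submodule 𝔽 (Fin (d + 1) → 𝔽)}
    (hV : Module.finrank 𝔽 V = d) {p : PS 𝔽 d} (hpV : p.submodule ≤ V) (hpW : ¬ p.submodule ≤ W)
    {B : Finset (PS 𝔽 d)} (hB : B ⊆ Q) (hBV : ∀ x ∈ B, x.submodule ≤ V) : B.card ≠ d := by
  intro hc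
  have h₁ := projSpan_eq_of_le hgp (hB.trans hQP) hc hV hBV
  have h₂ := projSpan_eq_of_le hgp (hB.trans hQP) hc hW (fun x hx => hQ x (hB hx))
  exact hpW (h₂ ▸ h₁ ▸ hpV)

theorem ordinarySubsets_card_le_of_insert (hdQ : d < Q.card) {p : PS 𝔽 d}
    (hP : P = insert p Q) : (ordinarySubsets P).card ≤ Q.card.choose (d - 1) := by
  rw [← Finset.card_powersetCard]
  have hmem : ∀ B ∈ ordinarySubsets P, B ⊆ P ∧ B.card = d ∧ p ∈ B := by
    intro B hB
    rw [ordinarySubsets, Finset.mem_filter, Finset.mem_powersetCard] at hB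
    obtain ⟨⟨hBP, hc⟩, hB⟩ := hB
    refine ⟨hBP, hc, ?_⟩
    by_contra hpB
    have hBQ : B ⊆ Q := by
      rw [hP] at hBP
      exact (Finset.subset_insert_iff_of_notMem hpB).1 hBP
    have hBW := projSpan_eq_of_le hgp hBP hc hW (fun x hx => hQ x (hBQ hx))
    have : Q ⊆ B := fun x hx => hB x (hQP hx) (hBW ▸ hQ x hx)
    have := Finset.card_le_card this
    omega
  refine Finset.card_le_card_of_injOn (fun B => B.erase p) ?_ ?_
  · intro B hB
    obtain ⟨hBP, hc, hpB⟩ := hmem B hB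
    rw [Finset.mem_coe, Finset.mem_powersetCard, Finset.card_erase_of_mem hpB, hc]
    exact ⟨by rw [hP] at hBP; exact Finset.subset_insert_iff.1 hBP, rfl⟩
  · intro B hB C hC h
    simp only at h
    rw [← Finset.insert_erase (hmem B hB).2.2, h, Finset.insert_erase (hmem C hC).2.2]

include hRP hR

/-- For two points `p`, `q` off the hyperplane `W`, each `(d - 2)`-subset of `W` extends in at most
one way to a `(d - 1)`-subset whose span with `p` contains `q`. -/
theorem card_spanning_subsets_mul_le (hd : 2 ≤ d) {p q : PS 𝔽 d} (hp : p ∈ R) (hq : q ∈ R)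
    (hpq : q ≠ p) :
    ({A ∈ Q.powersetCard (d - 1) |
        q.submodule ≤ projSpan (↑(insert p A) : Set (PS 𝔽 d))} :
          Finset (Finset (PS 𝔽 d))).card * (d - 1) ≤
      Q.card.choose (d - 2) := by
  have hpQ : p ∉ Q := fun h => hR p hp (hQ p h)
  have hqQ : q ∉ Q := fun h => hR q hq (hQ q h)
  set bad : Finset (Finset (PS 𝔽 d)) := {A ∈ Q.powersetCard (d - 1) |
    q.submodule ≤ projSpan (↑(insert p A) : Set (PS 𝔽 d))} with hbad
  have hmem : ∀ A ∈ bad, A ⊆ Q ∧ A.card = d - 1 ∧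
      q.submodule ≤ projSpan (↑(insert p A) : Set (PS 𝔽 d)) := by
    intro A hA
    simpa [hbad, and_assoc] using hA
  have hcardE : ∀ A ∈ bad, ∀ a ∈ A, (insert p (insert q (A.erase a))).card = d := by
    intro A hA a ha
    obtain ⟨hAQ, hc, -⟩ := hmem A hA
    have hEQ : A.erase a ⊆ Q := (Finset.erase_subset _ _).trans hAQ
    rw [Finset.card_insert_of_notMem, Finset.card_insert_of_notMem, Finset.card_erase_of_mem ha,
      hc]
    · omega
    · exact fun h => hqQ (hEQ h)
    · rw [Finset.mem_insert]
      rintro (h | h)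
      · exact hpq h.symm
      · exact hpQ (hEQ h)
  have hle : ∀ A ∈ bad, ∀ a ∈ A,
      a.submodule ≤ projSpan (↑(insert p (insert q (A.erase a))) : Set (PS 𝔽 d)) := by
    intro A hA a ha
    obtain ⟨hAQ, hc, hqA⟩ := hmem A hA
    have hEQ : A.erase a ⊆ Q := (Finset.erase_subset _ _).trans hAQ
    have hcard := hcardE A hA a ha
    have hcard' : (insert p A).card = d := by
      rw [Finset.card_insert_of_notMem (fun h => hpQ (hAQ h)), hc]
      omega
    rw [projSpan_eq_of_le hgp (W := projSpan (↑(insert p A) : Set (PS 𝔽 d))) _ hcard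
      (finrank_projSpan_eq_of_card_eq hgp _ hcard')]
    · exact submodule_le_projSpan (by simp [ha])
    · intro x hx
      simp only [Finset.mem_insert] at hx
      rcases hx with rfl | rfl | hx
      · exact submodule_le_projSpan (by simp)
      · exact hqA
      · exact submodule_le_projSpan (by simp [Finset.mem_of_mem_erase hx])
    · exact Finset.insert_subset (hRP hp) (Finset.insert_subset (hRP hq) (hEQ.trans hQP))
    · exact Finset.insert_subset (hRP hp) (hAQ.trans hQP)
  have hsig : (bad.sigma fun A => A).card = bad.card * (d - 1) := by
    rw [Finset.card_sigma, Finset.sum_congr rfl (fun A hA => (hmem A hA).2.1), Finset.sum_const,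
      smul_eq_mul]
  rw [← hsig, ← Finset.card_powersetCard]
  refine Finset.card_le_card_of_injOn (fun s => s.1.erase s.2) ?_ ?_
  · rintro ⟨A, a⟩ h
    obtain ⟨hA, ha⟩ := Finset.mem_sigma.1 (Finset.mem_coe.1 h)
    obtain ⟨hAQ, hc, -⟩ := hmem A hA
    simp only at ha
    rw [Finset.mem_coe, Finset.mem_powersetCard]
    refine ⟨(Finset.erase_subset _ _).trans hAQ, ?_⟩
    rw [Finset.card_erase_of_mem ha, hc]
    omega
  · rintro ⟨A, a⟩ h ⟨B, b⟩ h' hEE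
    obtain ⟨hA, ha⟩ := Finset.mem_sigma.1 (Finset.mem_coe.1 h)
    obtain ⟨hB, hb⟩ := Finset.mem_sigma.1 (Finset.mem_coe.1 h')
    obtain ⟨hAQ, hc, hqA⟩ := hmem A hA
    simp only at ha hb hEE
    have hAi : insert a (A.erase a) = A := Finset.insert_erase ha
    have hBi : insert b (B.erase b) = B := Finset.insert_erase hb
    have hab : a = b := by
      by_contra hab
      have hbA : b ∉ A := by
        intro hbA
        have : b ∈ A.erase a := Finset.mem_erase.2 ⟨fun h => hab h.symm, hbA⟩
        rw [hEE] at this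
        simp at this
      have hEQ : A.erase a ⊆ Q := (Finset.erase_subset _ _).trans hAQ
      refine card_ne_of_le_hyperplane hgp hQP hW hQ (B := insert b A)
        (finrank_projSpan_eq_of_card_eq hgp (Finset.insert_subset (hRP hp)
          (Finset.insert_subset (hRP hq) (hEQ.trans hQP))) (hcardE A hA a ha))
        (submodule_le_projSpan (by simp)) (hR p hp)
        (Finset.insert_subset ((hmem B hB).1 hb) hAQ) ?_ ?_
      · intro x hx
        by_cases hxa : x = a
        · exact hxa ▸ hle A hA a ha
        by_cases hxb : x = b
        · rw [hxb, hEE]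
          exact hle B hB b hb
        · refine submodule_le_projSpan ?_
          have := (Finset.mem_insert.1 hx).resolve_left hxb
          simp [hxa, this]
      · rw [Finset.card_insert_of_notMem hbA, hc]
        omega
    subst hab
    have : A = B := by rw [← hAi, ← hBi, hEE]
    subst this
    rfl

/-- Lower bound for the ordinary hyperplanes with exactly one point off `W`, obtained by
discarding for each `p ∈ R` the `(d - 1)`-subsets of `Q` whose span with `p` meets `R` again. -/
theorem card_mul_le_ordinarySubsets_card (hd : 2 ≤ d) (hdQ : d ≤ Q.card) (hP : P = Q ∪ R) :
    R.card * (Q.card.choose (d - 1) * (Q.card - d + 2)) ≤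
      (ordinarySubsets P).card * (Q.card - d + 2) +
        R.card * ((R.card - 1) * Q.card.choose (d - 1)) := by
  have hdisj : ∀ x ∈ Q, x ∉ R := fun x hx h => hR x h (hQ x hx)
  let bad (p q : PS 𝔽 d) : Finset (Finset (PS 𝔽 d)) :=
    {A ∈ Q.powersetCard (d - 1) | q.submodule ≤ projSpan (↑(insert p A) : Set (PS 𝔽 d))}
  let good (p : PS 𝔽 d) : Finset (Finset (PS 𝔽 d)) :=
    Q.powersetCard (d - 1) \ (R.erase p).biUnion (bad p)
  have hbad : ∀ p ∈ R, ∀ q ∈ R.erase p,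
      (bad p q).card * (Q.card - d + 2) ≤ Q.card.choose (d - 1) := by
    intro p hp q hq
    have h := card_spanning_subsets_mul_le hgp hQP hRP hW hQ hR hd hp
      (Finset.mem_of_mem_erase hq) (Finset.ne_of_mem_erase hq)
    have hch := Nat.choose_succ_right_eq Q.card (d - 2)
    rw [show d - 2 + 1 = d - 1 by omega, show Q.card - (d - 2) = Q.card - d + 2 by omega] at hch
    refine Nat.le_of_mul_le_mul_right (c := d - 1) ?_ (by omega)
    rw [hch, mul_right_comm]
    exact Nat.mul_le_mul_right _ h
  have hgood : ∀ p ∈ R, Q.card.choose (d - 1) * (Q.card - d + 2) ≤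
      (good p).card * (Q.card - d + 2) + (R.card - 1) * Q.card.choose (d - 1) := by
    intro p hp
    have h₁ : Q.card.choose (d - 1) ≤ (good p).card + ∑ q ∈ R.erase p, (bad p q).card := by
      rw [← Finset.card_powersetCard]
      have := Finset.le_card_sdiff ((R.erase p).biUnion (bad p)) (Q.powersetCard (d - 1))
      have h' : ((R.erase p).biUnion (bad p)).card ≤ _ := Finset.card_biUnion_le
      simp only [good]
      omega
    have h₂ : (∑ q ∈ R.erase p, (bad p q).card) * (Q.card - d + 2) ≤
        (R.card - 1) * Q.card.choose (d - 1) := by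
      rw [Finset.sum_mul, ← Finset.card_erase_of_mem hp, ← smul_eq_mul]
      exact Finset.sum_le_card_nsmul _ _ _ (hbad p hp)
    calc _ ≤ _ := Nat.mul_le_mul_right _ h₁
      _ ≤ _ := by rw [add_mul]; omega
  have hinj : (R.sigma good).card ≤ (ordinarySubsets P).card := by
    refine Finset.card_le_card_of_injOn (fun s => insert s.1 s.2) ?_ ?_
    · rintro ⟨p, A⟩ h
      obtain ⟨hp, hA⟩ := Finset.mem_sigma.1 (Finset.mem_coe.1 h)
      simp only [good, Finset.mem_sdiff, Finset.mem_powersetCard, Finset.mem_biUnion, not_exists,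
        not_and] at hp hA
      obtain ⟨⟨hAQ, hc⟩, hA⟩ := hA
      have hcard : (insert p A).card = d := by
        rw [Finset.card_insert_of_notMem (fun h => hdisj p (hAQ h) hp), hc]
        omega
      have hsub : insert p A ⊆ P := Finset.insert_subset (hRP hp) (hAQ.trans hQP)
      rw [Finset.mem_coe, ordinarySubsets, Finset.mem_filter, Finset.mem_powersetCard]
      refine ⟨⟨hsub, hcard⟩, fun x hx hxs => ?_⟩
      by_contra hxn
      rw [Finset.mem_insert, not_or] at hxn
      rw [hP, Finset.mem_union] at hx
      rcases hx with hx | hx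
      · refine card_ne_of_le_hyperplane hgp hQP hW hQ
          (finrank_projSpan_eq_of_card_eq hgp hsub hcard) (submodule_le_projSpan (by simp))
          (hR p hp) (Finset.insert_subset hx hAQ) ?_ ?_
        · intro y hy
          rcases Finset.mem_insert.1 hy with rfl | hy
          · exact hxs
          · exact submodule_le_projSpan (by simp [hy])
        · rw [Finset.card_insert_of_notMem hxn.2, hc]
          omega
      · refine hA x (Finset.mem_erase.2 ⟨hxn.1, hx⟩) ?_
        simp only [bad, Finset.mem_filter, Finset.mem_powersetCard]
        exact ⟨⟨hAQ, hc⟩, hxs⟩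
    · have hQf : ∀ p ∈ R, ∀ A ∈ good p, {x ∈ insert p A | x ∈ Q} = A ∧
          p ∉ A := by
        intro p hp A hA
        simp only [good, Finset.mem_sdiff, Finset.mem_powersetCard] at hA
        have hpQ : p ∉ Q := fun h => hdisj p h hp
        refine ⟨?_, fun h => hpQ (hA.1.1 h)⟩
        rw [Finset.filter_insert, if_neg hpQ, Finset.filter_true_of_mem (fun x hx => hA.1.1 hx)]
      rintro ⟨p, A⟩ h ⟨q, B⟩ h' heq
      obtain ⟨hp, hA⟩ := Finset.mem_sigma.1 (Finset.mem_coe.1 h)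
      obtain ⟨hq, hB⟩ := Finset.mem_sigma.1 (Finset.mem_coe.1 h')
      simp only at hp hA hq hB heq
      obtain ⟨h₁, hpA⟩ := hQf p hp A hA
      obtain ⟨h₂, -⟩ := hQf q hq B hB
      have hAB : A = B := by rw [← h₁, ← h₂, heq]
      subst hAB
      have hpq : p = q := by
        have : p ∈ insert q A := heq ▸ Finset.mem_insert_self p A
        exact (Finset.mem_insert.1 this).resolve_right hpA
      subst hpq
      rfl
  have hsum : R.card * (Q.card.choose (d - 1) * (Q.card - d + 2)) ≤
      (∑ p ∈ R, (good p).card) * (Q.card - d + 2) +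
        R.card * ((R.card - 1) * Q.card.choose (d - 1)) := by
    have := Finset.sum_le_sum hgood
    simpa only [Finset.sum_add_distrib, ← Finset.sum_mul, Finset.sum_const, smul_eq_mul,
      mul_assoc] using this
  rw [Finset.card_sigma] at hinj
  exact hsum.trans (Nat.add_le_add_right (Nat.mul_le_mul_right _ hinj) _)

end Span

theorem choose_add_mul_le (N k j : ℕ) :
    ((N + j).choose k : ℤ) * (N + 1 - j * k) ≤ N.choose k * (N + 1) := by
  induction j with
  | zero => simp
  | succ j ih =>
    have hrec : ((N + j + 1).choose k : ℤ) * (N + j + 1 - k) = (N + j).choose k * (N + j + 1) := by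
      rcases le_or_gt k (N + j + 1) with h | h
      · have := Nat.choose_mul_succ_eq (N + j) k
        zify [h] at this
        linarith
      · rw [Nat.choose_eq_zero_of_lt h, Nat.choose_eq_zero_of_lt (by omega)]
        simp
    have hc : (0 : ℤ) ≤ (N + j).choose k := by positivity
    have hc' : (0 : ℤ) ≤ (N + j + 1).choose k := by positivity
    have hcc' : ((N + j).choose k : ℤ) ≤ (N + j + 1).choose k := by
      exact_mod_cast Nat.choose_le_choose k (Nat.le_succ _)
    have hN : (0 : ℤ) ≤ N.choose k := by positivity
    rw [← add_assoc]
    push_cast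
    generalize ((N + j + 1).choose k : ℤ) = c' at *
    generalize ((N + j).choose k : ℤ) = c at *
    generalize (N.choose k : ℤ) = C at *
    rcases le_or_gt ((N : ℤ) + 1 - j * k) 0 with h | h
    · have : (N : ℤ) + 1 - (j + 1) * k ≤ 0 := by nlinarith
      exact (mul_nonpos_of_nonneg_of_nonpos hc' this).trans (by positivity)
    · have h₁ : c' * ((N : ℤ) + 1 - k) ≤ c * (N + 1) := by
        nlinarith [mul_nonneg (show (0 : ℤ) ≤ j by positivity) (sub_nonneg.2 hcc')]
      have h₂ := mul_le_mul_of_nonneg_right h₁ h.le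
      have h₃ : c' * (((N : ℤ) + 1 - k) * (N + 1 - j * k)) ≥
          c' * ((N + 1) * (N + 1 - (j + 1) * k)) := by
        refine mul_le_mul_of_nonneg_left ?_ hc'
        nlinarith [show (0 : ℤ) ≤ k * (j * k) by positivity]
      have h₄ := mul_le_mul_of_nonneg_right ih (show (0 : ℤ) ≤ N + 1 by positivity)
      refine le_of_mul_le_mul_right (a := (N : ℤ) + 1) ?_ (by positivity)
      nlinarith

theorem choose_lt_of_card_bound {d K N T : ℕ} (hd : 1 ≤ d) (hK : 2 ≤ K) (hN : 2 * d * K ≤ N + K)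
    (h : K * (N.choose (d - 1) * (N - d + 2)) ≤
      T * (N - d + 2) + K * ((K - 1) * N.choose (d - 1))) :
    (N + K - 1).choose (d - 1) < T := by
  have hdN : d ≤ N := by nlinarith
  obtain ⟨j, rfl⟩ : ∃ j, K = j + 1 := ⟨K - 1, by omega⟩
  obtain ⟨k, rfl⟩ : ∃ k, d = k + 1 := ⟨d - 1, by omega⟩
  have hmon := choose_add_mul_le N k j
  have hpos : 0 < (N + j).choose k := Nat.choose_pos (by omega)
  rw [show N + (j + 1) - 1 = N + j by omega]
  simp only [Nat.add_sub_cancel] at h ⊢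
  obtain ⟨m, hm⟩ : ∃ m, m = N - (k + 1) + 2 := ⟨_, rfl⟩
  rw [← hm] at h
  have hNm : N + 1 = m + k := by omega
  have hmK : (j + 1) * (k + 1) < m := by nlinarith
  have hj : 1 ≤ j := by omega
  generalize (N + j).choose k = M at *
  generalize N.choose k = C at *
  zify at h hpos hNm hmK hj ⊢
  rw [hNm] at hmon
  have hk : (0 : ℤ) ≤ k := by positivity
  have hC : (0 : ℤ) ≤ C := by positivity
  by_contra hcon
  push Not at hcon
  have hmj : (0 : ℤ) < m - j := by nlinarith
  have h₁ : ((j : ℤ) + 1) * (m - j) * C ≤ M * m := by nlinarith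
  have h₂ : ((j : ℤ) + 1) * (m - j) * (M * (m + k - j * k)) ≤ M * m * (m + k) := by
    calc _ ≤ ((j : ℤ) + 1) * (m - j) * (C * (m + k)) := by gcongr
      _ = ((j : ℤ) + 1) * (m - j) * C * (m + k) := by ring
      _ ≤ _ := by gcongr
  have h₃ : ((j : ℤ) + 1) * (m - j) * (m + k - j * k) ≤ m * (m + k) :=
    le_of_mul_le_mul_left (by linarith) hpos
  have h₄ : ((m : ℤ) + k) * (m - j * (k + 1)) ≤ (m - j) * (m + k - j * k) := by
    nlinarith [mul_nonneg (mul_nonneg (show (0 : ℤ) ≤ j by positivity) hk) hk,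
      mul_nonneg (mul_nonneg (show (0 : ℤ) ≤ j by positivity) (show (0 : ℤ) ≤ j by positivity)) hk]
  have h₅ : (m : ℤ) < (j + 1) * (m - j * (k + 1)) := by nlinarith
  have h₆ : ((m : ℤ) + k) * m < (m + k) * ((j + 1) * (m - j * (k + 1))) :=
    mul_lt_mul_of_pos_left h₅ (by linarith)
  nlinarith

/-- Lemma 5.1.
Let `d ≥ 4`, `K ≥ 1`, and `n ≥ 2dK`. Let `P` be a set of `n` points in `ℝPᵈ` where every `d`
points span a hyperplane. If all but `K` points of `P` lie on a hyperplane, then `P` spans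
at least `C(n-1, d-1)` ordinary hyperplanes, with equality if and only if `K = 1`. -/
theorem hyperplane_configuration_lower_bound
    (d K n : ℕ) (hd : 4 ≤ d) (hK : 1 ≤ K) (hn : 2 * d * K ≤ n)
    (P : Set (PS ℝ d)) (hfin : P.Finite) (hcard : P.ncard = n) (hgp : SpanEveryd d P)
    (S : Set (PS ℝ d)) (hS : IsHypSet S) (hPS : (P \ S).ncard = K) :
    (n - 1).choose (d - 1) ≤ numHyp P d ∧
      (numHyp P d = (n - 1).choose (d - 1) ↔ K = 1) := by
  obtain ⟨W, hW, rfl⟩ := hS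
  lift P to Finset (PS ℝ d) using hfin
  rw [numHyp_eq_card_ordinarySubsets hgp]
  rw [Set.ncard_coe_finset] at hcard
  set Q : Finset (PS ℝ d) := {x ∈ P | x.submodule ≤ W} with hQdef
  set R : Finset (PS ℝ d) := {x ∈ P | ¬ x.submodule ≤ W} with hRdef
  have hPR : (↑P : Set (PS ℝ d)) \ {x | x.submodule ≤ W} = ↑R := by ext; simp [hRdef]
  rw [hPR, Set.ncard_coe_finset] at hPS
  have hQR : Q.card + K = n := by
    rw [← hPS, ← hcard]
    exact Finset.card_filter_add_card_filter_not _
  have hQP : Q ⊆ P := Finset.filter_subset _ _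
  have hQ : ∀ x ∈ Q, x.submodule ≤ W := by simp [hQdef]
  have hPU : P = Q ∪ R := (Finset.filter_union_filter_not_eq _ _).symm
  have hdQ : d < Q.card := by nlinarith
  have hbound := card_mul_le_ordinarySubsets_card hgp hQP (Finset.filter_subset _ _) hW hQ
    (by simp) (by omega) hdQ.le hPU
  rw [← hRdef, hPS] at hbound
  rcases hK.eq_or_lt with rfl | hK2
  · obtain ⟨p, hp⟩ := Finset.card_eq_one.1 hPS
    have hle := ordinarySubsets_card_le_of_insert hgp hQP hW hQ hdQ (p := p)
      (by rw [hPU, hp, Finset.union_comm]; rfl)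
    have hge : Q.card.choose (d - 1) ≤ (ordinarySubsets P).card :=
      Nat.le_of_mul_le_mul_right (c := Q.card - d + 2) (by simpa using hbound) (by omega)
    rw [show n - 1 = Q.card by omega]
    exact ⟨hge, iff_of_true (hle.antisymm hge) rfl⟩
  · have hlt := choose_lt_of_card_bound (by omega) hK2 (by omega) hbound
    rw [hQR] at hlt
    exact ⟨hlt.le, iff_of_false hlt.ne' (by omega)⟩
end
end
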